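/- arXiv:1106.0867 — 6 statements merged into one kernel-verified Lean document; each statement's English description precedes it below -/
import Mathlib

section
/- Let q be a power of a prime p with q ≡ 0 or ±1 (mod 5), and let Π be the set of ordered pairs (x, y) of elements of PSL(2, F_q) such that x has order 3, y has order 5, and xy has order 2. Identify PSL(2, F_q) with its image in PGL(2, F_q), so that PGL(2, F_q) acts on Π by simultaneous conjugation. Then this action is free (only the identity of PGL(2, F_q) fixes some pair in Π); it has exactly two orbits if p ≠ 5, and it is transitive (hence regular) if p = 5. -/
abbrev PGL2 (F : Type) [Field F] : Type :=
  Matrix.GeneralLinearGroup (Fin 2) F ⧸ Subgroup.center (Matrix.GeneralLinearGroup (Fin 2) F)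

/-- The image of `PSL(2, F)` in `PGL(2, F)`, i.e. the image of `SL(2, F) → GL(2, F) → PGL(2, F)`. -/
def pslInPGL (F : Type) [Field F] : Subgroup (PGL2 F) :=
  ((QuotientGroup.mk' (Subgroup.center (Matrix.GeneralLinearGroup (Fin 2) F))).comp
    Matrix.SpecialLinearGroup.toGL).range

/-- The pair `(x, y)` belongs to the set `Π`: both components lie in (the image of) `PSL(2, F)`,
`x` has order `3`, `y` has order `5` and `xy` has order `2`. -/
def MemPi (F : Type) [Field F] (x y : PGL2 F) : Prop :=
  x ∈ pslInPGL F ∧ y ∈ pslInPGL F ∧ orderOf x = 3 ∧ orderOf y = 5 ∧ orderOf (x * y) = 2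

/-- The pairs `(x, y)` and `(x', y')` are simultaneously conjugate under `PGL(2, F)`. -/
def PairConj (F : Type) [Field F] (x y x' y' : PGL2 F) : Prop :=
  ∃ g : PGL2 F, g * x * g⁻¹ = x' ∧ g * y * g⁻¹ = y'

section PGL

open Matrix

/-- The canonical map `SL(2, F) → PGL(2, F)`, whose range is `pslInPGL F`. -/
abbrev slToPGL (F : Type) [Field F] : Matrix.SpecialLinearGroup (Fin 2) F →* PGL2 F :=
  (QuotientGroup.mk' (Subgroup.center (Matrix.GeneralLinearGroup (Fin 2) F))).comp
    Matrix.SpecialLinearGroup.toGL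

variable {F : Type} [Field F]

lemma mk_eq_one_iff (A : GL (Fin 2) F) :
    (QuotientGroup.mk A : PGL2 F) = 1 ↔ ∃ c : F, A.val = c • (1 : Matrix (Fin 2) (Fin 2) F) := by
  rw [QuotientGroup.eq_one_iff, GeneralLinearGroup.mem_center_iff_val_mem_range_scalar]
  simp [eq_comm, Set.mem_range, ← Matrix.smul_one_eq_diagonal]

lemma mk_eq_mk_iff_smul (A B : GL (Fin 2) F) :
    (QuotientGroup.mk A : PGL2 F) = QuotientGroup.mk B ↔ ∃ c : F, B.val = c • A.val := by
  rw [QuotientGroup.eq, GeneralLinearGroup.mem_center_iff_val_mem_range_scalar]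
  constructor
  · rintro ⟨c, hc⟩
    refine ⟨c, ?_⟩
    have h : B.val = A.val * (A⁻¹ * B).val := by simp
    rw [h, ← hc]
    simp [← Matrix.smul_one_eq_diagonal]
  · rintro ⟨c, hc⟩
    refine ⟨c, ?_⟩
    rw [Units.val_mul, hc, Matrix.mul_smul, Units.inv_mul]
    simp [← Matrix.smul_one_eq_diagonal]

lemma slToPGL_pow_eq_one_iff (A : SpecialLinearGroup (Fin 2) F) (k : ℕ) :
    slToPGL F A ^ k = 1 ↔ ∃ c : F, A.val ^ k = c • (1 : Matrix (Fin 2) (Fin 2) F) := by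
  rw [← map_pow]
  exact mk_eq_one_iff _

lemma slToPGL_neg (A : SpecialLinearGroup (Fin 2) F) : slToPGL F (-A) = slToPGL F A := by
  refine (mk_eq_mk_iff_smul _ _).2 ⟨-1, ?_⟩
  ext i j
  simp

lemma exists_smul_of_conj {G : GL (Fin 2) F} {A B : SpecialLinearGroup (Fin 2) F}
    (h : (QuotientGroup.mk G : PGL2 F) * slToPGL F A * (QuotientGroup.mk G : PGL2 F)⁻¹
      = slToPGL F B) :
    ∃ c : F, c ^ 2 = 1 ∧ B.val.trace = c * A.val.trace ∧ B.val * G.val = c • (G.val * A.val) := by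
  rw [mul_inv_eq_iff_eq_mul] at h
  obtain ⟨c, hc⟩ := (mk_eq_mk_iff_smul (G * A.toGL) (B.toGL * G)).1 h
  have hc' : B.val * G.val = c • (G.val * A.val) := hc
  refine ⟨c, ?_, ?_, hc'⟩
  · have h2 := congrArg Matrix.det hc'
    rw [det_mul, det_smul, det_mul, A.2, B.2] at h2
    have := GeneralLinearGroup.det_ne_zero G
    simpa [this] using h2.symm
  · have h3 : B.val = c • (G.val * A.val * (G⁻¹).val) := by
      rw [← smul_mul_assoc, ← hc', mul_assoc, Units.mul_inv, mul_one]
    rw [h3, trace_smul, Matrix.trace_units_conj, smul_eq_mul]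

lemma conj_of_mul_eq {G : GL (Fin 2) F} {A B : SpecialLinearGroup (Fin 2) F}
    (h : B.val * G.val = G.val * A.val) :
    (QuotientGroup.mk G : PGL2 F) * slToPGL F A * (QuotientGroup.mk G : PGL2 F)⁻¹
      = slToPGL F B := by
  rw [mul_inv_eq_iff_eq_mul]
  exact (mk_eq_mk_iff_smul (G * A.toGL) (B.toGL * G)).2 ⟨1, by rw [one_smul]; exact h⟩

end PGL

section Traces

open Matrix

variable {F : Type} [Field F]

lemma sq_eq_of_det_eq_one {A : Matrix (Fin 2) (Fin 2) F} (h : A.det = 1) :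
    A ^ 2 = A.trace • A - 1 := by
  rw [det_fin_two] at h
  rw [Matrix.trace_fin_two, sq]
  ext i j
  fin_cases i <;> fin_cases j <;> simp [Matrix.mul_apply] <;> grind

lemma cube_eq_of_det_eq_one {A : Matrix (Fin 2) (Fin 2) F} (h : A.det = 1) :
    A ^ 3 = (A.trace ^ 2 - 1) • A - A.trace • (1 : Matrix (Fin 2) (Fin 2) F) := by
  rw [pow_succ, sq_eq_of_det_eq_one h, sub_mul, smul_mul_assoc, one_mul, ← sq,
    sq_eq_of_det_eq_one h]
  module

lemma pow_five_eq_of_det_eq_one {A : Matrix (Fin 2) (Fin 2) F} (h : A.det = 1) :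
    A ^ 5 = ((A.trace ^ 2 - A.trace - 1) * (A.trace ^ 2 + A.trace - 1)) • A
      - (A.trace ^ 3 - 2 * A.trace) • (1 : Matrix (Fin 2) (Fin 2) F) := by
  rw [show 5 = 3 + 1 + 1 from rfl, pow_succ, pow_succ, cube_eq_of_det_eq_one h]
  simp only [sub_mul, smul_mul_assoc, one_mul, ← sq, sq_eq_of_det_eq_one h, smul_sub]
  module

lemma eq_zero_of_smul_eq {A : Matrix (Fin 2) (Fin 2) F} {r s c : F}
    (hA : ¬ ∃ d : F, A = d • (1 : Matrix (Fin 2) (Fin 2) F))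
    (h : r • A - s • (1 : Matrix (Fin 2) (Fin 2) F) = c • 1) : r = 0 := by
  by_contra hr
  refine hA ⟨r⁻¹ * (c + s), ?_⟩
  rw [mul_smul, add_smul, ← h, sub_add_cancel, smul_smul, inv_mul_cancel₀ hr, one_smul]

lemma orderOf_slToPGL_iff (A : SpecialLinearGroup (Fin 2) F) (k : ℕ) [Fact k.Prime] :
    orderOf (slToPGL F A) = k ↔
      (∃ c : F, A.val ^ k = c • (1 : Matrix (Fin 2) (Fin 2) F)) ∧
      ¬ ∃ c : F, A.val = c • (1 : Matrix (Fin 2) (Fin 2) F) := by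
  rw [orderOf_eq_prime_iff, slToPGL_pow_eq_one_iff]
  exact and_congr_right fun _ => not_congr (mk_eq_one_iff A.toGL)

lemma orderOf_slToPGL_eq_two_iff (A : SpecialLinearGroup (Fin 2) F) :
    orderOf (slToPGL F A) = 2 ↔
      A.val.trace = 0 ∧ ¬ ∃ c : F, A.val = c • (1 : Matrix (Fin 2) (Fin 2) F) := by
  rw [orderOf_slToPGL_iff]
  refine and_congr_left fun hA => ⟨fun ⟨c, hc⟩ => ?_, fun h => ⟨-1, ?_⟩⟩
  · rw [sq_eq_of_det_eq_one A.2] at hc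
    exact eq_zero_of_smul_eq (s := 1) (c := c) hA (by rw [one_smul, hc])
  · rw [sq_eq_of_det_eq_one A.2, h]
    simp

lemma orderOf_slToPGL_eq_three_iff (A : SpecialLinearGroup (Fin 2) F) :
    orderOf (slToPGL F A) = 3 ↔
      A.val.trace ^ 2 = 1 ∧ ¬ ∃ c : F, A.val = c • (1 : Matrix (Fin 2) (Fin 2) F) := by
  rw [orderOf_slToPGL_iff]
  refine and_congr_left fun hA => ⟨fun ⟨c, hc⟩ => ?_, fun h => ⟨-A.val.trace, ?_⟩⟩
  · rw [cube_eq_of_det_eq_one A.2] at hc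
    exact sub_eq_zero.1 (eq_zero_of_smul_eq hA hc)
  · rw [cube_eq_of_det_eq_one A.2, h]
    simp

lemma orderOf_slToPGL_eq_five_iff (A : SpecialLinearGroup (Fin 2) F) :
    orderOf (slToPGL F A) = 5 ↔
      (A.val.trace ^ 2 - A.val.trace - 1) * (A.val.trace ^ 2 + A.val.trace - 1) = 0 ∧
      ¬ ∃ c : F, A.val = c • (1 : Matrix (Fin 2) (Fin 2) F) := by
  have : Fact (Nat.Prime 5) := ⟨by norm_num⟩
  rw [orderOf_slToPGL_iff]
  refine and_congr_left fun hA => ⟨fun ⟨c, hc⟩ => ?_,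
    fun h => ⟨-(A.val.trace ^ 3 - 2 * A.val.trace), ?_⟩⟩
  · rw [pow_five_eq_of_det_eq_one A.2] at hc
    exact eq_zero_of_smul_eq hA hc
  · rw [pow_five_eq_of_det_eq_one A.2, h, zero_smul, zero_sub, neg_smul]

end Traces

section NormalForm

open Matrix

variable {F : Type} [Field F]

/-- The companion matrix of `T ^ 2 - T + 1`. -/
def normalX (F : Type) [Field F] : SpecialLinearGroup (Fin 2) F :=
  ⟨!![0, -1; 1, 1], by simp [det_fin_two]⟩

/-- The general matrix `Y` of trace `t` and determinant `1` with `trace (normalX F * Y) = 0`. -/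
def normalY (a b t : F) (h : a * (t - a) - b * (b + t - a) = 1) :
    SpecialLinearGroup (Fin 2) F :=
  ⟨!![a, b; b + t - a, t - a], by simpa [det_fin_two] using h⟩

lemma coe_normalX : (normalX F).val = !![0, -1; 1, 1] := rfl

lemma coe_normalY (a b t : F) (h : a * (t - a) - b * (b + t - a) = 1) :
    (normalY a b t h).val = !![a, b; b + t - a, t - a] := rfl

lemma trace_normalX : (normalX F).val.trace = 1 := by
  simp [coe_normalX, trace_fin_two]

lemma trace_normalY (a b t : F) (h : a * (t - a) - b * (b + t - a) = 1) :
    (normalY a b t h).val.trace = t := by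
  simp [coe_normalY, trace_fin_two]

/-- A non-scalar matrix of trace and determinant `1` is conjugate to its companion matrix. -/
lemma exists_conj_normalX (A : SpecialLinearGroup (Fin 2) F) (ht : A.val.trace = 1)
    (hA : ¬ ∃ c : F, A.val = c • (1 : Matrix (Fin 2) (Fin 2) F)) :
    ∃ P : GL (Fin 2) F, P.val * (normalX F).val = A.val * P.val := by
  have hd : A.val 0 0 * A.val 1 1 - A.val 0 1 * A.val 1 0 = 1 := by
    rw [← det_fin_two]; exact A.2
  rw [trace_fin_two] at ht
  suffices ∃ v w : F, v * (A.val 1 0 * v + A.val 1 1 * w)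
      - (A.val 0 0 * v + A.val 0 1 * w) * w ≠ 0 by
    obtain ⟨v, w, hvw⟩ := this
    refine ⟨GeneralLinearGroup.mkOfDetNeZero
      !![v, A.val 0 0 * v + A.val 0 1 * w; w, A.val 1 0 * v + A.val 1 1 * w]
      (by simpa [det_fin_two] using hvw), ?_⟩
    change !![v, A.val 0 0 * v + A.val 0 1 * w; w, A.val 1 0 * v + A.val 1 1 * w] * _ = _ *
      !![v, A.val 0 0 * v + A.val 0 1 * w; w, A.val 1 0 * v + A.val 1 1 * w]
    rw [coe_normalX]
    ext i j
    fin_cases i <;> fin_cases j <;> simp [Matrix.mul_apply] <;> grind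
  by_contra! hall
  refine hA ⟨A.val 0 0, ?_⟩
  have h1 := hall 1 0
  have h2 := hall 0 1
  have h3 := hall 1 1
  ext i j
  fin_cases i <;> fin_cases j <;> simp <;> grind

/-- A matrix is determined up to the parameters `a`, `b` by its trace, its determinant and the
trace of its product with `normalX F`. -/
lemma exists_eq_normalY (B : SpecialLinearGroup (Fin 2) F)
    (h : ((normalX F).val * B.val).trace = 0) :
    ∃ a b h, B = normalY a b B.val.trace h := by
  have hd : B.val 0 0 * B.val 1 1 - B.val 0 1 * B.val 1 0 = 1 := by
    rw [← det_fin_two]; exact B.2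
  rw [coe_normalX, trace_fin_two] at h
  simp [Matrix.mul_apply] at h
  refine ⟨B.val 0 0, B.val 0 1, ?_, ?_⟩
  · rw [trace_fin_two]
    grind
  · apply Subtype.ext
    rw [coe_normalY, trace_fin_two]
    ext i j
    fin_cases i <;> fin_cases j <;> simp <;> grind

lemma sq_ne_three {t : F} (ht : t ^ 2 - t - 1 = 0) : t ^ 2 ≠ 3 := by
  intro h
  have h2 : t = 2 := by linear_combination h - ht
  rw [h2] at h
  exact one_ne_zero (α := F) (by linear_combination h)

lemma eq_of_isotropic {t a b a' b' : F} (ht : t ^ 2 - t - 1 = 0)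
    (h : a * (t - a) - b * (b + t - a) = 1) (h' : a' * (t - a') - b' * (b' + t - a') = 1)
    (hN : (b + t - a + b') ^ 2 + (b + t - a + b') * (a - a') + (a - a') ^ 2 = 0) :
    a = a' := by
  by_contra hne
  have hv : a - a' ≠ 0 := sub_ne_zero.2 hne
  obtain ⟨k, hk⟩ : ∃ k, b + t - a' + b' = k * (a - a') := ⟨_, (div_mul_cancel₀ _ hv).symm⟩
  have hk2 : k ^ 2 - k + 1 = 0 := by
    have : (a - a') ^ 2 * (k ^ 2 - k + 1) = 0 := by
      rw [← hN, show b + t - a + b' = k * (a - a') - (a - a') by rw [← hk]; ring]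
      ring
    simpa [hv] using this
  obtain ⟨c, rfl⟩ : ∃ c, b' = a' - t - c := ⟨a' - t - b', by ring⟩
  obtain rfl : b = c + k * (a - a') := by linear_combination hk
  obtain ⟨d, rfl⟩ : ∃ d, a = a' + d := ⟨a - a', by ring⟩
  have hd : d ≠ 0 := by simpa using hv
  have h1 : (2 * a' - c - t) + k * (2 * c - a' + t) = 0 := by
    apply mul_left_cancel₀ hd
    linear_combination h' - h - d ^ 2 * hk2
  have h2 : (1 + k) * (a' - (1 - k) * c) = t := by
    linear_combination k * h1 + (a' - c - t) * hk2
  have h3 : k * (a' - (1 - k) * c) ^ 2 = 1 := by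
    linear_combination h' + (a' - c) * h2 + (c ^ 2 + (a' - (1 - k) * c) * c) * hk2
  refine sq_ne_three ht ?_
  rw [← h2]
  linear_combination 3 * h3 + (a' - (1 - k) * c) ^ 2 * hk2

lemma exists_intertwiner_normalY {t a b a' b' : F} (ht : t ^ 2 - t - 1 = 0)
    (h : a * (t - a) - b * (b + t - a) = 1) (h' : a' * (t - a') - b' * (b' + t - a') = 1) :
    ∃ u v : F, u ^ 2 + u * v + v ^ 2 ≠ 0 ∧
      u * (a - a') = v * (b + t - a + b') ∧ u * (b - b') = v * (t - a - a' + b') := by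
  by_cases hN : (b + t - a + b') ^ 2 + (b + t - a + b') * (a - a') + (a - a') ^ 2 = 0
  · obtain rfl := eq_of_isotropic ht h h' hN
    obtain rfl : b' = a - t - b := by
      have : b + t - a + b' = 0 := by simpa using hN
      linear_combination this
    refine ⟨t - a - a + (a - t - b), b - (a - t - b), fun h0 => sq_ne_three ht ?_, by ring, by ring⟩
    linear_combination h0 + 3 * h
  · have key : (b + t - a + b') * (b - b') = (a - a') * (t - a - a' + b') := by
      linear_combination h' - h
    exact ⟨b + t - a + b', a - a', hN, by ring, key⟩

/-- Two normal forms with the same trace parameter are conjugate by an element centralising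
`normalX F`. -/
lemma exists_conj_normal {t a b a' b' : F} (ht : t ^ 2 - t - 1 = 0)
    (h : a * (t - a) - b * (b + t - a) = 1) (h' : a' * (t - a') - b' * (b' + t - a') = 1) :
    ∃ G : GL (Fin 2) F, (normalX F).val * G.val = G.val * (normalX F).val ∧
      (normalY a' b' t h').val * G.val = G.val * (normalY a b t h).val := by
  obtain ⟨u, v, hN, h1, h2⟩ := exists_intertwiner_normalY ht h h'
  let M : Matrix (Fin 2) (Fin 2) F := !![u, -v; v, u + v]
  refine ⟨GeneralLinearGroup.mkOfDetNeZero M ?_, ?_, ?_⟩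
  · rw [det_fin_two_of]
    contrapose! hN
    linear_combination hN
  · change _ * M = M * _
    rw [coe_normalX]
    ext i j
    fin_cases i <;> fin_cases j <;> simp [M, Matrix.mul_apply] <;> ring
  · change _ * M = M * _
    rw [coe_normalY, coe_normalY]
    ext i j
    fin_cases i <;> fin_cases j <;> simp [M, Matrix.mul_apply] <;> grind

/-- The normal form pair has trivial centraliser. -/
lemma eq_smul_one_of_commute_normal {t a b : F} (ht : t ^ 2 - t - 1 = 0)
    (h : a * (t - a) - b * (b + t - a) = 1) (M : Matrix (Fin 2) (Fin 2) F)
    (hX : (normalX F).val * M = M * (normalX F).val)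
    (hY : (normalY a b t h).val * M = M * (normalY a b t h).val) :
    ∃ c : F, M = c • (1 : Matrix (Fin 2) (Fin 2) F) := by
  rw [coe_normalX] at hX
  rw [coe_normalY] at hY
  have x00 := congrFun (congrFun hX 0) 0
  have x10 := congrFun (congrFun hX 1) 0
  have y00 := congrFun (congrFun hY 0) 0
  have y01 := congrFun (congrFun hY 0) 1
  simp [Matrix.mul_apply] at x00 x10 y00 y01
  have hv : M 1 0 = 0 := by
    by_contra hv
    have e1 : 2 * b + t - a = 0 := by
      apply mul_left_cancel₀ hv
      linear_combination y00 - (b + t - a) * x00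
    have e2 : t - 2 * a + b = 0 := by
      apply mul_left_cancel₀ hv
      linear_combination y01 + b * x10 + (2 * a - t) * x00
    refine sq_ne_three ht ?_
    grind
  refine ⟨M 0 0, ?_⟩
  ext i j
  fin_cases i <;> fin_cases j <;> simp <;> grind

/-- The conic parametrising the normal forms has a rational point over a finite field. -/
lemma exists_normalY_params [Fintype F] {t : F} (ht : t ^ 2 - t - 1 = 0) :
    ∃ a b : F, a * (t - a) - b * (b + t - a) = 1 := by
  by_cases h2 : (2 : F) = 0
  · exact ⟨1, 1, by linear_combination -h2⟩
  have h4 : (4 : F) ≠ 0 := by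
    rw [show (4 : F) = 2 * 2 by norm_num]
    exact mul_ne_zero h2 h2
  suffices ∃ z b : F, z ^ 2 + (3 * b ^ 2 + 2 * t * b + (4 - t ^ 2)) = 0 by
    obtain ⟨z, b, h⟩ := this
    refine ⟨(z + b + t) / 2, b, ?_⟩
    apply mul_left_cancel₀ h4
    field_simp
    linear_combination -h
  by_cases h3 : (3 : F) = 0
  · have ht0 : t ≠ 0 := by rintro rfl; simp at ht
    refine ⟨0, (t ^ 2 - 4) / (2 * t), ?_⟩
    rw [h3]
    field_simp
    ring
  · have hodd : Fintype.card F % 2 = 1 := by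
      refine FiniteField.odd_card_of_char_ne_two fun hc => h2 ?_
      have := ringChar.Nat.cast_ringChar (R := F)
      rw [hc] at this
      exact_mod_cast this
    obtain ⟨z, b, h⟩ := FiniteField.exists_root_sum_quadratic
      (f := (Polynomial.X ^ 2 : Polynomial F))
      (g := Polynomial.C 3 * Polynomial.X ^ 2 + Polynomial.C (2 * t) * Polynomial.X
        + Polynomial.C (4 - t ^ 2))
      (Polynomial.degree_X_pow 2) (Polynomial.degree_quadratic h3) hodd
    exact ⟨z, b, by simpa using h⟩

end NormalForm

section GoldenRatio

open Polynomial in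
/-- An element of an extension of a finite field `F` fixed by the Frobenius of `F` lies in `F`. -/
lemma exists_algebraMap_eq_of_pow_card_eq {F K : Type*} [Field F] [Fintype F] [Field K]
    [Algebra F K] {s : K} (hs : s ^ Fintype.card F = s) : ∃ t : F, algebraMap F K t = s := by
  have hroots := FiniteField.roots_X_pow_card_sub_X F
  have hdeg := FiniteField.X_pow_card_sub_X_natDegree_eq F (Fintype.one_lt_card (α := F))
  have hmonic : (X ^ Fintype.card F - X : F[X]).Monic :=
    monic_X_pow_sub (by rw [degree_X]; exact_mod_cast Fintype.one_lt_card)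
  have hprod := prod_multiset_X_sub_C_of_monic_of_roots_card_eq hmonic
    (by rw [hroots, hdeg]; rfl)
  have h0 : aeval s (X ^ Fintype.card F - X : F[X]) = 0 := by simp [hs]
  rw [← hprod, hroots, map_multiset_prod, Multiset.prod_eq_zero_iff] at h0
  simp only [Multiset.map_map, Multiset.mem_map, Function.comp_apply] at h0
  obtain ⟨t, -, ht⟩ := h0
  exact ⟨t, (by simpa [sub_eq_zero] using ht : s = _).symm⟩

/-- A finite field with `q ≡ ±1 (mod 5)` elements contains the roots of `T ^ 2 - T - 1`. -/
lemma exists_sq_sub_sub_one_eq_zero (F : Type*) [Field F] [Fintype F]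
    (hq : Fintype.card F % 5 = 1 ∨ Fintype.card F % 5 = 4) : ∃ t : F, t ^ 2 - t - 1 = 0 := by
  have h5 : (5 : F) ≠ 0 := by
    intro h
    have hdvd : ringChar F ∣ 5 := ringChar.dvd (by exact_mod_cast h)
    obtain ⟨n, hp, hn⟩ := FiniteField.card F (ringChar F)
    have : ringChar F = 5 := (Nat.prime_dvd_prime_iff_eq hp (by norm_num)).1 hdvd
    rw [this] at hn
    have : 5 ∣ Fintype.card F := hn ▸ dvd_pow_self 5 n.ne_zero
    omega
  let K := AlgebraicClosure F
  have : NeZero ((5 : ℕ) : K) := ⟨by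
    rw [← map_natCast (algebraMap F K) 5]
    exact (map_ne_zero (algebraMap F K)).2 (by exact_mod_cast h5)⟩
  obtain ⟨z, hz⟩ := HasEnoughRootsOfUnity.exists_primitiveRoot K 5
  have hz5 : z ^ 5 = 1 := hz.pow_eq_one
  have hz1 : z ≠ 1 := hz.ne_one (by norm_num)
  have hsum : z ^ 4 + z ^ 3 + z ^ 2 + z + 1 = 0 := by
    apply mul_left_cancel₀ (sub_ne_zero.2 hz1)
    linear_combination hz5
  let φ : K →+* K := (FiniteField.frobeniusAlgHom F K).toRingHom
  have hφ : ∀ x : K, φ x = x ^ Fintype.card F := fun x => rfl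
  have hfix : (-(z + z ^ 4)) ^ Fintype.card F = -(z + z ^ 4) := by
    rw [← hφ, map_neg, map_add, map_pow, hφ, ← Nat.div_add_mod (Fintype.card F) 5, pow_add,
      pow_mul, hz5, one_pow, one_mul]
    rcases hq with h | h <;> rw [h]
    · rw [pow_one]
    · linear_combination (-z ^ 11 - z ^ 6 - z) * hz5
  obtain ⟨t, ht⟩ := exists_algebraMap_eq_of_pow_card_eq hfix
  refine ⟨t, (algebraMap F K).injective ?_⟩
  simp only [map_sub, map_pow, map_one, map_zero, ht]
  linear_combination hsum + (z ^ 3 + 2) * hz5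

end GoldenRatio

section Pairs

open Matrix

variable {F : Type} [Field F]

lemma val_mul (A B : SpecialLinearGroup (Fin 2) F) : (A * B).val = A.val * B.val := rfl

/-- The pair of elements of `PGL(2, F)` represented by the normal forms lies in `Π`. -/
lemma memPi_normal (h5 : (5 : F) ≠ 0) {t a b : F} (ht : t ^ 2 - t - 1 = 0)
    (h : a * (t - a) - b * (b + t - a) = 1) :
    MemPi F (slToPGL F (normalX F)) (slToPGL F (normalY a b t h)) := by
  refine ⟨⟨_, rfl⟩, ⟨_, rfl⟩, ?_, ?_, ?_⟩
  · rw [orderOf_slToPGL_eq_three_iff, trace_normalX]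
    refine ⟨one_pow 2, ?_⟩
    rintro ⟨c, hc⟩
    have := congrFun (congrFun hc 1) 0
    simp [coe_normalX] at this
  · rw [orderOf_slToPGL_eq_five_iff, trace_normalY, ht, zero_mul]
    refine ⟨rfl, ?_⟩
    rintro ⟨c, hc⟩
    have h00 := congrFun (congrFun hc 0) 0
    have h01 := congrFun (congrFun hc 0) 1
    have h10 := congrFun (congrFun hc 1) 0
    simp [coe_normalY] at h00 h01 h10
    have h11 := congrFun (congrFun hc 1) 1
    simp [coe_normalY] at h11
    refine h5 ?_
    grind
  · rw [← map_mul, orderOf_slToPGL_eq_two_iff, val_mul, coe_normalX, coe_normalY]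
    refine ⟨by simp [trace_fin_two]; ring, ?_⟩
    rintro ⟨c, hc⟩
    have h00 := congrFun (congrFun hc 0) 0
    have h01 := congrFun (congrFun hc 0) 1
    have h10 := congrFun (congrFun hc 1) 0
    have h11 := congrFun (congrFun hc 1) 1
    simp [Matrix.mul_apply] at h00 h01 h10 h11
    grind

/-- Every pair in `Π` is simultaneously conjugate to a pair in normal form. -/
lemma exists_pairConj_normal {x y : PGL2 F} (hxy : MemPi F x y) :
    ∃ (t a b : F) (_ : t ^ 2 - t - 1 = 0) (h : a * (t - a) - b * (b + t - a) = 1),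
      PairConj F (slToPGL F (normalX F)) (slToPGL F (normalY a b t h)) x y := by
  obtain ⟨⟨A₀, hA₀⟩, ⟨B₀, hB₀⟩, hx, hy, hz⟩ := hxy
  obtain ⟨A, rfl, hA⟩ : ∃ A, slToPGL F A = x ∧ A.val.trace = 1 := by
    rw [← hA₀] at hx
    rcases sq_eq_one_iff.1 ((orderOf_slToPGL_eq_three_iff A₀).1 hx).1 with h | h
    · exact ⟨A₀, hA₀, h⟩
    · exact ⟨-A₀, (slToPGL_neg A₀).trans hA₀, by
        rw [SpecialLinearGroup.coe_neg, trace_neg, h, neg_neg]⟩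
  obtain ⟨B, rfl, hB⟩ : ∃ B, slToPGL F B = y ∧ B.val.trace ^ 2 - B.val.trace - 1 = 0 := by
    rw [← hB₀] at hy
    rcases mul_eq_zero.1 ((orderOf_slToPGL_eq_five_iff B₀).1 hy).1 with h | h
    · exact ⟨B₀, hB₀, h⟩
    · exact ⟨-B₀, (slToPGL_neg B₀).trans hB₀, by
        rw [SpecialLinearGroup.coe_neg, trace_neg, ← h]; ring⟩
  rw [← map_mul] at hz
  have hz0 := ((orderOf_slToPGL_eq_two_iff _).1 hz).1
  obtain ⟨P, hP⟩ := exists_conj_normalX A hA ((orderOf_slToPGL_eq_three_iff A).1 hx).2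
  let B' : SpecialLinearGroup (Fin 2) F := ⟨(P⁻¹).val * B.val * P.val, by
    rw [Matrix.det_mul_comm, ← mul_assoc, Units.mul_inv, one_mul]; exact B.2⟩
  have hBP : B.val * P.val = P.val * B'.val := by
    simp only [B', ← mul_assoc, Units.mul_inv, one_mul]
  have hXP : (normalX F).val = (P⁻¹).val * A.val * P.val := by
    rw [mul_assoc, ← hP, ← mul_assoc, Units.inv_mul, one_mul]
  have htr : B'.val.trace = B.val.trace := by
    simp only [B']
    rw [trace_mul_comm, ← mul_assoc, Units.mul_inv, one_mul]
  have hXB : ((normalX F).val * B'.val).trace = 0 := by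
    rw [hXP, mul_assoc, ← hBP, mul_assoc, trace_mul_comm]
    rw [← hz0, val_mul]
    simp only [mul_assoc, Units.mul_inv, mul_one]
  obtain ⟨a, b, h, hB'⟩ := exists_eq_normalY B' hXB
  refine ⟨B'.val.trace, a, b, by rw [htr]; exact hB, h, QuotientGroup.mk P, ?_, ?_⟩
  · exact conj_of_mul_eq hP.symm
  · rw [← hB']
    exact conj_of_mul_eq hBP

lemma PairConj.symm {x y x' y' : PGL2 F} (h : PairConj F x y x' y') : PairConj F x' y' x y := by
  obtain ⟨g, rfl, rfl⟩ := h
  exact ⟨g⁻¹, by group, by group⟩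

lemma PairConj.trans {x y x' y' x'' y'' : PGL2 F} (h : PairConj F x y x' y')
    (h' : PairConj F x' y' x'' y'') : PairConj F x y x'' y'' := by
  obtain ⟨g, rfl, rfl⟩ := h
  obtain ⟨g', rfl, rfl⟩ := h'
  exact ⟨g' * g, by group, by group⟩

lemma pairConj_normal_of_trace_eq {t a b a' b' : F} (ht : t ^ 2 - t - 1 = 0)
    (h : a * (t - a) - b * (b + t - a) = 1) (h' : a' * (t - a') - b' * (b' + t - a') = 1) :
    PairConj F (slToPGL F (normalX F)) (slToPGL F (normalY a b t h))
      (slToPGL F (normalX F)) (slToPGL F (normalY a' b' t h')) := by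
  obtain ⟨G, h1, h2⟩ := exists_conj_normal ht h h'
  exact ⟨QuotientGroup.mk G, conj_of_mul_eq h1, conj_of_mul_eq h2⟩

/-- Conjugate normal forms have the same trace parameter. -/
lemma trace_eq_of_pairConj_normal {t a b t' a' b' : F} (ht : t ^ 2 - t - 1 = 0)
    (ht' : t' ^ 2 - t' - 1 = 0)
    (h : a * (t - a) - b * (b + t - a) = 1) (h' : a' * (t' - a') - b' * (b' + t' - a') = 1)
    (hc : PairConj F (slToPGL F (normalX F)) (slToPGL F (normalY a b t h))
      (slToPGL F (normalX F)) (slToPGL F (normalY a' b' t' h'))) : t = t' := by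
  obtain ⟨g, -, hg⟩ := hc
  obtain ⟨G, rfl⟩ := QuotientGroup.mk_surjective g
  obtain ⟨c, hc, htr, -⟩ := exists_smul_of_conj hg
  rw [trace_normalY, trace_normalY] at htr
  subst htr
  linear_combination ht' - ht - t ^ 2 * hc

lemma eq_one_of_conj_normal {t a b : F} (ht : t ^ 2 - t - 1 = 0)
    (h : a * (t - a) - b * (b + t - a) = 1) {g : PGL2 F}
    (hX : g * slToPGL F (normalX F) * g⁻¹ = slToPGL F (normalX F))
    (hY : g * slToPGL F (normalY a b t h) * g⁻¹ = slToPGL F (normalY a b t h)) : g = 1 := by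
  obtain ⟨G, rfl⟩ := QuotientGroup.mk_surjective g
  obtain ⟨c, -, hc, hcX⟩ := exists_smul_of_conj hX
  obtain ⟨d, -, hd, hdY⟩ := exists_smul_of_conj hY
  rw [trace_normalX, mul_one] at hc
  rw [trace_normalY] at hd
  have ht0 : t ≠ 0 := by rintro rfl; simp at ht
  have hd1 : d = 1 := (mul_eq_right₀ ht0).1 hd.symm
  rw [← hc, one_smul] at hcX
  rw [hd1, one_smul] at hdY
  exact (mk_eq_one_iff G).2 (eq_smul_one_of_commute_normal ht h G.val hcX hdY)

/-- The action of `PGL(2, F)` on `Π` is free. -/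
lemma eq_one_of_conj_eq {x y g : PGL2 F} (hxy : MemPi F x y) (hx : g * x * g⁻¹ = x)
    (hy : g * y * g⁻¹ = y) : g = 1 := by
  obtain ⟨t, a, b, ht, h, k, rfl, rfl⟩ := exists_pairConj_normal hxy
  have aux : ∀ z : PGL2 F, g * (k * z * k⁻¹) * g⁻¹ = k * z * k⁻¹ →
      k⁻¹ * g * k * z * (k⁻¹ * g * k)⁻¹ = z := fun z hz => by
    calc k⁻¹ * g * k * z * (k⁻¹ * g * k)⁻¹ = k⁻¹ * (g * (k * z * k⁻¹) * g⁻¹) * k := by group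
      _ = z := by rw [hz]; group
  have h1 := eq_one_of_conj_normal ht h (aux _ hx) (aux _ hy)
  rwa [mul_assoc, inv_mul_eq_one, right_eq_mul] at h1

end Pairs

theorem stmt_9 (p n : ℕ) [Fact p.Prime] (hn : 0 < n)
    (hq : p ^ n % 5 = 0 ∨ p ^ n % 5 = 1 ∨ p ^ n % 5 = 4) :
    (∀ g x y : PGL2 (GaloisField p n), MemPi (GaloisField p n) x y →
        g * x * g⁻¹ = x → g * y * g⁻¹ = y → g = 1) ∧
    (p ≠ 5 → ∃ x₁ y₁ x₂ y₂ : PGL2 (GaloisField p n),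
        MemPi (GaloisField p n) x₁ y₁ ∧ MemPi (GaloisField p n) x₂ y₂ ∧
        ¬ PairConj (GaloisField p n) x₁ y₁ x₂ y₂ ∧
        ∀ x y : PGL2 (GaloisField p n), MemPi (GaloisField p n) x y →
          PairConj (GaloisField p n) x₁ y₁ x y ∨ PairConj (GaloisField p n) x₂ y₂ x y) ∧
    (p = 5 → ∀ x y x' y' : PGL2 (GaloisField p n),
        MemPi (GaloisField p n) x y → MemPi (GaloisField p n) x' y' →
        PairConj (GaloisField p n) x y x' y') := by
  have hcard : Nat.card (GaloisField p n) = p ^ n := GaloisField.card p n hn.ne'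
  have : Fintype (GaloisField p n) := Fintype.ofFinite _
  rw [← hcard, Nat.card_eq_fintype_card] at hq
  refine ⟨fun g x y hxy => eq_one_of_conj_eq hxy, fun hp => ?_, fun hp x y x' y' h h' => ?_⟩
  · have h5 : (5 : GaloisField p n) ≠ 0 := by
      intro h
      have hdvd : p ∣ 5 := (CharP.cast_eq_zero_iff (GaloisField p n) p 5).1 (by exact_mod_cast h)
      exact hp ((Nat.prime_dvd_prime_iff_eq Fact.out (by norm_num)).1 hdvd)
    have hq' : Fintype.card (GaloisField p n) % 5 ≠ 0 := by
      intro h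
      rw [← Nat.card_eq_fintype_card, hcard] at h
      have hdvd := Nat.Prime.dvd_of_dvd_pow (by norm_num) (Nat.dvd_of_mod_eq_zero h)
      exact hp ((Nat.prime_dvd_prime_iff_eq (by norm_num) Fact.out).1 hdvd).symm
    obtain ⟨t, ht⟩ := exists_sq_sub_sub_one_eq_zero _ (hq.resolve_left hq')
    have ht' : (1 - t) ^ 2 - (1 - t) - 1 = 0 := by linear_combination ht
    obtain ⟨a, b, h⟩ := exists_normalY_params ht
    obtain ⟨a', b', h'⟩ := exists_normalY_params ht'
    refine ⟨_, _, _, _, memPi_normal h5 ht h, memPi_normal h5 ht' h', fun hc => h5 ?_,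
      fun x y hxy => ?_⟩
    · have := trace_eq_of_pairConj_normal ht ht' h h' hc
      linear_combination -4 * ht + (2 * t - 1) * this
    · obtain ⟨s, c, d, hs, hcd, hconj⟩ := exists_pairConj_normal hxy
      have : (s - t) * (s - (1 - t)) = 0 := by linear_combination hs - ht
      rcases mul_eq_zero.1 this with hst | hst
      · obtain rfl := sub_eq_zero.1 hst
        exact Or.inl ((pairConj_normal_of_trace_eq hs h hcd).trans hconj)
      · obtain rfl := sub_eq_zero.1 hst
        exact Or.inr ((pairConj_normal_of_trace_eq hs h' hcd).trans hconj)
  · have h5 : (5 : GaloisField p n) = 0 := by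
      subst hp
      exact_mod_cast CharP.cast_eq_zero (GaloisField 5 n) 5
    have eq_three : ∀ s : GaloisField p n, s ^ 2 - s - 1 = 0 → s = 3 := fun s hs => by
      have : (s - 3) ^ 2 = 0 := by linear_combination hs + (2 - s) * h5
      exact sub_eq_zero.1 (pow_eq_zero_iff two_ne_zero |>.1 this)
    obtain ⟨t, a, b, ht, hab, hc⟩ := exists_pairConj_normal h
    obtain ⟨t', a', b', ht', hab', hc'⟩ := exists_pairConj_normal h'
    obtain rfl : t' = t := (eq_three t' ht').trans (eq_three t ht).symm
    exact hc.symm.trans ((pairConj_normal_of_trace_eq ht hab hab').trans hc')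
end

section
/- Let p be a prime with p ≠ 2 and p ≠ 5, and let F̄ be an algebraic closure of F_p. Then any two subgroups of PSL(2, F̄) that are isomorphic to the alternating group A₅ are conjugate in PSL(2, F̄). -/
open Matrix

section FieldLemmas

variable {k : Type*} [Field k]

/-- A pair of matrices in `SL₂` with traces `0`, `1` and `z`, where `z ^ 2 = z + 1`, has a
normal form depending only on `z` and a chosen square root of `-1`. -/
lemma exists_basis_normal_form (X Y : Matrix.SpecialLinearGroup (Fin 2) k) (e z : k) (he : e ^ 2 = -1)
    (hz : z ^ 2 = z + 1) (hX : X.1.trace = 0) (hY : Y.1.trace = 1)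
    (hXY : (X.1 * Y.1).trace = z) :
    ∃ Q : Matrix (Fin 2) (Fin 2) k, Q.det ≠ 0 ∧
      X.1 * Q = Q * !![e, z + e; 0, -e] ∧ Y.1 * Q = Q * !![0, -1; 1, 1] := by
  obtain ⟨X, hX1⟩ := X
  obtain ⟨Y, hY1⟩ := Y
  obtain ⟨v, hv0, hv⟩ : ∃ v ≠ 0, (X - e • (1 : Matrix (Fin 2) (Fin 2) k)) *ᵥ v = 0 := by
    rw [exists_mulVec_eq_zero_iff]
    simp only [det_fin_two, trace_fin_two] at hX1 hX
    simp [det_fin_two]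
    linear_combination hX1 + he - e * hX
  have hv1 := congrFun hv 0
  have hv2 := congrFun hv 1
  have hne : v 0 ≠ 0 ∨ v 1 ≠ 0 := by
    by_contra! h
    exact hv0 (by ext i; fin_cases i <;> simp [h])
  simp only [det_fin_two, trace_fin_two, mul_apply, Fin.sum_univ_two] at hX1 hY1 hX hY hXY
  simp [mulVec, dotProduct, Fin.sum_univ_two] at hv1 hv2
  clear hv hv0
  change ∃ Q : Matrix (Fin 2) (Fin 2) k, Q.det ≠ 0 ∧
    X * Q = Q * !![e, z + e; 0, -e] ∧ Y * Q = Q * !![0, -1; 1, 1]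
  rw [eta_fin_two X, eta_fin_two Y]
  generalize v 0 = p at *
  generalize v 1 = q at *
  generalize X 0 0 = a, X 0 1 = b, X 1 0 = c, X 1 1 = d at *
  generalize Y 0 0 = u, Y 0 1 = s, Y 1 0 = w, Y 1 1 = t at *
  obtain rfl : d = -a := by linear_combination hX
  obtain rfl : t = 1 - u := by linear_combination hY
  have hXY1 : a * (u * p + s * q) + b * (w * p + (1 - u) * q)
      = (z + e) * p - e * (u * p + s * q) := by
    linear_combination p * hXY - u * hv1 - s * hv2 + hv1
  have hXY2 : c * (u * p + s * q) - a * (w * p + (1 - u) * q)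
      = (z + e) * q - e * (w * p + (1 - u) * q) := by
    linear_combination q * hXY - w * hv1 - (1 - u) * hv2 + hv2
  have hYY1 : u * (u * p + s * q) + s * (w * p + (1 - u) * q) = -p + (u * p + s * q) := by
    linear_combination -p * hY1
  have hYY2 : w * (u * p + s * q) + (1 - u) * (w * p + (1 - u) * q)
      = -q + (w * p + (1 - u) * q) := by
    linear_combination -q * hY1
  refine ⟨!![p, u * p + s * q; q, w * p + (1 - u) * q], ?_, ?_, ?_⟩
  · rw [det_fin_two_of]
    intro hdet
    obtain ⟨l, hl1, hl2⟩ : ∃ l, u * p + s * q = l * p ∧ w * p + (1 - u) * q = l * q := by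
      rcases hne with h | h
      · refine ⟨(u * p + s * q) / p, by field_simp, ?_⟩
        field_simp
        linear_combination hdet
      · refine ⟨(w * p + (1 - u) * q) / q, ?_, by field_simp⟩
        field_simp
        linear_combination -hdet
    rw [hl1, hl2] at hXY1 hXY2 hYY1 hYY2
    have key : l ^ 2 - l + 1 = 0 ∧ z + e - 2 * e * l = 0 := by
      rcases hne with h | h
      · constructor <;> apply mul_right_cancel₀ h
        · linear_combination hYY1 - l * hl1
        · linear_combination -hXY1 + l * hv1
      · constructor <;> apply mul_right_cancel₀ h
        · linear_combination hYY2 - l * hl2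
        · linear_combination -hXY2 + l * hv2
    obtain ⟨hl, hze⟩ := key
    have hz3 : z ^ 2 = 3 := by
      linear_combination (z + e * (2 * l - 1)) * hze + (2 * l - 1) ^ 2 * he - 4 * hl
    have hz2 : z = 2 := by linear_combination hz3 - hz
    rw [hz2] at hz3
    exact one_ne_zero (α := k) (by linear_combination hz3)
  · ext i j
    fin_cases i <;> fin_cases j <;> simp [mul_apply, Fin.sum_univ_two]
    · linear_combination hv1
    · linear_combination hXY1
    · linear_combination hv2
    · linear_combination hXY2
  · ext i j
    fin_cases i <;> fin_cases j <;> simp [mul_apply, Fin.sum_univ_two]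
    · linear_combination hYY1
    · linear_combination hYY2

lemma exists_conj_of_trace_eq [IsAlgClosed k] (X Y X' Y' : Matrix.SpecialLinearGroup (Fin 2) k) (z : k)
    (hz : z ^ 2 = z + 1) (hX : X.1.trace = 0) (hY : Y.1.trace = 1)
    (hXY : (X.1 * Y.1).trace = z) (hX' : X'.1.trace = 0) (hY' : Y'.1.trace = 1)
    (hXY' : (X'.1 * Y'.1).trace = z) :
    ∃ P : Matrix.SpecialLinearGroup (Fin 2) k, P * X * P⁻¹ = X' ∧ P * Y * P⁻¹ = Y' := by
  obtain ⟨e, he⟩ := IsAlgClosed.exists_pow_nat_eq (-1 : k) two_pos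
  obtain ⟨Q, hQ, hQX, hQY⟩ := exists_basis_normal_form X Y e z he hz hX hY hXY
  obtain ⟨Q', hQ', hQX', hQY'⟩ := exists_basis_normal_form X' Y' e z he hz hX' hY' hXY'
  obtain ⟨r, hr⟩ := IsAlgClosed.exists_pow_nat_eq (Q.det * Q'.det⁻¹) two_pos
  have hunit : IsUnit Q.det := hQ.isUnit
  have comm (M M' A : Matrix (Fin 2) (Fin 2) k) (h : M * Q = Q * A) (h' : M' * Q' = Q' * A) :
      (r • (Q' * Q⁻¹)) * M = M' * (r • (Q' * Q⁻¹)) := by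
    have h1 : Q⁻¹ * M = A * Q⁻¹ := by
      calc Q⁻¹ * M = Q⁻¹ * (M * Q) * Q⁻¹ := by
            rw [mul_assoc, mul_assoc, mul_nonsing_inv _ hunit, mul_one]
        _ = A * Q⁻¹ := by rw [h, ← mul_assoc, nonsing_inv_mul _ hunit, one_mul]
    rw [smul_mul, Matrix.mul_smul, mul_assoc, h1, ← mul_assoc, ← mul_assoc, h']
  let P : Matrix.SpecialLinearGroup (Fin 2) k := ⟨r • (Q' * Q⁻¹), by
    rw [det_smul, det_mul, det_nonsing_inv, Ring.inverse_eq_inv']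
    simp only [Fintype.card_fin, hr]
    field_simp⟩
  exact ⟨P, mul_inv_eq_of_eq_mul (Subtype.ext (comm _ _ _ hQX hQX')),
    mul_inv_eq_of_eq_mul (Subtype.ext (comm _ _ _ hQY hQY'))⟩

lemma sq_eq_trace_smul_sub_one (X : Matrix.SpecialLinearGroup (Fin 2) k) :
    X.1 ^ 2 = X.1.trace • X.1 - 1 := by
  have h := X.2
  rw [det_fin_two] at h
  ext i j
  fin_cases i <;> fin_cases j <;> simp [pow_two, mul_apply, trace_fin_two, Fin.sum_univ_two]
  · linear_combination -h
  · ring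
  · ring
  · linear_combination -h

lemma mem_center_of_smul_eq {X : Matrix.SpecialLinearGroup (Fin 2) k} {a b : k} (ha : a ≠ 0)
    (h : a • X.1 = b • (1 : Matrix (Fin 2) (Fin 2) k)) :
    X ∈ Subgroup.center (Matrix.SpecialLinearGroup (Fin 2) k) := by
  have hX : X.1 = scalar (Fin 2) (b / a) := by
    rw [scalar_apply, ← smul_one_eq_diagonal, div_eq_inv_mul, mul_smul, ← h, smul_smul,
      inv_mul_cancel₀ ha, one_smul]
  refine Matrix.SpecialLinearGroup.mem_center_iff.2 ⟨b / a, ?_, hX.symm⟩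
  have := X.2
  rw [hX] at this
  simpa [div_pow] using this

lemma exists_smul_one_of_mem_center {X : Matrix.SpecialLinearGroup (Fin 2) k}
    (hX : X ∈ Subgroup.center (Matrix.SpecialLinearGroup (Fin 2) k)) :
    ∃ r : k, r ^ 2 = 1 ∧ X.1 = r • (1 : Matrix (Fin 2) (Fin 2) k) := by
  obtain ⟨r, hr, hrX⟩ := Matrix.SpecialLinearGroup.mem_center_iff.1 hX
  refine ⟨r, by simpa using hr, ?_⟩
  rw [← hrX, scalar_apply, smul_one_eq_diagonal]

lemma neg_one_mem_center : -1 ∈ Subgroup.center (Matrix.SpecialLinearGroup (Fin 2) k) :=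
  Subgroup.mem_center_iff.2 fun X => by rw [mul_neg, neg_mul, mul_one, one_mul]

lemma trace_eq_zero_of_sq_mem_center {X : Matrix.SpecialLinearGroup (Fin 2) k}
    (hX : X ∉ Subgroup.center (Matrix.SpecialLinearGroup (Fin 2) k))
    (h : X ^ 2 ∈ Subgroup.center (Matrix.SpecialLinearGroup (Fin 2) k)) : X.1.trace = 0 := by
  obtain ⟨r, -, hr⟩ := exists_smul_one_of_mem_center h
  rw [Matrix.SpecialLinearGroup.coe_pow, sq_eq_trace_smul_sub_one] at hr
  by_contra ht
  refine hX (mem_center_of_smul_eq (b := r + 1) ht ?_)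
  rw [add_smul, ← hr]
  module

lemma pow_three_eq (X : Matrix.SpecialLinearGroup (Fin 2) k) :
    X.1 ^ 3 = (X.1.trace ^ 2 - 1) • X.1 - X.1.trace • 1 := by
  rw [pow_succ, sq_eq_trace_smul_sub_one, sub_mul, smul_mul_assoc, ← pow_two,
    sq_eq_trace_smul_sub_one, one_mul]
  module

lemma trace_sq_eq_one_of_pow_three_mem_center {X : Matrix.SpecialLinearGroup (Fin 2) k}
    (hX : X ∉ Subgroup.center (Matrix.SpecialLinearGroup (Fin 2) k))
    (h : X ^ 3 ∈ Subgroup.center (Matrix.SpecialLinearGroup (Fin 2) k)) :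
    X.1.trace ^ 2 = 1 := by
  obtain ⟨r, -, hr⟩ := exists_smul_one_of_mem_center h
  rw [Matrix.SpecialLinearGroup.coe_pow, pow_three_eq] at hr
  by_contra ht
  refine hX (mem_center_of_smul_eq (b := r + X.1.trace) (sub_ne_zero.2 ht) ?_)
  rw [add_smul, ← hr]
  module

lemma trace_of_pow_five_mem_center {X : Matrix.SpecialLinearGroup (Fin 2) k}
    (hX : X ∉ Subgroup.center (Matrix.SpecialLinearGroup (Fin 2) k))
    (h : X ^ 5 ∈ Subgroup.center (Matrix.SpecialLinearGroup (Fin 2) k)) :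
    X.1.trace ^ 2 = X.1.trace + 1 ∨ (-X.1.trace) ^ 2 = -X.1.trace + 1 := by
  obtain ⟨r, -, hr⟩ := exists_smul_one_of_mem_center h
  rw [Matrix.SpecialLinearGroup.coe_pow, pow_add X.1 3 2, pow_three_eq, sub_mul, smul_mul_assoc,
    smul_mul_assoc, ← pow_succ' X.1 2, pow_three_eq, one_mul, sq_eq_trace_smul_sub_one] at hr
  have ht : X.1.trace ^ 4 - 3 * X.1.trace ^ 2 + 1 = 0 := by
    by_contra ht
    refine hX (mem_center_of_smul_eq (b := r + X.1.trace ^ 3 - 2 * X.1.trace) ht ?_)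
    rw [sub_smul (r + _), add_smul r, ← hr]
    module
  have : (X.1.trace ^ 2 - X.1.trace - 1) * (X.1.trace ^ 2 + X.1.trace - 1) = 0 := by
    linear_combination ht
  rcases mul_eq_zero.1 this with h | h
  · left; linear_combination h
  · right; linear_combination h

lemma mk_eq_one_iff_s15 {X : Matrix.SpecialLinearGroup (Fin 2) k} :
    QuotientGroup.mk' (Subgroup.center (Matrix.SpecialLinearGroup (Fin 2) k)) X = 1 ↔
      X ∈ Subgroup.center (Matrix.SpecialLinearGroup (Fin 2) k) :=
  QuotientGroup.eq_one_iff X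

lemma mk_neg (X : Matrix.SpecialLinearGroup (Fin 2) k) :
    QuotientGroup.mk' (Subgroup.center (Matrix.SpecialLinearGroup (Fin 2) k)) (-X) =
      QuotientGroup.mk' (Subgroup.center (Matrix.SpecialLinearGroup (Fin 2) k)) X := by
  rw [← neg_one_mul, map_mul, mk_eq_one_iff_s15.2 neg_one_mem_center, one_mul]

lemma trace_sq_eq_of_mk_eq {X Y : Matrix.SpecialLinearGroup (Fin 2) k}
    (h : QuotientGroup.mk' (Subgroup.center (Matrix.SpecialLinearGroup (Fin 2) k)) X =
      QuotientGroup.mk' (Subgroup.center (Matrix.SpecialLinearGroup (Fin 2) k)) Y) :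
    X.1.trace ^ 2 = Y.1.trace ^ 2 := by
  obtain ⟨r, hr, hrX⟩ := exists_smul_one_of_mem_center (QuotientGroup.eq.1 h)
  have hY : Y.1 = r • X.1 := by
    calc Y.1 = X.1 * (X⁻¹ * Y).1 := by
          rw [← Matrix.SpecialLinearGroup.coe_mul, mul_inv_cancel_left]
      _ = r • X.1 := by rw [hrX, mul_smul_comm, mul_one]
  rw [hY, trace_smul, smul_eq_mul, mul_pow, hr, one_mul]

variable {G : Type*} [Group G]

lemma exists_lift_with_traces
    (f : G →* Matrix.ProjectiveSpecialLinearGroup (Fin 2) k) (hf : Function.Injective f) {x y : G}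
    (hx : x ≠ 1) (hy : y ≠ 1) (hxy : x * y ≠ 1) (hx2 : x ^ 2 = 1) (hy3 : y ^ 3 = 1)
    (hxy5 : (x * y) ^ 5 = 1) :
    ∃ X Y : Matrix.SpecialLinearGroup (Fin 2) k, QuotientGroup.mk' _ X = f x ∧
      QuotientGroup.mk' _ Y = f y ∧ X.1.trace = 0 ∧ Y.1.trace = 1 ∧
      (X.1 * Y.1).trace ^ 2 = (X.1 * Y.1).trace + 1 := by
  obtain ⟨X, hX⟩ := QuotientGroup.mk'_surjective _ (f x)
  have not_mem {Z : Matrix.SpecialLinearGroup (Fin 2) k} {g : G}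
      (hZ : QuotientGroup.mk' _ Z = f g) (hg : g ≠ 1) : Z ∉ Subgroup.center _ := fun h =>
    hg (hf (by rw [map_one, ← hZ, mk_eq_one_iff_s15.2 h]))
  have pow_mem {Z : Matrix.SpecialLinearGroup (Fin 2) k} {g : G} {n : ℕ}
      (hZ : QuotientGroup.mk' _ Z = f g) (hg : g ^ n = 1) : Z ^ n ∈ Subgroup.center _ :=
    mk_eq_one_iff_s15.1 (by rw [map_pow, hZ, ← map_pow, hg, map_one])
  obtain ⟨Y, hY, hYt⟩ : ∃ Y : Matrix.SpecialLinearGroup (Fin 2) k,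
      QuotientGroup.mk' _ Y = f y ∧ Y.1.trace = 1 := by
    obtain ⟨Y, hY⟩ := QuotientGroup.mk'_surjective _ (f y)
    rcases sq_eq_one_iff.1
      (trace_sq_eq_one_of_pow_three_mem_center (not_mem hY hy) (pow_mem hY hy3)) with h | h
    · exact ⟨Y, hY, h⟩
    · refine ⟨-Y, (mk_neg Y).trans hY, ?_⟩
      change (-Y.1).trace = 1
      rw [trace_neg, h, neg_neg]
  have hXt := trace_eq_zero_of_sq_mem_center (not_mem hX hx) (pow_mem hX hx2)
  have hXY : QuotientGroup.mk' _ (X * Y) = f (x * y) := by rw [map_mul, map_mul, hX, hY]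
  rcases trace_of_pow_five_mem_center (not_mem hXY hxy) (pow_mem hXY hxy5) with h | h
  · exact ⟨X, Y, hX, hY, hXt, hYt, h⟩
  · refine ⟨-X, Y, (mk_neg X).trans hX, hY, ?_, hYt, ?_⟩
    · change (-X.1).trace = 0
      rw [trace_neg, hXt, neg_zero]
    · change (-X.1 * Y.1).trace ^ 2 = (-X.1 * Y.1).trace + 1
      rw [neg_mul, trace_neg]
      exact h

lemma exists_conj_comp_eq [IsAlgClosed k] {f g : G →* Matrix.ProjectiveSpecialLinearGroup (Fin 2) k}
    {x y : G} (hG : Subgroup.closure {x, y} = ⊤) {X Y X' Y' : Matrix.SpecialLinearGroup (Fin 2) k}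
    (hX : QuotientGroup.mk' _ X = f x) (hY : QuotientGroup.mk' _ Y = f y)
    (hX' : QuotientGroup.mk' _ X' = g x) (hY' : QuotientGroup.mk' _ Y' = g y)
    (hXt : X.1.trace = 0) (hYt : Y.1.trace = 1)
    (hXY : (X.1 * Y.1).trace ^ 2 = (X.1 * Y.1).trace + 1)
    (hXt' : X'.1.trace = 0) (hYt' : Y'.1.trace = 1)
    (h : (X'.1 * Y'.1).trace = (X.1 * Y.1).trace) :
    ∃ c, (MulAut.conj c).toMonoidHom.comp f = g := by
  obtain ⟨P, hPX, hPY⟩ := exists_conj_of_trace_eq X Y X' Y' _ hXY hXt hYt rfl hXt' hYt' h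
  refine ⟨QuotientGroup.mk' _ P, MonoidHom.eq_of_eqOn_dense hG ?_⟩
  rintro _ (rfl | rfl)
  · simp only [MonoidHom.comp_apply, MulEquiv.coe_toMonoidHom, MulAut.conj_apply]
    rw [← hX, ← hX', ← hPX, map_mul, map_mul, map_inv]
  · simp only [MonoidHom.comp_apply, MulEquiv.coe_toMonoidHom, MulAut.conj_apply]
    rw [← hY, ← hY', ← hPY, map_mul, map_mul, map_inv]

end FieldLemmas

lemma exists_generators_alternatingGroup_five :
    ∃ x y : alternatingGroup (Fin 5), ∃ τ : MulAut (alternatingGroup (Fin 5)),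
      x ≠ 1 ∧ y ≠ 1 ∧ x * y ≠ 1 ∧ x ^ 2 = 1 ∧ y ^ 3 = 1 ∧ (x * y) ^ 5 = 1 ∧
      Subgroup.closure {x, y} = ⊤ ∧ τ x * τ y = (x * y) ^ 2 := by
  let x : alternatingGroup (Fin 5) :=
    ⟨Equiv.swap 0 1 * Equiv.swap 2 3, Equiv.Perm.mem_alternatingGroup.2 (by decide)⟩
  let y : alternatingGroup (Fin 5) :=
    ⟨Equiv.swap 1 4 * Equiv.swap 1 3, Equiv.Perm.mem_alternatingGroup.2 (by decide)⟩
  let s : Equiv.Perm (Fin 5) := Equiv.swap 1 3 * Equiv.swap 1 4 * Equiv.swap 1 2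
  have hx : x ≠ 1 := by decide
  have hy : y ≠ 1 := by decide
  have hxy : x * y ≠ 1 := by decide
  have hx2 : x ^ 2 = 1 := by decide
  have hy3 : y ^ 3 = 1 := by decide
  have hxy5 : (x * y) ^ 5 = 1 := by decide
  refine ⟨x, y, MulAut.conjNormal s, hx, hy, hxy, hx2, hy3, hxy5, ?_, ?_⟩
  · set H := Subgroup.closure {x, y} with hH
    have hxH : x ∈ H := Subgroup.subset_closure (by simp)
    have hyH : y ∈ H := Subgroup.subset_closure (by simp)
    have dvd : ∀ (g : alternatingGroup (Fin 5)) (n : ℕ), n.Prime → g ∈ H → g ≠ 1 → g ^ n = 1 →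
        n ∣ Nat.card H := by
      intro g n hn hg hg1 hgn
      have := Fact.mk hn
      rw [← orderOf_eq_prime hgn hg1]
      exact Subgroup.orderOf_dvd_natCard H hg
    have h2 := dvd x 2 (by norm_num) hxH hx hx2
    have h3 := dvd y 3 (by norm_num) hyH hy hy3
    have h5 := dvd (x * y) 5 (by norm_num) (H.mul_mem hxH hyH) hxy hxy5
    have hcard : Nat.card (alternatingGroup (Fin 5)) = 60 := by
      rw [nat_card_alternatingGroup]; simp; decide
    have hmul := H.card_mul_index
    rw [hcard] at hmul
    have h30 : 30 ∣ Nat.card H := by omega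
    obtain ⟨m, hm⟩ := h30
    rw [hm, mul_assoc] at hmul
    have hmi : m * H.index = 2 := by omega
    rcases (Nat.dvd_prime Nat.prime_two).1 (Dvd.intro_left m hmi) with h | h
    · exact Subgroup.index_eq_one.1 h
    · have := Subgroup.normal_of_index_eq_two h
      rcases this.eq_bot_or_eq_top with hb | ht
      · exact absurd (Subgroup.mem_bot.1 (hb ▸ hxH)) hx
      · exact ht
  · rw [← map_mul]
    apply Subtype.ext
    rw [MulAut.conjNormal_apply]
    decide

/-- Any two embeddings of `A₅` into `PSL₂` over an algebraically closed field agree up to an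
automorphism of `A₅` and conjugation. -/
lemma exists_conj_comp_eq_comp_mulAut {k : Type*} [Field k] [IsAlgClosed k]
    (f g : alternatingGroup (Fin 5) →* Matrix.ProjectiveSpecialLinearGroup (Fin 2) k)
    (hf : Function.Injective f) (hg : Function.Injective g) :
    ∃ c, ∃ τ : MulAut (alternatingGroup (Fin 5)),
      (MulAut.conj c).toMonoidHom.comp f = g.comp τ.toMonoidHom := by
  obtain ⟨x, y, τ, hx, hy, hxy, hx2, hy3, hxy5, hG, hτ⟩ :=
    exists_generators_alternatingGroup_five
  obtain ⟨X, Y, hX, hY, hXt, hYt, hXY⟩ := exists_lift_with_traces f hf hx hy hxy hx2 hy3 hxy5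
  obtain ⟨X₁, Y₁, hX₁, hY₁, hXt₁, hYt₁, hXY₁⟩ :=
    exists_lift_with_traces g hg hx hy hxy hx2 hy3 hxy5
  obtain ⟨X₂, Y₂, hX₂, hY₂, hXt₂, hYt₂, hXY₂⟩ :=
    exists_lift_with_traces (g.comp τ.toMonoidHom) (hg.comp τ.injective) hx hy hxy hx2 hy3 hxy5
  have hroots : ((X₁.1 * Y₁.1).trace - (X.1 * Y.1).trace) *
      (1 - (X₁.1 * Y₁.1).trace - (X.1 * Y.1).trace) = 0 := by
    linear_combination hXY - hXY₁
  have hswap : (X₂.1 * Y₂.1).trace = 1 - (X₁.1 * Y₁.1).trace := by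
    have hmk : QuotientGroup.mk' (Subgroup.center _) (X₂ * Y₂) =
        QuotientGroup.mk' (Subgroup.center _) ((X₁ * Y₁) ^ 2) := by
      rw [map_mul, hX₂, hY₂, map_pow, map_mul, hX₁, hY₁, ← map_mul g, ← map_pow, ← hτ, map_mul g]
      rfl
    have htr := trace_sq_eq_of_mk_eq hmk
    rw [Matrix.SpecialLinearGroup.coe_pow, sq_eq_trace_smul_sub_one] at htr
    simp only [trace_sub, trace_smul, trace_one, Matrix.SpecialLinearGroup.coe_mul, smul_eq_mul,
      Fintype.card_fin, Nat.cast_ofNat] at htr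
    generalize (X₁.1 * Y₁.1).trace = z at *
    linear_combination htr - hXY₂ + (z ^ 2 + z - 2) * hXY₁
  rcases mul_eq_zero.1 hroots with h | h
  · obtain ⟨c, hc⟩ := exists_conj_comp_eq hG hX hY hX₁ hY₁ hXt hYt hXY hXt₁ hYt₁ (sub_eq_zero.1 h)
    exact ⟨c, 1, hc⟩
  · obtain ⟨c, hc⟩ := exists_conj_comp_eq hG hX hY hX₂ hY₂ hXt hYt hXY hXt₂ hYt₂
      (hswap.trans (sub_eq_zero.1 h))
    exact ⟨c, τ, hc⟩

theorem stmt_15 (p : ℕ) [Fact p.Prime] (hp2 : p ≠ 2) (hp5 : p ≠ 5)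
    (H₁ H₂ : Subgroup
      (Matrix.ProjectiveSpecialLinearGroup (Fin 2) (AlgebraicClosure (ZMod p))))
    (h₁ : Nonempty (↥H₁ ≃* ↥(alternatingGroup (Fin 5))))
    (h₂ : Nonempty (↥H₂ ≃* ↥(alternatingGroup (Fin 5)))) :
    ∃ g : Matrix.ProjectiveSpecialLinearGroup (Fin 2) (AlgebraicClosure (ZMod p)),
      H₁.map (MulAut.conj g).toMonoidHom = H₂ := by
  obtain ⟨e₁⟩ := h₁
  obtain ⟨e₂⟩ := h₂
  obtain ⟨c, τ, hc⟩ := exists_conj_comp_eq_comp_mulAut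
    (H₁.subtype.comp e₁.symm.toMonoidHom) (H₂.subtype.comp e₂.symm.toMonoidHom)
    (H₁.subtype_injective.comp e₁.symm.injective) (H₂.subtype_injective.comp e₂.symm.injective)
  refine ⟨c, ?_⟩
  have range_eq (H : Subgroup (Matrix.ProjectiveSpecialLinearGroup (Fin 2)
      (AlgebraicClosure (ZMod p)))) (e : alternatingGroup (Fin 5) ≃* H) :
      (H.subtype.comp e.toMonoidHom).range = H := by
    rw [MonoidHom.range_comp, MonoidHom.range_eq_top.2 e.surjective, ← MonoidHom.range_eq_map,
      Subgroup.range_subtype]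
  have hrange := congrArg MonoidHom.range hc
  rw [MonoidHom.range_comp, range_eq H₁ e₁.symm] at hrange
  exact hrange.trans (range_eq H₂ (τ.trans e₂.symm))
end

section
/- Let p be a prime with p ≠ 2 and p ≠ 5, and let F̄ be an algebraic closure of F_p. Consider the action of PSL(2, F̄) by conjugation (post-composition with inner automorphisms) on the set of injective group homomorphisms from the alternating group A₅ to PSL(2, F̄). This action has exactly two orbits. -/
/-- `ψ₂` is in the orbit of `ψ₁` under post-composition with inner automorphisms of `G`. -/
def ConjEquiv {A G : Type} [Group A] [Group G] (ψ₁ ψ₂ : A →* G) : Prop :=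
  ∃ g : G, ∀ x : A, ψ₂ x = g * ψ₁ x * g⁻¹

open Matrix
open scoped MatrixGroups

namespace Icosahedral

section Words

variable {G H : Type*} [Group G] [Group H]

/-- Homomorphisms that agree on a generating family are equal. -/
theorem hom_ext_of_words {s : Bool → G} {W : List (List Bool)}
    (surj : ∀ x, ∃ l ∈ W, (l.map s).prod = x) {φ χ : G →* H} (h : ∀ b, φ (s b) = χ (s b)) :
    φ = χ := by
  ext x
  obtain ⟨l, -, rfl⟩ := surj x
  simp only [map_list_prod, List.map_map]
  congr 2
  funext b
  exact h b

/-- A set of normal forms for `G`, closed under left multiplication by generators in `G` and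
in `H` simultaneously, yields a homomorphism `G →* H`. -/
theorem exists_hom_of_words (s : Bool → G) (S : Bool → H) (W : List (List Bool))
    (nil_mem : [] ∈ W) (surj : ∀ x, ∃ l ∈ W, (l.map s).prod = x)
    (inj : ∀ l ∈ W, ∀ l' ∈ W, (l.map s).prod = (l'.map s).prod → l = l')
    (step : ∀ l ∈ W, ∀ b, ∃ l' ∈ W, ((b :: l).map s).prod = (l'.map s).prod ∧
      ((b :: l).map S).prod = (l'.map S).prod) :
    ∃ φ : G →* H, ∀ b, φ (s b) = S b := by
  choose nf nf_mem nf_prod using surj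
  have nf_word : ∀ l ∈ W, nf (l.map s).prod = l := fun l hl =>
    inj _ (nf_mem _) _ hl (nf_prod _)
  have key : ∀ b x, ((nf (s b * x)).map S).prod = S b * ((nf x).map S).prod := by
    intro b x
    obtain ⟨l', hl', hs, hS⟩ := step (nf x) (nf_mem x) b
    rw [List.map_cons, List.prod_cons, nf_prod] at hs
    rw [hs, nf_word l' hl', ← hS, List.map_cons, List.prod_cons]
  have nf_one : nf 1 = [] := by simpa using nf_word [] nil_mem
  have word_mul : ∀ (l : List Bool) (y : G),
      ((nf ((l.map s).prod * y)).map S).prod = (l.map S).prod * ((nf y).map S).prod := by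
    intro l y
    induction l with
    | nil => simp
    | cons b l ih => simp [mul_assoc, key, ih]
  refine ⟨MonoidHom.mk' (fun x => ((nf x).map S).prod) fun x y => ?_, fun b => ?_⟩
  · conv_lhs => rw [← nf_prod x]
    exact word_mul _ _
  · simpa [nf_one] using key b 1

end Words

section Normal

/-- The ring `ℤ[t]` with `t² + t = 1`. -/
abbrev GoldenInt := QuadraticAlgebra ℤ 1 (-1)

/-- The ring `ℤ[t, w]` with `t² + t = 1` and `w² + w + 1 = 0`. -/
abbrev GoldenEisenstein := QuadraticAlgebra GoldenInt (-1) (-1)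

/-- Generators `(0 1)(2 3)` and `(0 2 4)` of the alternating group, with product of order `5`. -/
def altGen : Bool → alternatingGroup (Fin 5)
  | true => ⟨Equiv.swap 0 1 * Equiv.swap 2 3, Equiv.Perm.mem_alternatingGroup.2 (by decide)⟩
  | false => ⟨Equiv.swap 0 2 * Equiv.swap 2 4, Equiv.Perm.mem_alternatingGroup.2 (by decide)⟩

/-- Matrices with traces `0` and `-1` whose product has trace `t`, where `w² + w + 1 = 0`. -/
def matGen {R : Type*} [CommRing R] (w t : R) : Bool → Matrix (Fin 2) (Fin 2) R
  | true => !![0, -1; 1, 0]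
  | false => !![w, t; 0, -1 - w]

/-- Representatives of the cosets of the subgroup of order `5`. -/
def cosetWords : List (List Bool) :=
  let x := [true, false, true, false, true]
  [[], [true], [false, true], [true, false, true], [false, true, false, true], x,
    false :: false :: [true, false, true], false :: x, false :: false :: x,
    true :: false :: false :: x, false :: true :: false :: false :: x,
    true :: false :: true :: false :: false :: x]

/-- Normal forms for the sixty elements of the alternating group. -/
def words : List (List Bool) :=
  cosetWords.flatMap fun r =>
    (List.range 5).map fun k => r ++ (List.replicate k [true, false]).flatten

theorem words_surj : ∀ x, ∃ l ∈ words, (l.map altGen).prod = x := by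
  decide +kernel

theorem words_inj : ∀ l ∈ words, ∀ l' ∈ words,
    (l.map altGen).prod = (l'.map altGen).prod → l = l' := by
  have hcard : words.toFinset.card ≤ (Finset.univ : Finset (alternatingGroup (Fin 5))).card :=
    (List.toFinset_card_le words).trans_eq
      (by rw [Finset.card_univ, card_alternatingGroup]; rfl)
  have hinj := Finset.injOn_of_surjOn_of_card_le
    (fun l : List Bool => (l.map altGen).prod) (s := words.toFinset) (t := Finset.univ)
    (fun _ _ => Finset.mem_coe.2 (Finset.mem_univ _))
    (fun x _ => by
      obtain ⟨l, hl, hx⟩ := words_surj x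
      exact ⟨l, by simpa using hl, hx⟩)
    hcard
  exact fun l hl l' hl' h => hinj (by simpa using hl) (by simpa using hl') h

theorem cosetWords_step : ∀ r ∈ cosetWords, ∀ b, ∃ r' ∈ cosetWords, ∃ k ∈ List.range 5,
    let l' := r' ++ (List.replicate k [true, false]).flatten
    ((b :: r).map altGen).prod = (l'.map altGen).prod ∧
      let m := matGen (⟨0, 1⟩ : GoldenEisenstein) ⟨⟨0, 1⟩, 0⟩
      (((b :: r).map m).prod = (l'.map m).prod ∨ ((b :: r).map m).prod = -(l'.map m).prod) := by
  decide +kernel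

theorem prod_map_append_flatten {M : Type*} [Monoid M] (s : Bool → M) (r : List Bool) (k : ℕ) :
    ((r ++ (List.replicate k [true, false]).flatten).map s).prod =
      (r.map s).prod * (s true * s false) ^ k := by
  induction k with
  | zero => simp
  | succ k ih => simp [List.replicate_succ, pow_succ', mul_assoc]

/-- Coset multiplication rules extend to all normal forms. -/
theorem words_step {H : Type*} [Group H] {S : Bool → H} (hS : (S true * S false) ^ 5 = 1)
    (step : ∀ r ∈ cosetWords, ∀ b, ∃ r' ∈ cosetWords, ∃ k ∈ List.range 5,
      let l' := r' ++ (List.replicate k [true, false]).flatten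
      ((b :: r).map altGen).prod = (l'.map altGen).prod ∧
        ((b :: r).map S).prod = (l'.map S).prod) :
    ∀ l ∈ words, ∀ b, ∃ l' ∈ words, ((b :: l).map altGen).prod = (l'.map altGen).prod ∧
      ((b :: l).map S).prod = (l'.map S).prod := by
  intro l hl b
  obtain ⟨r, hr, hl⟩ := List.mem_flatMap.1 hl
  obtain ⟨j, -, rfl⟩ := List.mem_map.1 hl
  obtain ⟨r', hr', k, -, h₁, h₂⟩ := step r hr b
  refine ⟨_, List.mem_flatMap.2 ⟨r', hr', List.mem_map.2
    ⟨(k + j) % 5, List.mem_range.2 (Nat.mod_lt _ (by decide)), rfl⟩⟩, ?_, ?_⟩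
  · rw [← List.cons_append, prod_map_append_flatten, h₁, prod_map_append_flatten,
      prod_map_append_flatten, mul_assoc, ← pow_add,
      pow_eq_pow_mod _ (show (altGen true * altGen false) ^ 5 = 1 by decide)]
  · rw [← List.cons_append, prod_map_append_flatten, h₂, prod_map_append_flatten,
      prod_map_append_flatten, mul_assoc, ← pow_add, pow_eq_pow_mod _ hS]

theorem matGen_relation :
    (([] ++ (List.replicate 5 [true, false]).flatten).map
      (matGen (⟨0, 1⟩ : GoldenEisenstein) ⟨⟨0, 1⟩, 0⟩)).prod = 1 := by
  decide +kernel

end Normal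

section Existence

variable {K : Type*} [Field K]

theorem exists_goldenEisenstein_hom {w t : K} (hw : w ^ 2 + w + 1 = 0) (ht : t ^ 2 + t = 1) :
    ∃ f : GoldenEisenstein →+* K, f ⟨0, 1⟩ = w ∧ f ⟨⟨0, 1⟩, 0⟩ = t := by
  let f₀ : GoldenInt →+* K := (QuadraticAlgebra.lift ⟨t, by
    simp only [one_smul, neg_smul]; linear_combination ht⟩ : GoldenInt →ₐ[ℤ] K).toRingHom
  let := f₀.toAlgebra
  have hf₀ : f₀ ⟨0, 1⟩ = t := by simp [f₀, QuadraticAlgebra.lift]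
  refine ⟨(QuadraticAlgebra.lift ⟨w, by
    simp only [one_smul, neg_smul]; linear_combination hw⟩ : GoldenEisenstein →ₐ[GoldenInt] K).toRingHom,
    ?_, ?_⟩
  · simp [QuadraticAlgebra.lift]
  · simpa [QuadraticAlgebra.lift, Algebra.smul_def, RingHom.algebraMap_toAlgebra] using hf₀

/-- The matrices `matGen` as elements of `SL(2, K)`. -/
def slGen {w : K} (hw : w ^ 2 + w + 1 = 0) (t : K) (b : Bool) : SL(2, K) :=
  ⟨matGen w t b, by
    cases b
    · simp only [matGen, det_fin_two_of]; linear_combination -hw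
    · simp [matGen, det_fin_two_of]⟩

theorem psl_mk_eq_mk_iff {A B : SL(2, K)} :
    (A : PSL(2, K)) = (B : PSL(2, K)) ↔ A = B ∨ A = -B := by
  rw [QuotientGroup.eq, Matrix.SpecialLinearGroup.mem_center_iff]
  constructor
  · rintro ⟨r, hr, h⟩
    have h' : (B : Matrix (Fin 2) (Fin 2) K) = r • (A : Matrix (Fin 2) (Fin 2) K) := by
      have : B.1 = A.1 * (A⁻¹ * B).1 := congrArg Subtype.val (mul_inv_cancel_left A B).symm
      refine this.trans ?_
      rw [← h]
      ext i j
      simp [mul_comm]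
    rw [Fintype.card_fin, sq_eq_one_iff] at hr
    rcases hr with rfl | rfl
    · exact Or.inl (Subtype.ext (by simpa using h'.symm))
    · exact Or.inr (Subtype.ext (by simp [h']))
  · rintro (rfl | rfl)
    · exact ⟨1, by simp, by simp⟩
    · refine ⟨-1, by simp, ?_⟩
      have : (-B)⁻¹ * B = -1 := by rw [inv_mul_eq_iff_eq_mul]; simp
      rw [this]
      ext i j
      fin_cases i <;> fin_cases j <;> simp

theorem exists_hom {w t : K} (hw : w ^ 2 + w + 1 = 0) (ht : t ^ 2 + t = 1) :
    ∃ φ : alternatingGroup (Fin 5) →* PSL(2, K), ∀ b, φ (altGen b) = (slGen hw t b : PSL(2, K)) := by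
  obtain ⟨f, hfw, hft⟩ := exists_goldenEisenstein_hom hw ht
  have hgen : ∀ b, f.mapMatrix (matGen ⟨0, 1⟩ ⟨⟨0, 1⟩, 0⟩ b) = matGen w t b := by
    intro b
    ext i j
    cases b <;> fin_cases i <;> fin_cases j <;> simp [matGen, hfw, hft]
  have hword : ∀ l : List Bool, ((l.map (slGen hw t)).prod : SL(2, K)).1 =
      f.mapMatrix (l.map (matGen ⟨0, 1⟩ ⟨⟨0, 1⟩, 0⟩)).prod := by
    intro l
    induction l with
    | nil => simp
    | cons b l ih =>
      rw [List.map_cons, List.prod_cons, List.map_cons, List.prod_cons, map_mul, hgen, ← ih]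
      rfl
  have hpsl : ∀ l : List Bool, (l.map fun b => (slGen hw t b : PSL(2, K))).prod =
      ((l.map (slGen hw t)).prod : SL(2, K)) := by
    intro l
    have := map_list_prod (QuotientGroup.mk' (Subgroup.center SL(2, K))) (l.map (slGen hw t))
    rw [List.map_map] at this
    exact this.symm
  have hpow : (slGen hw t true * slGen hw t false) ^ 5 = 1 := by
    have h := prod_map_append_flatten (slGen hw t) [] 5
    rw [List.map_nil, List.prod_nil, one_mul] at h
    rw [← h]
    exact Subtype.ext (by rw [hword, matGen_relation, map_one]; rfl)
  refine exists_hom_of_words altGen _ words (by decide) words_surj words_inj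
    (words_step ?_ fun r hr b => ?_)
  · rw [← QuotientGroup.mk_mul, ← QuotientGroup.mk_pow, hpow, QuotientGroup.mk_one]
  · obtain ⟨r', hr', k, hk, h₁, h₂⟩ := cosetWords_step r hr b
    refine ⟨r', hr', k, hk, h₁, ?_⟩
    rw [hpsl, hpsl, psl_mk_eq_mk_iff]
    refine h₂.imp (fun h => Subtype.ext ?_) fun h => Subtype.ext ?_
    · rw [hword, hword, h]
    · rw [SpecialLinearGroup.coe_neg, hword, hword, h, map_neg]

theorem injective_of_apply_ne_one {H : Type*} [Group H] (φ : alternatingGroup (Fin 5) →* H)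
    {x : alternatingGroup (Fin 5)} (hx : φ x ≠ 1) : Function.Injective φ := by
  rw [← MonoidHom.ker_eq_bot_iff]
  refine (IsSimpleGroup.eq_bot_or_eq_top_of_normal φ.ker inferInstance).resolve_right fun h => hx ?_
  exact MonoidHom.mem_ker.1 (h ▸ Subgroup.mem_top x)

end Existence

section Uniqueness

variable {K : Type*} [Field K]

theorem sl_mul_self (M : SL(2, K)) :
    M.1 * M.1 = M.1.trace • M.1 - (1 : Matrix (Fin 2) (Fin 2) K) := by
  have h := M.2
  rw [det_fin_two] at h
  ext i j
  fin_cases i <;> fin_cases j <;> simp [mul_apply, trace_fin_two]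
  · linear_combination -h
  · ring
  · ring
  · linear_combination -h

/-- A noncentral matrix in `SL(2, K)` is linearly independent from the identity. -/
theorem coeff_eq_of_smul_eq {M : SL(2, K)} (hM : (M : PSL(2, K)) ≠ 1) {x y : K}
    (h : x • M.1 = y • (1 : Matrix (Fin 2) (Fin 2) K)) : x = 0 ∧ y = 0 := by
  have hx : x = 0 := by
    by_contra hx
    have hM' : M.1 = (y / x) • (1 : Matrix (Fin 2) (Fin 2) K) := by
      rw [div_eq_inv_mul, ← smul_smul, ← h, smul_smul, inv_mul_cancel₀ hx, one_smul]
    refine hM ((QuotientGroup.eq_one_iff M).2 (Matrix.SpecialLinearGroup.mem_center_iff.2 ⟨y / x, ?_, ?_⟩))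
    · simpa [hM'] using M.2
    · rw [hM']
      ext i j
      fin_cases i <;> fin_cases j <;> simp
  subst hx
  refine ⟨rfl, ?_⟩
  simpa using (congrFun (congrFun h 0) 0).symm

theorem trace_of_sq {A : SL(2, K)} (hA : (A : PSL(2, K)) ≠ 1) (h : (A : PSL(2, K)) ^ 2 = 1) :
    A.1.trace = 0 := by
  rw [← QuotientGroup.mk_pow, ← QuotientGroup.mk_one, psl_mk_eq_mk_iff] at h
  have hsq := sl_mul_self A
  have : ∃ ε : K, A.1 * A.1 = ε • 1 := by
    rcases h with h | h
    · exact ⟨1, by simpa [sq] using congrArg Subtype.val h⟩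
    · exact ⟨-1, by simpa [sq] using congrArg Subtype.val h⟩
  obtain ⟨ε, hε⟩ := this
  refine (coeff_eq_of_smul_eq hA (y := ε + 1) ?_).1
  rw [add_smul, one_smul, ← hε, hsq, sub_add_cancel]

theorem trace_of_cube {B : SL(2, K)} (hB : (B : PSL(2, K)) ≠ 1) (h : B ^ 3 = 1) :
    B.1.trace = -1 := by
  have hsq := sl_mul_self B
  have h3 : B.1 * B.1 * B.1 = 1 := by simpa [pow_succ] using congrArg Subtype.val h
  have := (coeff_eq_of_smul_eq hB (x := B.1.trace ^ 2 - 1) (y := B.1.trace + 1) (by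
    rw [hsq, sub_mul, smul_mul_assoc, hsq, one_mul] at h3
    rw [← sub_eq_zero] at h3 ⊢
    rw [← h3]
    module)).2
  linear_combination this

theorem trace_of_pow_five {C : SL(2, K)} (hC : (C : PSL(2, K)) ≠ 1) (h : C ^ 5 = 1) :
    C.1.trace ^ 2 + C.1.trace = 1 := by
  have hsq := sl_mul_self C
  have h5 : C.1 * C.1 * (C.1 * C.1) * C.1 = 1 := by
    simpa [pow_succ, mul_assoc] using congrArg Subtype.val h
  set τ := C.1.trace
  obtain ⟨h₁, h₂⟩ := coeff_eq_of_smul_eq hC (x := τ ^ 4 - 3 * τ ^ 2 + 1)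
    (y := τ ^ 3 - 2 * τ + 1) (by
      rw [hsq] at h5
      simp only [sub_mul, mul_sub, smul_mul_assoc, mul_smul_comm, hsq, one_mul, mul_one] at h5
      rw [← sub_eq_zero] at h5 ⊢
      rw [← h5]
      module)
  linear_combination τ * h₂ - h₁

/-- A pair in `SL(2, K)` with the traces of the standard generators is conjugate to them. -/
theorem exists_conj_slGen [IsAlgClosed K] {w t : K} (hw : w ^ 2 + w + 1 = 0) (ht : t ^ 2 + t = 1)
    {A B : SL(2, K)} (hA : A.1.trace = 0) (hB : B.1.trace = -1) (hAB : (A * B).1.trace = t) :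
    ∃ P : SL(2, K), A * P = P * slGen hw t true ∧ B * P = P * slGen hw t false := by
  have hA₁ := A.2
  have hB₁ := B.2
  change (A.1 * B.1).trace = t at hAB
  obtain ⟨v, hv, hBv⟩ : ∃ v ≠ 0, (B.1 - w • (1 : Matrix (Fin 2) (Fin 2) K)) *ᵥ v = 0 := by
    rw [Matrix.exists_mulVec_eq_zero_iff, det_fin_two]
    rw [trace_fin_two] at hB
    rw [det_fin_two] at hB₁
    simp
    linear_combination hB₁ - w * hB + hw
  have hB₀ := congrFun hBv 0
  have hB₂ := congrFun hBv 1
  have hv' : v 0 ≠ 0 ∨ v 1 ≠ 0 := by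
    by_contra! h
    exact hv (by ext i; fin_cases i <;> simp [h])
  rw [det_fin_two] at hA₁ hB₁
  rw [trace_fin_two] at hA hB hAB
  simp [mulVec, dotProduct, mul_apply] at hB₀ hB₂ hAB
  generalize hx : v 0 = x at *
  generalize hy : v 1 = y at *
  generalize ha : A.1 0 0 = a at *
  generalize hb : A.1 0 1 = b at *
  generalize hc : A.1 1 0 = c at *
  generalize hd : A.1 1 1 = d at *
  generalize he : B.1 0 0 = e at *
  generalize hf : B.1 0 1 = f at *
  generalize hg : B.1 1 0 = g at *
  generalize hh : B.1 1 1 = h at *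
  obtain rfl : d = -a := by linear_combination hA
  obtain rfl : h = -1 - e := by linear_combination hB
  have hBA₀ : e * (a * x + b * y) + f * (c * x - a * y) = t * x - (1 + w) * (a * x + b * y) := by
    linear_combination (-a) * hB₀ - b * hB₂ + x * hAB
  have hBA₁ : g * (a * x + b * y) + (-1 - e) * (c * x - a * y) =
      t * y - (1 + w) * (c * x - a * y) := by
    linear_combination (-c) * hB₀ + a * hB₂ + y * hAB
  have hδ : x * (c * x - a * y) - y * (a * x + b * y) ≠ 0 := by
    intro hδ
    obtain ⟨l, hl₀, hl₁⟩ : ∃ l, a * x + b * y = l * x ∧ c * x - a * y = l * y := by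
      rcases hv' with h | h
      · refine ⟨(a * x + b * y) / x, by field_simp, ?_⟩
        field_simp
        linear_combination hδ
      · refine ⟨(c * x - a * y) / y, ?_, by field_simp⟩
        field_simp
        linear_combination -hδ
    have hl : l ^ 2 = -1 ∧ t = (1 + 2 * w) * l := by
      rcases hv' with h | h
      · constructor <;> apply mul_right_cancel₀ h
        · linear_combination -(l + a) * hl₀ - b * hl₁ - x * hA₁
        · rw [hl₀, hl₁] at hBA₀
          linear_combination -hBA₀ + l * hB₀
      · constructor <;> apply mul_right_cancel₀ h
        · linear_combination -(l - a) * hl₁ - c * hl₀ - y * hA₁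
        · rw [hl₀, hl₁] at hBA₁
          linear_combination -hBA₁ + l * hB₂
    have ht₃ : t ^ 2 = 3 := by
      rw [hl.2]
      linear_combination (1 + 2 * w) ^ 2 * hl.1 - 4 * hw
    refine one_ne_zero (α := K) ?_
    linear_combination ht₃ - (t - 2) * (ht - ht₃)
  obtain ⟨s, hs⟩ := IsAlgClosed.exists_pow_nat_eq (x * (c * x - a * y) - y * (a * x + b * y)) two_pos
  have hs₀ : s ≠ 0 := by
    rintro rfl
    exact hδ (by simpa using hs.symm)
  refine ⟨⟨!![x / s, (a * x + b * y) / s; y / s, (c * x - a * y) / s], ?_⟩, ?_, ?_⟩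
  · rw [det_fin_two_of]
    field_simp
    linear_combination -hs
  · refine Subtype.ext ?_
    change A.1 * _ = _ * matGen w t true
    ext i j
    fin_cases i <;> fin_cases j <;> simp [mul_apply, matGen, *] <;> field_simp
    · linear_combination -x * hA₁
    · ring
    · linear_combination -y * hA₁
  · refine Subtype.ext ?_
    change B.1 * _ = _ * matGen w t false
    ext i j
    fin_cases i <;> fin_cases j <;> simp [mul_apply, matGen, *] <;> field_simp
    · linear_combination hB₀
    · linear_combination hBA₀
    · linear_combination hB₂
    · linear_combination hBA₁

/-- Elements of `PSL(2, K)` satisfying the icosahedral relations are conjugate to the standard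
generators for one of the two roots of `t² + t = 1`. -/
theorem exists_conj_of_relations [IsAlgClosed K] {w : K} (hw : w ^ 2 + w + 1 = 0)
    {α β : PSL(2, K)} (hα : α ≠ 1) (hβ : β ≠ 1) (hαβ : α * β ≠ 1) (hα₂ : α ^ 2 = 1)
    (hβ₃ : β ^ 3 = 1) (hαβ₅ : (α * β) ^ 5 = 1) :
    ∃ t : K, t ^ 2 + t = 1 ∧ ∃ g : PSL(2, K),
      α = g * slGen hw t true * g⁻¹ ∧ β = g * slGen hw t false * g⁻¹ := by
  obtain ⟨B, rfl, hB⟩ : ∃ B : SL(2, K), (B : PSL(2, K)) = β ∧ B ^ 3 = 1 := by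
    obtain ⟨B, rfl⟩ := QuotientGroup.mk_surjective β
    rw [← QuotientGroup.mk_pow, ← QuotientGroup.mk_one, psl_mk_eq_mk_iff] at hβ₃
    rcases hβ₃ with h | h
    · exact ⟨B, rfl, h⟩
    · exact ⟨-B, psl_mk_eq_mk_iff.2 (Or.inr rfl), by rw [Odd.neg_pow (by decide), h, neg_neg]⟩
  obtain ⟨A, rfl, hAB⟩ : ∃ A : SL(2, K), (A : PSL(2, K)) = α ∧ (A * B) ^ 5 = 1 := by
    obtain ⟨A, rfl⟩ := QuotientGroup.mk_surjective α
    rw [← QuotientGroup.mk_mul, ← QuotientGroup.mk_pow, ← QuotientGroup.mk_one,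
      psl_mk_eq_mk_iff] at hαβ₅
    rcases hαβ₅ with h | h
    · exact ⟨A, rfl, h⟩
    · exact ⟨-A, psl_mk_eq_mk_iff.2 (Or.inr rfl), by
        rw [neg_mul, Odd.neg_pow (by decide), h, neg_neg]⟩
  have ht := trace_of_pow_five (C := A * B) hαβ hAB
  obtain ⟨P, hP₁, hP₂⟩ :=
    exists_conj_slGen hw ht (trace_of_sq hα hα₂) (trace_of_cube hβ hB) rfl
  refine ⟨_, ht, P, ?_, ?_⟩ <;> rw [eq_mul_inv_iff_mul_eq, ← QuotientGroup.mk_mul,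
    ← QuotientGroup.mk_mul]
  · rw [hP₁]
  · rw [hP₂]

theorem trace_eq_or_eq_neg_of_conj {w t t' : K} (hw : w ^ 2 + w + 1 = 0) {g : PSL(2, K)}
    (h : ∀ b, (slGen hw t' b : PSL(2, K)) = g * slGen hw t b * g⁻¹) : t' = t ∨ t' = -t := by
  obtain ⟨P, rfl⟩ := QuotientGroup.mk_surjective g
  have htr : ∀ u : K, (slGen hw u true * slGen hw u false).1.trace = u := fun u => by
    change (matGen w u true * matGen w u false).trace = u
    simp [matGen, trace_fin_two]
  have hmul : ((slGen hw t' true * slGen hw t' false : SL(2, K)) : PSL(2, K)) =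
      ((P * (slGen hw t true * slGen hw t false) * P⁻¹ : SL(2, K)) : PSL(2, K)) := by
    simp only [QuotientGroup.mk_mul, QuotientGroup.mk_inv, h]
    group
  have hconj : (P * (slGen hw t true * slGen hw t false) * P⁻¹).1.trace = t := by
    conv_rhs => rw [← htr t]
    change (P.1 * _ * P⁻¹.1).trace = _
    rw [trace_mul_comm, ← mul_assoc]
    change ((P⁻¹ * P).1 * _).trace = _
    rw [inv_mul_cancel]
    exact congrArg trace (one_mul _)
  rw [psl_mk_eq_mk_iff] at hmul
  rw [← htr t']
  refine hmul.imp (fun e => by rw [e, hconj]) fun e => ?_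
  rw [e]
  change (-_ : Matrix (Fin 2) (Fin 2) K).trace = _
  rw [trace_neg, hconj]

end Uniqueness

theorem exists_sq_add_self_eq {K : Type*} [Field K] [IsAlgClosed K] (c : K) :
    ∃ x : K, x ^ 2 + x = c := by
  open Polynomial in
  obtain ⟨x, hx⟩ := IsAlgClosed.exists_root (X ^ 2 + X + C (-c) : K[X]) (by
    have : (X ^ 2 + X + C (-c) : K[X]).degree = 2 := by compute_degree!
    rw [this]
    decide)
  refine ⟨x, ?_⟩
  simp at hx
  linear_combination hx

theorem slGen_true_ne_one {K : Type*} [Field K] {w : K} (hw : w ^ 2 + w + 1 = 0) (t : K) :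
    (slGen hw t true : PSL(2, K)) ≠ 1 := by
  rw [← QuotientGroup.mk_one, Ne, psl_mk_eq_mk_iff]
  rintro (h | h) <;> simpa [slGen, matGen] using congrFun (congrFun (congrArg Subtype.val h) 1) 0

/-- Over an algebraically closed field of characteristic not `5`, there are exactly two
conjugacy classes of embeddings of the alternating group on five letters in `PSL(2, K)`. -/
theorem two_orbits {K : Type} [Field K] [IsAlgClosed K] (h5 : (5 : K) ≠ 0) :
    ∃ ψ₁ ψ₂ : alternatingGroup (Fin 5) →* PSL(2, K),
      Function.Injective ψ₁ ∧ Function.Injective ψ₂ ∧ ¬ ConjEquiv ψ₁ ψ₂ ∧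
      ∀ ψ : alternatingGroup (Fin 5) →* PSL(2, K),
        Function.Injective ψ → (ConjEquiv ψ₁ ψ ∨ ConjEquiv ψ₂ ψ) := by
  obtain ⟨w, hw⟩ := exists_sq_add_self_eq (-1 : K)
  replace hw : w ^ 2 + w + 1 = 0 := by linear_combination hw
  obtain ⟨t, ht⟩ := exists_sq_add_self_eq (1 : K)
  have ht' : (-1 - t) ^ 2 + (-1 - t) = 1 := by linear_combination ht
  obtain ⟨ψ₁, h₁⟩ := exists_hom hw ht
  obtain ⟨ψ₂, h₂⟩ := exists_hom hw ht'
  refine ⟨ψ₁, ψ₂, injective_of_apply_ne_one ψ₁ (h₁ true ▸ slGen_true_ne_one hw _),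
    injective_of_apply_ne_one ψ₂ (h₂ true ▸ slGen_true_ne_one hw _), ?_, fun ψ hψ => ?_⟩
  · rintro ⟨g, hg⟩
    rcases trace_eq_or_eq_neg_of_conj hw (g := g) (t := t) (t' := -1 - t)
      (fun b => by rw [← h₁, ← h₂, hg]) with h | h
    · exact h5 (by linear_combination (1 + 2 * t) * (-h) - 4 * ht)
    · exact one_ne_zero (α := K) (by linear_combination -h)
  · have hne : ∀ x, x ≠ 1 → ψ x ≠ 1 := fun x hx h => hx (hψ (h.trans (map_one ψ).symm))
    obtain ⟨u, hu, g, hg₁, hg₂⟩ := exists_conj_of_relations hw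
      (hne (altGen true) (by decide)) (hne (altGen false) (by decide))
      (by rw [← map_mul]; exact hne _ (by decide))
      (by rw [← map_pow, show altGen true ^ 2 = 1 by decide, map_one])
      (by rw [← map_pow, show altGen false ^ 3 = 1 by decide, map_one])
      (by rw [← map_mul, ← map_pow,
        show (altGen true * altGen false) ^ 5 = 1 by decide, map_one])
    have conj_of_eq : ∀ χ : alternatingGroup (Fin 5) →* PSL(2, K),
        (∀ b, χ (altGen b) = slGen hw u b) → ConjEquiv χ ψ := by
      refine fun χ hχ => ⟨g, fun x => ?_⟩
      have : ψ = (MulAut.conj g).toMonoidHom.comp χ :=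
        hom_ext_of_words words_surj fun b => by cases b <;> simp [hχ, hg₁, hg₂]
      simp [this]
    have : (u - t) * (u - (-1 - t)) = 0 := by linear_combination hu - ht
    rcases mul_eq_zero.1 this with h | h
    · obtain rfl := sub_eq_zero.1 h
      exact Or.inl (conj_of_eq ψ₁ h₁)
    · obtain rfl := sub_eq_zero.1 h
      exact Or.inr (conj_of_eq ψ₂ h₂)

end Icosahedral

theorem stmt_16 (p : ℕ) [Fact p.Prime] (hp2 : p ≠ 2) (hp5 : p ≠ 5) :
    ∃ ψ₁ ψ₂ : ↥(alternatingGroup (Fin 5)) →*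
        Matrix.ProjectiveSpecialLinearGroup (Fin 2) (AlgebraicClosure (ZMod p)),
      Function.Injective ψ₁ ∧ Function.Injective ψ₂ ∧ ¬ ConjEquiv ψ₁ ψ₂ ∧
      ∀ ψ : ↥(alternatingGroup (Fin 5)) →*
          Matrix.ProjectiveSpecialLinearGroup (Fin 2) (AlgebraicClosure (ZMod p)),
        Function.Injective ψ → (ConjEquiv ψ₁ ψ ∨ ConjEquiv ψ₂ ψ) := by
  refine Icosahedral.two_orbits fun h => hp5 ?_
  have : CharP (AlgebraicClosure (ZMod p)) p := inferInstance
  have hdvd : p ∣ 5 :=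
    (CharP.cast_eq_zero_iff (AlgebraicClosure (ZMod p)) p 5).1 (by exact_mod_cast h)
  exact (Nat.prime_dvd_prime_iff_eq Fact.out Nat.prime_five).1 hdvd
end

section
/- Let q be an odd prime power and let I be a subgroup of PSL(2, F_q) isomorphic to the alternating group A₅. In the natural action of PSL(2, F_q) on the left cosets of I, every element of order 2 of PSL(2, F_q) fixes exactly (q−1)/4 cosets if q ≡ 1 (mod 4), and exactly (q+1)/4 cosets if q ≡ 3 (mod 4). -/
open Matrix

section FixedCosets

variable {G : Type*} [Group G]

/-- If all elements of order two are conjugate to `x`, the number of elements conjugating `x` into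
a subgroup `I` is the number of involutions of `I` times the order of the centralizer of `x`. -/
lemma card_conj_mem_eq_of_forall_isConj (I : Subgroup G) {x : G} (hx : orderOf x = 2)
    (hconj : ∀ y : G, orderOf y = 2 → IsConj y x) :
    Nat.card {g : G // g⁻¹ * x * g ∈ I} =
      Nat.card {y : I // orderOf y = 2} * Nat.card (Subgroup.centralizer {x}) := by
  have key : ∀ y : {y : I // orderOf y = 2}, ∃ c : G, c * (y : I) * c⁻¹ = x := fun y ↦
    isConj_iff.1 (hconj _ (by rw [Subgroup.orderOf_coe]; exact y.2))
  choose c hc using key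
  have hc' : ∀ y, (c y)⁻¹ * x * c y = (y : I) := fun y ↦ by
    conv_lhs => rw [← hc y]
    group
  have hk : ∀ (y) (k : Subgroup.centralizer {x}),
      ((k : G) * c y)⁻¹ * x * (k * c y) = (y : I) := fun y k ↦ by
    rw [← hc' y]
    have := Subgroup.mem_centralizer_singleton_iff.1 k.2
    calc _ = (c y)⁻¹ * (k : G)⁻¹ * (x * k) * c y := by group
      _ = (c y)⁻¹ * (k : G)⁻¹ * (k * x) * c y := by rw [this]
      _ = _ := by group
  rw [← Nat.card_prod]
  symm
  refine Nat.card_congr (Equiv.ofBijective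
    (fun p ↦ ⟨p.2 * c p.1, by rw [hk]; exact p.1.1.2⟩) ⟨?_, ?_⟩)
  · rintro ⟨y, k⟩ ⟨y', k'⟩ h
    have h : (k : G) * c y = k' * c y' := congrArg Subtype.val h
    have hy : y = y' := by
      apply Subtype.ext
      apply Subtype.ext
      rw [← hk y k, h, hk]
    subst hy
    simpa using h
  · rintro ⟨g, hg⟩
    have ho : orderOf (⟨g⁻¹ * x * g, hg⟩ : I) = 2 := by
      rw [Subgroup.orderOf_mk, ← hx, ← (MulAut.conj g⁻¹).orderOf_eq x]
      simp
    let y : {y : I // orderOf y = 2} := ⟨_, ho⟩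
    have hy : (c y)⁻¹ * x * c y = g⁻¹ * x * g := hc' y
    refine ⟨⟨y, ⟨g * (c y)⁻¹, ?_⟩⟩, by simp⟩
    rw [Subgroup.mem_centralizer_singleton_iff]
    calc g * (c y)⁻¹ * x = g * ((c y)⁻¹ * x * c y) * (c y)⁻¹ := by group
      _ = x * (g * (c y)⁻¹) := by rw [hy]; group

lemma ncard_fixed_cosets_mul_card (I : Subgroup G) {x : G} (hx : orderOf x = 2)
    (hconj : ∀ y : G, orderOf y = 2 → IsConj y x) :
    {z : G ⧸ I | x • z = z}.ncard * Nat.card I =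
      Nat.card {y : I // orderOf y = 2} * Nat.card (Subgroup.centralizer {x}) := by
  rw [← card_conj_mem_eq_of_forall_isConj I hx hconj, mul_comm, ← Nat.card_coe_set_eq,
    ← QuotientGroup.card_preimage_mk]
  refine Nat.card_congr (Equiv.subtypeEquivRight fun g ↦ ?_)
  change x • (g : G ⧸ I) = g ↔ _
  rw [eq_comm, MulAction.Quotient.smul_coe, QuotientGroup.eq, smul_eq_mul, mul_assoc]

end FixedCosets

lemma Equiv.Perm.mem_alternatingGroup_five_and_orderOf_eq_two_iff {g : Equiv.Perm (Fin 5)} :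
    g ∈ alternatingGroup (Fin 5) ∧ orderOf g = 2 ↔ g.cycleType = {2, 2} := by
  constructor
  · rintro ⟨hg, ho⟩
    obtain ⟨n, hn⟩ := cycleType_prime_order (σ := g) (ho ▸ Nat.prime_two)
    have hsum := g.sum_cycleType_le
    rw [hn, ho, Multiset.sum_replicate, smul_eq_mul, Fintype.card_fin] at hsum
    rw [mem_alternatingGroup, sign_of_cycleType, hn, ho, Multiset.sum_replicate,
      Multiset.card_replicate] at hg
    have h2 : n < 2 := by omega
    interval_cases n
    · exact absurd hg (by decide)
    · rw [hn, ho]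
      rfl
  · intro h
    constructor
    · rw [mem_alternatingGroup, sign_of_cycleType, h]
      rfl
    · rw [← lcm_cycleType, h]
      simp

lemma card_involutions_alternatingGroup_five :
    Nat.card {y : alternatingGroup (Fin 5) // orderOf y = 2} = 15 := by
  have h := Equiv.Perm.card_of_cycleType (Fin 5) {2, 2}
  rw [if_pos (by decide)] at h
  have e : {y : alternatingGroup (Fin 5) // orderOf y = 2} ≃
      {g : Equiv.Perm (Fin 5) // g.cycleType = {2, 2}} :=
    (Equiv.subtypeEquivRight fun y ↦ by rw [← Subgroup.orderOf_coe]).trans <|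
    (Equiv.subtypeSubtypeEquivSubtypeInter (· ∈ alternatingGroup (Fin 5))
      (fun g ↦ orderOf g = 2)).trans <|
    Equiv.subtypeEquivRight fun g ↦
      Equiv.Perm.mem_alternatingGroup_five_and_orderOf_eq_two_iff
  rw [Nat.card_congr e, Nat.card_eq_fintype_card, Fintype.card_subtype, h]
  decide

section FiniteField

variable {F : Type*} [Field F] [Fintype F] [DecidableEq F]

/-- The number of representations of a nonzero element of a finite field as a sum of two
squares. -/
lemma card_sum_two_squares (hF : ringChar F ≠ 2) {c : F} (hc : c ≠ 0) :
    (Nat.card {p : F × F // p.1 ^ 2 + p.2 ^ 2 = c} : ℤ) =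
      Fintype.card F - quadraticChar F (-1) := by
  have hs : ∀ u : F, (Fintype.card {a : F // a ^ 2 = u} : ℤ) = quadraticChar F u + 1 := fun u ↦ by
    rw [← quadraticChar_card_sqrts hF u, Set.toFinset_card]
    rfl
  let e : {p : F × F // p.1 ^ 2 + p.2 ^ 2 = c} ≃
      Σ u : F, {a : F // a ^ 2 = u} × {b : F // b ^ 2 = c - u} :=
    { toFun := fun p ↦ ⟨p.1.1 ^ 2, ⟨p.1.1, rfl⟩, ⟨p.1.2, by linear_combination p.2⟩⟩
      invFun := fun s ↦ ⟨(s.2.1, s.2.2), by rw [s.2.1.2, s.2.2.2]; ring⟩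
      left_inv := fun p ↦ rfl
      right_inv := by
        rintro ⟨u, ⟨a, rfl⟩, b⟩
        rfl }
  have hj : ∑ u : F, quadraticChar F u * quadraticChar F (c - u) = -quadraticChar F (-1) := by
    rw [← jacobiSum_nontrivial_inv (quadraticChar_ne_one hF), (quadraticChar_isQuadratic F).inv,
      jacobiSum, ← Equiv.sum_comp (Equiv.mulLeft₀ c hc)]
    refine Finset.sum_congr rfl fun u _ ↦ ?_
    have h1 : c - c * u = c * (1 - u) := by ring
    simp only [Equiv.mulLeft₀_apply, h1, map_mul]
    linear_combination
      (quadraticChar F u * quadraticChar F (1 - u)) * quadraticChar_sq_one hc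
  have h0 : ∑ u : F, quadraticChar F (c - u) = 0 :=
    ((Equiv.subLeft c).sum_comp (quadraticChar F ·)).trans (quadraticChar_sum_zero hF)
  rw [Nat.card_congr e, Nat.card_eq_fintype_card, Fintype.card_sigma]
  push_cast [Fintype.card_prod, hs]
  simp only [add_mul, mul_add, one_mul, mul_one, Finset.sum_add_distrib, hj, h0,
    quadraticChar_sum_zero hF]
  simp
  ring

lemma exists_sq_add_sq_eq (hF : ringChar F ≠ 2) {c : F} (hc : c ≠ 0) :
    ∃ a b : F, a ^ 2 + b ^ 2 = c := by
  have h := card_sum_two_squares hF hc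
  have h1 : (1 : ℤ) < Fintype.card F := by exact_mod_cast Fintype.one_lt_card
  have h2 : quadraticChar F (-1) ≤ 1 := by
    rcases quadraticChar_dichotomy (F := F) (a := -1) (by simp) with h | h <;> simp [h]
  have h3 : 0 < Nat.card {p : F × F // p.1 ^ 2 + p.2 ^ 2 = c} := by omega
  obtain ⟨⟨⟨⟨a, b⟩, hab⟩⟩, -⟩ := Nat.card_pos_iff.1 h3
  exact ⟨a, b, hab⟩

/-- A binary quadratic form of discriminant `-4` over a finite field of odd order represents
`1`. -/
lemma exists_binary_form_eq_one (hF : ringChar F ≠ 2) {a b c : F} (h : a ^ 2 + b * c = -1) :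
    ∃ u v : F, c * u ^ 2 - 2 * a * u * v - b * v ^ 2 = 1 := by
  by_cases hc : c = 0
  · subst hc
    have h2 : (2 : F) ≠ 0 := Ring.two_ne_zero hF
    have ha : a ≠ 0 := by
      rintro rfl
      simp at h
    exact ⟨-(1 + b) / (2 * a), 1, by field_simp; ring⟩
  · obtain ⟨w, v, hwv⟩ := exists_sq_add_sq_eq hF hc
    refine ⟨(w + a * v) / c, v, ?_⟩
    field_simp
    linear_combination hwv - v ^ 2 * h

end FiniteField

section PSL

variable {F : Type*} [Field F]

lemma Matrix.SpecialLinearGroup.mem_center_fin_two_iff {A : SpecialLinearGroup (Fin 2) F} :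
    A ∈ Subgroup.center (SpecialLinearGroup (Fin 2) F) ↔ A = 1 ∨ A = -1 := by
  rw [SpecialLinearGroup.mem_center_iff]
  constructor
  · rintro ⟨r, hr, hA⟩
    rw [Fintype.card_fin, sq_eq_one_iff] at hr
    rcases hr with rfl | rfl
    · left
      ext i j
      simp [← hA]
    · right
      ext i j
      rw [← hA]
      fin_cases i <;> fin_cases j <;> simp
  · rintro (rfl | rfl)
    · exact ⟨1, by simp, by simp⟩
    · refine ⟨-1, by simp, ?_⟩
      ext i j
      fin_cases i <;> fin_cases j <;> simp

lemma Matrix.ProjectiveSpecialLinearGroup.mk_eq_mk_iff {A B : SpecialLinearGroup (Fin 2) F} :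
    (A : ProjectiveSpecialLinearGroup (Fin 2) F) = B ↔ A = B ∨ A = -B := by
  rw [eq_comm, QuotientGroup.eq, SpecialLinearGroup.mem_center_fin_two_iff, inv_mul_eq_one,
    inv_mul_eq_iff_eq_mul, mul_neg_one, eq_comm]

lemma Matrix.SpecialLinearGroup.card_center_fin_two (hF : ringChar F ≠ 2) :
    Nat.card (Subgroup.center (SpecialLinearGroup (Fin 2) F)) = 2 := by
  have h : (Subgroup.center (SpecialLinearGroup (Fin 2) F) :
      Set (SpecialLinearGroup (Fin 2) F)) = {1, -1} := by
    ext A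
    simp [mem_center_fin_two_iff]
  rw [← SetLike.coe_sort_coe, h, Nat.card_coe_set_eq, Set.ncard_pair]
  intro h1
  have h2 := congrArg (fun A : SpecialLinearGroup (Fin 2) F ↦ A 0 0) h1
  exact Ring.neg_one_ne_one_of_char_ne_two hF (by simpa using h2.symm)

/-- Rotation by a quarter turn, as an element of `SL(2, F)`. -/
def quarterTurn (F : Type*) [Field F] : SpecialLinearGroup (Fin 2) F :=
  ⟨!![0, -1; 1, 0], by simp [det_fin_two]⟩

lemma mul_quarterTurn_eq_iff {X : SpecialLinearGroup (Fin 2) F} :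
    X * quarterTurn F = quarterTurn F * X ↔ X 1 1 = X 0 0 ∧ X 0 1 = -X 1 0 := by
  have h : X * quarterTurn F = quarterTurn F * X ↔
      (X : Matrix (Fin 2) (Fin 2) F) * !![0, -1; 1, 0] = !![0, -1; 1, 0] * X.1 := Subtype.ext_iff
  rw [h, ← Matrix.ext_iff]
  simp [Fin.forall_fin_two, Matrix.mul_apply, Fin.sum_univ_two]
  grind

lemma mul_quarterTurn_eq_neg_iff {X : SpecialLinearGroup (Fin 2) F} :
    X * quarterTurn F = -(quarterTurn F * X) ↔ X 1 1 = -X 0 0 ∧ X 0 1 = X 1 0 := by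
  have h : X * quarterTurn F = -(quarterTurn F * X) ↔
      (X : Matrix (Fin 2) (Fin 2) F) * !![0, -1; 1, 0] = -(!![0, -1; 1, 0] * X.1) := Subtype.ext_iff
  rw [h, ← Matrix.ext_iff]
  simp [Fin.forall_fin_two, Matrix.mul_apply, Fin.sum_univ_two, -neg_mul, -cons_mul]
  grind

lemma isConj_quarterTurn [Fintype F] (hF : ringChar F ≠ 2)
    {x : ProjectiveSpecialLinearGroup (Fin 2) F} (hx : orderOf x = 2) :
    IsConj (quarterTurn F : ProjectiveSpecialLinearGroup (Fin 2) F) x := by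
  classical
  obtain ⟨X, rfl⟩ := QuotientGroup.mk_surjective x
  obtain ⟨hx2, hx1⟩ := orderOf_eq_prime_iff.1 hx
  have h2 : (2 : F) ≠ 0 := Ring.two_ne_zero hF
  rw [← QuotientGroup.mk_pow, ← QuotientGroup.mk_one,
    ProjectiveSpecialLinearGroup.mk_eq_mk_iff, sq] at hx2
  rw [← QuotientGroup.mk_one, Ne, ProjectiveSpecialLinearGroup.mk_eq_mk_iff] at hx1
  have hdet : X 0 0 * X 1 1 - X 0 1 * X 1 0 = 1 := by rw [← det_fin_two, X.det_coe]
  have hentry : ∀ i j, (X * X) i j = X i 0 * X 0 j + X i 1 * X 1 j := fun i j ↦ by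
    simp [Matrix.mul_apply, Fin.sum_univ_two]
  have h00 := hentry 0 0
  have h01 := hentry 0 1
  have h10 := hentry 1 0
  have h11 := hentry 1 1
  have hX : X 1 1 = -X 0 0 := by
    rcases hx2 with h | h <;> rw [h] at h00 h01 h10 h11 <;> simp at h00 h01 h10 h11
    · exfalso
      have ht : X 0 0 + X 1 1 ≠ 0 := fun ht ↦ h2 (by linear_combination h00 - hdet + X 0 0 * ht)
      have hb : X 0 1 = 0 := by
        apply (mul_eq_zero.1 (_ : X 0 1 * (X 0 0 + X 1 1) = 0)).resolve_right ht
        linear_combination -h01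
      have hc : X 1 0 = 0 := by
        apply (mul_eq_zero.1 (_ : X 1 0 * (X 0 0 + X 1 1) = 0)).resolve_right ht
        linear_combination -h10
      have had : X 1 1 = X 0 0 := by
        rw [← sub_eq_zero]
        apply (mul_eq_zero.1 (_ : (X 1 1 - X 0 0) * (X 0 0 + X 1 1) = 0)).resolve_right ht
        linear_combination h00 - h11
      have ha : X 0 0 ^ 2 = 1 := by rw [had, hb] at hdet; linear_combination hdet
      apply hx1
      rcases sq_eq_one_iff.1 ha with ha | ha
      · left
        ext i j
        fin_cases i <;> fin_cases j <;> simp [ha, hb, hc, had]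
      · right
        ext i j
        fin_cases i <;> fin_cases j <;> simp [ha, hb, hc, had]
    · have : (X 0 0 + X 1 1) ^ 2 = 0 := by linear_combination -h00 - h11 + 2 * hdet
      linear_combination pow_eq_zero_iff (two_ne_zero) |>.1 this
  obtain ⟨u, v, huv⟩ := exists_binary_form_eq_one hF (a := X 0 0) (b := X 0 1) (c := X 1 0)
    (by rw [hX] at hdet; linear_combination -hdet)
  let g : SpecialLinearGroup (Fin 2) F :=
    ⟨!![u, X 0 0 * u + X 0 1 * v; v, X 1 0 * u - X 0 0 * v], by
      rw [det_fin_two_of]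
      linear_combination huv⟩
  refine isConj_iff.2 ⟨g, ?_⟩
  rw [mul_inv_eq_iff_eq_mul]
  have hg : g * quarterTurn F = X * g := by
    apply Subtype.ext
    change g.1 * !![0, -1; 1, 0] = X.1 * g.1
    rw [hX] at hdet
    rw [← Matrix.ext_iff]
    simp [g, Fin.forall_fin_two, Matrix.mul_apply, Fin.sum_univ_two, hX]
    refine ⟨?_, by ring, ?_⟩
    · linear_combination u * hdet
    · linear_combination v * hdet
  exact congrArg QuotientGroup.mk hg

lemma card_centralizer_quarterTurn [Fintype F] [DecidableEq F] (hF : ringChar F ≠ 2) :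
    (Nat.card (Subgroup.centralizer
      {(quarterTurn F : ProjectiveSpecialLinearGroup (Fin 2) F)}) : ℤ) =
      Fintype.card F - quadraticChar F (-1) := by
  have h2 : (2 : F) ≠ 0 := Ring.two_ne_zero hF
  have hpre := QuotientGroup.card_preimage_mk (Subgroup.center (SpecialLinearGroup (Fin 2) F))
    (Subgroup.centralizer {(quarterTurn F : ProjectiveSpecialLinearGroup (Fin 2) F)} : Set _)
  have hmem : ∀ X : SpecialLinearGroup (Fin 2) F,
      X ∈ (QuotientGroup.mk ⁻¹' (Subgroup.centralizer
        {(quarterTurn F : ProjectiveSpecialLinearGroup (Fin 2) F)} :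
          Set (ProjectiveSpecialLinearGroup (Fin 2) F))) ↔
      (X 1 1 = X 0 0 ∧ X 0 1 = -X 1 0) ∨ (X 1 1 = -X 0 0 ∧ X 0 1 = X 1 0) := fun X ↦ by
    rw [Set.mem_preimage, SetLike.mem_coe, Subgroup.mem_centralizer_singleton_iff,
      ← QuotientGroup.mk_mul, ← QuotientGroup.mk_mul, ProjectiveSpecialLinearGroup.mk_eq_mk_iff,
      mul_quarterTurn_eq_iff, mul_quarterTurn_eq_neg_iff]
  let f : {p : F × F // p.1 ^ 2 + p.2 ^ 2 = 1} ⊕ {p : F × F // p.1 ^ 2 + p.2 ^ 2 = -1} →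
      (QuotientGroup.mk ⁻¹' (Subgroup.centralizer
        {(quarterTurn F : ProjectiveSpecialLinearGroup (Fin 2) F)} :
          Set (ProjectiveSpecialLinearGroup (Fin 2) F)) :
            Set (SpecialLinearGroup (Fin 2) F)) :=
    Sum.elim
      (fun p ↦ ⟨⟨!![p.1.1, -p.1.2; p.1.2, p.1.1], by
        rw [det_fin_two_of]; linear_combination p.2⟩, (hmem _).2 (.inl (by simp))⟩)
      (fun p ↦ ⟨⟨!![p.1.1, p.1.2; p.1.2, -p.1.1], by
        rw [det_fin_two_of]; linear_combination -p.2⟩, (hmem _).2 (.inr (by simp))⟩)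
  have hf : Function.Bijective f := by
    constructor
    · have hentries : ∀ s t, f s = f t → ∀ i j, (f s).1 i j = (f t).1 i j :=
        fun s t h i j ↦ by rw [h]
      rintro (⟨⟨a, b⟩, h⟩ | ⟨⟨a, b⟩, h⟩) (⟨⟨a', b'⟩, h'⟩ | ⟨⟨a', b'⟩, h'⟩) hst <;>
        have h00 := hentries _ _ hst 0 0 <;> have h10 := hentries _ _ hst 1 0 <;>
        have h01 := hentries _ _ hst 0 1 <;> have h11 := hentries _ _ hst 1 1 <;>
        simp [f] at h00 h10 h01 h11 h h' ⊢ <;> grind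
    · rintro ⟨X, hX⟩
      have hdet : X 0 0 * X 1 1 - X 0 1 * X 1 0 = 1 := by rw [← det_fin_two, X.det_coe]
      rcases (hmem X).1 hX with ⟨h1, h3⟩ | ⟨h1, h3⟩
      · refine ⟨.inl ⟨(X 0 0, X 1 0), ?_⟩, ?_⟩
        · rw [h1, h3] at hdet
          linear_combination hdet
        · apply Subtype.ext
          ext i j
          fin_cases i <;> fin_cases j <;> simp [f, h1, h3]
      · refine ⟨.inr ⟨(X 0 0, X 1 0), ?_⟩, ?_⟩
        · rw [h1, h3] at hdet
          linear_combination -hdet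
        · apply Subtype.ext
          ext i j
          fin_cases i <;> fin_cases j <;> simp [f, h1, h3]
  rw [← Nat.card_congr (Equiv.ofBijective f hf), Nat.card_sum,
    SpecialLinearGroup.card_center_fin_two hF] at hpre
  have h1 := card_sum_two_squares hF (one_ne_zero (α := F))
  have h3 := card_sum_two_squares hF (neg_ne_zero.2 (one_ne_zero (α := F)))
  simp only [SetLike.coe_sort_coe] at hpre
  omega

lemma card_centralizer_of_orderOf_eq_two [Fintype F] [DecidableEq F] (hF : ringChar F ≠ 2)
    {x : ProjectiveSpecialLinearGroup (Fin 2) F} (hx : orderOf x = 2) :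
    (Nat.card (Subgroup.centralizer {x}) : ℤ) = Fintype.card F - quadraticChar F (-1) := by
  rw [← card_centralizer_quarterTurn hF, Subgroup.nat_card_centralizer_nat_card_stabilizer,
    Subgroup.nat_card_centralizer_nat_card_stabilizer]
  obtain ⟨c, hc⟩ := isConj_iff.1 (isConj_quarterTurn hF hx)
  have : x = ConjAct.toConjAct c • (quarterTurn F : ProjectiveSpecialLinearGroup (Fin 2) F) := by
    rw [ConjAct.toConjAct_smul, hc]
  rw [← Nat.card_congr (MulAction.stabilizerEquivStabilizer this).toEquiv]

end PSL

theorem stmt_17 (p n : ℕ) [Fact p.Prime] (hp : p ≠ 2) (hn : 0 < n)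
    (I : Subgroup (Matrix.ProjectiveSpecialLinearGroup (Fin 2) (GaloisField p n)))
    (hI : Nonempty (↥I ≃* ↥(alternatingGroup (Fin 5))))
    (x : Matrix.ProjectiveSpecialLinearGroup (Fin 2) (GaloisField p n))
    (hx : orderOf x = 2) :
    (p ^ n % 4 = 1 →
      {z : Matrix.ProjectiveSpecialLinearGroup (Fin 2) (GaloisField p n) ⧸ I |
        x • z = z}.ncard = (p ^ n - 1) / 4) ∧
    (p ^ n % 4 = 3 →
      {z : Matrix.ProjectiveSpecialLinearGroup (Fin 2) (GaloisField p n) ⧸ I |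
        x • z = z}.ncard = (p ^ n + 1) / 4) := by
  classical
  obtain ⟨e⟩ := hI
  let := Fintype.ofFinite (GaloisField p n)
  have hF : ringChar (GaloisField p n) ≠ 2 := by rwa [ringChar.eq (GaloisField p n) p]
  have hq : Fintype.card (GaloisField p n) = p ^ n := by
    rw [← Nat.card_eq_fintype_card, GaloisField.card p n hn.ne']
  have hcardI : Nat.card I = 60 := by
    rw [Nat.card_congr e.toEquiv, nat_card_alternatingGroup, Nat.card_fin]
    rfl
  have hinv : Nat.card {y : I // orderOf y = 2} = 15 := by
    rw [← card_involutions_alternatingGroup_five]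
    exact Nat.card_congr (e.toEquiv.subtypeEquiv fun y ↦ by simp)
  have hfix := ncard_fixed_cosets_mul_card I hx fun y hy ↦
    (isConj_quarterTurn hF hy).symm.trans (isConj_quarterTurn hF hx)
  have hcent := card_centralizer_of_orderOf_eq_two hF hx
  rw [hcardI, hinv] at hfix
  rw [quadraticChar_neg_one hF, hq] at hcent
  refine ⟨fun h ↦ ?_, fun h ↦ ?_⟩
  · rw [ZMod.χ₄_nat_one_mod_four h] at hcent
    omega
  · rw [ZMod.χ₄_nat_three_mod_four h] at hcent
    omega
end

section
/- Let q be a prime power such that PSL(2, F_q) contains a proper subgroup I isomorphic to the alternating group A₅. Then the natural action of PSL(2, F_q) on the left cosets of I is doubly transitive if and only if q = 9 or q = 11. -/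
section

open MulAction

theorem card_orbit_dvd_card (G : Type*) [Group G] {X : Type*} [MulAction G X] (x : X) :
    Nat.card (orbit G x) ∣ Nat.card G := by
  rw [Nat.card_coe_set_eq, ← index_stabilizer]
  exact Subgroup.index_dvd_card _

/-- A simple group with more than `k!` elements has no orbit of size between `2` and `k`. -/
theorem smul_eq_of_factorial_card_orbit_lt {G X : Type*} [Group G] [IsSimpleGroup G]
    [MulAction G X] (x : X) [Finite (orbit G x)]
    (h : (Nat.card (orbit G x)).factorial < Nat.card G) (g : G) : g • x = x := by
  have : Finite G := Nat.finite_of_card_ne_zero (by omega)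
  rcases (inferInstance : (toPermHom G (orbit G x)).ker.Normal).eq_bot_or_eq_top with hk | hk
  · rw [MonoidHom.ker_eq_bot_iff] at hk
    have := Nat.card_le_card_of_injective _ hk
    rw [Nat.card_perm] at this
    omega
  · have hg : g ∈ (toPermHom G (orbit G x)).ker := hk ▸ Subgroup.mem_top g
    have := congrArg Subtype.val
      (DFunLike.congr_fun (MonoidHom.mem_ker.mp hg) (⟨x, mem_orbit_self x⟩ : orbit G x))
    simpa using this

section Cosets

variable {G : Type*} [Group G] {I : Subgroup G}

theorem card_pred_dvd_of_doubly_transitive [Finite G] (hI : I ≠ ⊤)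
    (h : ∀ a b c d : G ⧸ I, a ≠ b → c ≠ d → ∃ g : G, g • a = c ∧ g • b = d) :
    I.index - 1 ∣ Nat.card I := by
  obtain ⟨x, hx⟩ : ∃ x, x ∉ I := by
    by_contra! hc
    exact hI (eq_top_iff.mpr fun x _ => hc x)
  have hx' : ((1 : G) : G ⧸ I) ≠ x := fun hc => hx (by simpa using QuotientGroup.eq.mp hc)
  have horb : orbit I (x : G ⧸ I) = {((1 : G) : G ⧸ I)}ᶜ := by
    ext b
    constructor
    · rintro ⟨i, rfl⟩ hc
      apply hx
      have hc : ((i * x : G) : G ⧸ I) = (1 : G) := hc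
      have := QuotientGroup.eq.mp hc.symm
      rw [inv_one, one_mul] at this
      exact (I.mul_mem_cancel_left i.2).mp this
    · intro hb
      obtain ⟨g, h1, h2⟩ := h _ x _ b hx' (Ne.symm hb)
      have h1 : ((g * 1 : G) : G ⧸ I) = (1 : G) := h1
      have hg := QuotientGroup.eq.mp h1.symm
      exact ⟨⟨g, by simpa using hg⟩, h2⟩
  have := card_orbit_dvd_card I (x : G ⧸ I)
  rwa [horb, Nat.card_coe_set_eq, Set.ncard_compl, Set.ncard_singleton] at this

theorem doubly_transitive_of_stabilizer
    (h : ∀ a b : G ⧸ I, a ≠ (1 : G) → b ≠ (1 : G) → b ∈ orbit I a)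
    (a b c d : G ⧸ I) (hab : a ≠ b) (hcd : c ≠ d) : ∃ g : G, g • a = c ∧ g • b = d := by
  obtain ⟨x, rfl⟩ := QuotientGroup.mk_surjective a
  obtain ⟨y, rfl⟩ := QuotientGroup.mk_surjective c
  have key (z : G) : z⁻¹ • (z : G ⧸ I) = (1 : G) := by
    rw [MulAction.Quotient.smul_coe, smul_eq_mul, inv_mul_cancel]
  have key' (z : G) : z • ((1 : G) : G ⧸ I) = z := by
    rw [MulAction.Quotient.smul_coe, smul_eq_mul, mul_one]
  obtain ⟨i, hi⟩ := h (x⁻¹ • b) (y⁻¹ • d)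
    (by rwa [← key x, Ne, smul_left_cancel_iff, eq_comm])
    (by rwa [← key y, Ne, smul_left_cancel_iff, eq_comm])
  have hi1 : (i : G) • ((1 : G) : G ⧸ I) = (1 : G) := by
    rw [key']
    exact QuotientGroup.eq.mpr (by simp)
  have hi2 : (i : G) • x⁻¹ • b = y⁻¹ • d := hi
  exact ⟨y * i * x⁻¹, by rw [mul_smul, mul_smul, key, hi1, key'],
    by rw [mul_smul, mul_smul, hi2, smul_inv_smul]⟩

theorem orbit_subset_compl_one {a : G ⧸ I} (ha : a ≠ (1 : G)) :
    orbit I a ⊆ {((1 : G) : G ⧸ I)}ᶜ := by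
  rintro _ ⟨i, rfl⟩ hc
  apply ha
  have hc : (i : G) • a = (1 : G) := hc
  rw [← inv_smul_smul (i : G) a, hc]
  exact QuotientGroup.eq.mpr (by simp)

theorem ncard_compl_one [Finite G] : ({((1 : G) : G ⧸ I)}ᶜ : Set (G ⧸ I)).ncard = I.index - 1 := by
  rw [Set.ncard_compl, Set.ncard_singleton, Subgroup.index]

theorem card_orbit_lt_index [Finite G] {a : G ⧸ I} (ha : a ≠ (1 : G)) :
    Nat.card (orbit I a) < I.index := by
  have h1 := Set.ncard_le_ncard (orbit_subset_compl_one ha)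
  rw [ncard_compl_one] at h1
  have := I.index_ne_zero_of_finite
  rw [Nat.card_coe_set_eq]
  omega

theorem mem_orbit_of_card_orbit [Finite G] {a b : G ⧸ I} (ha : a ≠ (1 : G)) (hb : b ≠ (1 : G))
    (h : Nat.card (orbit I a) + 1 = I.index) : b ∈ orbit I a := by
  rw [Set.eq_of_subset_of_ncard_le (orbit_subset_compl_one ha)]
  · exact hb
  · rw [ncard_compl_one, ← Nat.card_coe_set_eq]
    omega

/-- If `I` fixes every coset of `I`, then `I` is normal. -/
theorem normal_of_forall_smul_eq (h : ∀ (i : I) (a : G ⧸ I), i • a = a) : I.Normal := by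
  refine ⟨fun i hi g => ?_⟩
  have h1 : ((i * g⁻¹ : G) : G ⧸ I) = (g⁻¹ : G) := h ⟨i, hi⟩ (g⁻¹ : G)
  simpa [mul_assoc] using QuotientGroup.eq.mp h1.symm

/-- A simple subgroup of order `60` and index `6` in a simple group acts transitively on the
nontrivial cosets. -/
theorem mem_orbit_of_index_six [Finite G] [IsSimpleGroup G] [IsSimpleGroup I]
    (hcard : Nat.card I = 60) (hindex : I.index = 6) {a b : G ⧸ I} (ha : a ≠ (1 : G))
    (hb : b ≠ (1 : G)) : b ∈ orbit I a := by
  by_cases h5 : ∃ c : G ⧸ I, c ≠ (1 : G) ∧ Nat.card (orbit I c) = 5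
  · obtain ⟨c, hc, h5⟩ := h5
    have h1 := mem_orbit_of_card_orbit hc ha (by omega)
    rw [orbit_eq_iff.mpr h1]
    exact mem_orbit_of_card_orbit hc hb (by omega)
  · push Not at h5
    exfalso
    have hn : I.Normal := by
      refine normal_of_forall_smul_eq fun i c => ?_
      by_cases hc : c = (1 : G)
      · rw [hc]
        change ((i * 1 : G) : G ⧸ I) = (1 : G)
        exact QuotientGroup.eq.mpr (by simp)
      · refine smul_eq_of_factorial_card_orbit_lt c ?_ i
        have h1 := card_orbit_lt_index hc
        have h2 := h5 c hc
        have h3 : Nat.card (orbit I c) ≤ 4 := by omega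
        have := Nat.factorial_le h3
        rw [hcard]
        exact this.trans_lt (by decide)
    rcases hn.eq_bot_or_eq_top with h | h
    · rw [h, Subgroup.card_bot] at hcard
      omega
    · rw [h, Subgroup.index_top] at hindex
      omega

/-- The number of cosets of `I` fixed by a Sylow subgroup of `I` divides the order of its
normalizer. -/
theorem card_fixedPoints_dvd_card_normalizer [Finite G] {p : ℕ} [Fact p.Prime] (P : Sylow p I) :
    Nat.card (fixedPoints P (G ⧸ I)) ∣
      Nat.card (Subgroup.normalizer (P.map I.subtype : Set G)) := by
  set Q := (P : Subgroup I).map I.subtype with hQ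
  have hQI : Q ≤ I := Subgroup.map_subtype_le _
  set N := Subgroup.normalizer (Q : Set G)
  have : fixedPoints P (G ⧸ I) = orbit N ((1 : G) : G ⧸ I) := by
    ext a
    obtain ⟨g, rfl⟩ := QuotientGroup.mk_surjective a
    constructor
    · intro hg
      have hconj : ∀ i ∈ P, g⁻¹ * (i : G) * g ∈ I := by
        intro i hi
        have h1 : ((i * g : G) : G ⧸ I) = (g : G) := hg ⟨i, hi⟩
        simpa [mul_assoc] using QuotientGroup.eq.mp h1.symm
      let f : P →* I :=
        (((MulAut.conj g⁻¹).toMonoidHom.comp I.subtype).comp (P : Subgroup I).subtype).codRestrict I fun i => by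
          simpa using hconj i i.2
      have hfv (i : P) : (f i : G) = g⁻¹ * (i : G) * g := by simp [f]
      have hfi : Function.Injective f := fun i j hij => by
        have := congrArg Subtype.val hij
        rw [hfv, hfv] at this
        exact Subtype.ext (Subtype.ext (by simpa using this))
      let R : Sylow p I := Sylow.ofCard f.range (by
        rw [← Nat.card_congr (MonoidHom.ofInjective hfi).toEquiv]
        exact P.card_eq_multiplicity)
      obtain ⟨i, hi⟩ := MulAction.exists_smul_eq I R P
      have hn : (i : G) * g⁻¹ ∈ N := by
        refine Subgroup.mem_normalizer_fintype ?_
        rintro _ ⟨q, hq, rfl⟩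
        have h1 : i * f ⟨q, hq⟩ * i⁻¹ ∈ (i • R : Sylow p I) :=
          Subgroup.smul_mem_pointwise_smul (f ⟨q, hq⟩) (MulAut.conj i) f.range ⟨_, rfl⟩
        rw [hi] at h1
        refine ⟨_, h1, ?_⟩
        simp [hfv, mul_assoc]
      refine ⟨⟨_, N.inv_mem hn⟩, ?_⟩
      change (((i * g⁻¹ : G)⁻¹ * 1 : G) : G ⧸ I) = (g : G)
      exact QuotientGroup.eq.mpr (by simp)
    · rintro ⟨n, hn⟩ i
      rw [← hn]
      change ((i * (n * 1) : G) : G ⧸ I) = ((n * 1 : G) : G ⧸ I)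
      refine QuotientGroup.eq.mpr ?_
      have h1 := (Subgroup.mem_normalizer_iff.mp (N.inv_mem n.2) (i : G)).mp ⟨i, i.2, rfl⟩
      have := hQI (Q.inv_mem h1)
      simpa [mul_assoc] using this
  rw [this]
  exact card_orbit_dvd_card N _

/-- A simple subgroup of order `60` and index `11` in a simple group without elements of order `15`
acts transitively on the nontrivial cosets. -/
theorem mem_orbit_of_index_eleven [Finite G] [IsSimpleGroup G] [IsSimpleGroup I]
    (hcard : Nat.card I = 60) (hindex : I.index = 11)
    (h15 : ∀ x y : G, Commute x y → x ^ 5 = 1 → y ^ 3 = 1 → x = 1 ∨ y = 1)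
    {a b : G ⧸ I} (ha : a ≠ (1 : G)) (hb : b ≠ (1 : G)) : b ∈ orbit I a := by
  have : Fact (Nat.Prime 3) := ⟨by norm_num⟩
  have : Fact (Nat.Prime 5) := ⟨by norm_num⟩
  have hG : Nat.card G = 660 := by rw [← I.card_mul_index, hcard, hindex]
  have hnn : ¬ I.Normal := by
    intro hn
    rcases hn.eq_bot_or_eq_top with h | h
    · rw [h, Subgroup.card_bot] at hcard
      omega
    · rw [h, Subgroup.index_top] at hindex
      omega
  obtain ⟨y, hy⟩ := exists_prime_orderOf_dvd_card' (G := I) 3 (by rw [hcard]; norm_num)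
  have hfac : (Nat.card I).factorization 3 = 1 := by
    rw [hcard, Nat.factorization_def _ (by norm_num)]
    exact (padicValNat.mul (p := 3) (a := 3) (b := 20) (by norm_num) (by norm_num)).trans (by
      rw [padicValNat.self (by norm_num), padicValNat.eq_zero_of_not_dvd (by norm_num)])
  let P : Sylow 3 I := Sylow.ofCard (Subgroup.zpowers y) (by
    rw [Nat.card_zpowers, hy, hfac, pow_one])
  have hf1 := P.2.card_modEq_card_fixedPoints (G ⧸ I)
  have hf2 := card_fixedPoints_dvd_card_normalizer P
  have hf3 := hf2.trans (Subgroup.card_subgroup_dvd_card _)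
  rw [hG] at hf3
  set f := Nat.card (fixedPoints P (G ⧸ I)) with hf
  have hXcard : Nat.card (G ⧸ I) = 11 := hindex
  have hf4 : f ≤ 11 := hXcard ▸ Nat.card_le_card_of_injective _ Subtype.val_injective
  rw [hXcard] at hf1
  have hf5 : f = 2 ∨ f = 5 ∨ f = 11 := by
    clear_value f
    have : ∀ f < 12, 11 ≡ f [MOD 3] → f ∣ 660 → f = 2 ∨ f = 5 ∨ f = 11 := by decide
    exact this f (by omega) hf1 hf3
  rcases hf5 with hf5 | hf5 | hf5
  · obtain ⟨c, hc1, hc⟩ : ∃ c : G ⧸ I, c ≠ (1 : G) ∧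
        fixedPoints P (G ⧸ I) = {((1 : G) : G ⧸ I), c} := by
      have h1 : ((1 : G) : G ⧸ I) ∈ fixedPoints P (G ⧸ I) := by
        intro i
        change ((i * 1 : G) : G ⧸ I) = (1 : G)
        exact QuotientGroup.eq.mpr (by simp)
      rw [hf, Nat.card_coe_set_eq, Set.ncard_eq_two] at hf5
      obtain ⟨u, v, huv, h⟩ := hf5
      rw [h] at h1 ⊢
      rcases h1 with h1 | h1
      · exact ⟨v, by rw [h1]; exact huv.symm, by rw [h1]⟩
      · have h1 : ((1 : G) : G ⧸ I) = v := h1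
        exact ⟨u, by rw [h1]; exact huv, by rw [h1, Set.pair_comm]⟩
    have hk1 := P.2.card_modEq_card_fixedPoints (orbit I c)
    have hk2 : Nat.card (fixedPoints P (orbit I c)) = 1 := by
      rw [Nat.card_eq_one_iff_exists]
      refine ⟨⟨⟨c, mem_orbit_self c⟩, fun i => Subtype.ext ?_⟩, ?_⟩
      · have : c ∈ fixedPoints P (G ⧸ I) := by rw [hc]; simp
        exact this i
      · rintro ⟨⟨d, hd⟩, hd'⟩
        have h1 : d ∈ fixedPoints P (G ⧸ I) := fun i => congrArg Subtype.val (hd' i)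
        rw [hc] at h1
        rcases h1 with h1 | h1
        · exact absurd h1 (orbit_subset_compl_one hc1 hd)
        · exact Subtype.ext (Subtype.ext h1)
    have hk3 := card_orbit_dvd_card I c
    have hk4 := card_orbit_lt_index hc1
    rw [hk2] at hk1
    rw [hcard] at hk3
    rw [hindex] at hk4
    have hk5 : Nat.card (orbit I c) ≤ 4 ∨ Nat.card (orbit I c) = 10 := by
      generalize Nat.card (orbit I c) = k at hk1 hk3 hk4
      have : ∀ k < 11, k ≡ 1 [MOD 3] → k ∣ 60 → k ≤ 4 ∨ k = 10 := by decide
      exact this k hk4 hk1 hk3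
    rcases hk5 with hk5 | hk5
    · exfalso
      have hfix : ∀ i : I, i • c = c := smul_eq_of_factorial_card_orbit_lt c (by
        rw [hcard]
        exact (Nat.factorial_le hk5).trans_lt (by decide))
      obtain ⟨g, rfl⟩ := QuotientGroup.mk_surjective c
      have hg : g⁻¹ ∈ Subgroup.normalizer (I : Set G) := by
        refine Subgroup.mem_normalizer_fintype fun i hi => ?_
        have h1 : ((i * g : G) : G ⧸ I) = (g : G) := hfix ⟨i, hi⟩
        simpa [mul_assoc] using QuotientGroup.eq.mp h1.symm
      have h1 := Subgroup.relIndex_mul_index (Subgroup.le_normalizer (H := I))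
      rw [hindex] at h1
      have h2 : (Subgroup.normalizer (I : Set G)).index ∣ 11 := ⟨_, by rw [mul_comm, h1]⟩
      rcases (Nat.dvd_prime (by norm_num)).mp h2 with h2 | h2
      · exact hnn (Subgroup.normalizer_eq_top_iff.mp (Subgroup.index_eq_one.mp h2))
      · rw [h2] at h1
        have h3 : I.relIndex (Subgroup.normalizer (I : Set G)) = 1 := by omega
        have h4 := Subgroup.relIndex_eq_one.mp h3 hg
        exact hc1 (QuotientGroup.eq.mpr (by simpa using h4))
    · have h1 := mem_orbit_of_card_orbit hc1 ha (by omega)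
      rw [orbit_eq_iff.mpr h1]
      exact mem_orbit_of_card_orbit hc1 hb (by omega)
  · exfalso
    rw [hf5] at hf2
    obtain ⟨⟨x, hxN⟩, hx⟩ := exists_prime_orderOf_dvd_card' 5 hf2
    rw [Subgroup.orderOf_mk] at hx
    have hx5 : x ^ 5 = 1 := hx ▸ pow_orderOf_eq_one x
    have hy3 : (y : G) ^ 3 = 1 := by
      rw [← Subgroup.coe_pow, ← hy, pow_orderOf_eq_one, Subgroup.coe_one]
    have hy1 : (y : G) ≠ 1 := fun h => by
      rw [← Subgroup.orderOf_coe, h, orderOf_one] at hy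
      omega
    have hxy : x * y * x⁻¹ = y := by
      have h1 := (Subgroup.mem_normalizer_iff.mp hxN y).mp ⟨y, Subgroup.mem_zpowers y, rfl⟩
      obtain ⟨w, hw, hwx⟩ := h1
      classical
      obtain ⟨k, hk, rfl⟩ := Finset.mem_image.mp (mem_zpowers_iff_mem_range_orderOf.mp hw)
      rw [hy, Finset.mem_range] at hk
      replace hwx : x * y * x⁻¹ = (y : G) ^ k := by simpa using hwx.symm
      interval_cases k
      · rw [pow_zero, mul_inv_eq_one, mul_eq_left] at hwx
        exact absurd hwx hy1
      · rw [hwx, pow_one]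
      · have hpow (m : ℕ) : x ^ m * y * (x ^ m)⁻¹ = (y : G) ^ 2 ^ m := by
          induction m with
          | zero => simp
          | succ m ih =>
            calc x ^ (m + 1) * y * (x ^ (m + 1))⁻¹
                = x * (x ^ m * y * (x ^ m)⁻¹) * x⁻¹ := by rw [pow_succ']; group
              _ = (x * y * x⁻¹) ^ 2 ^ m := by rw [ih, conj_pow]
              _ = (y : G) ^ 2 ^ (m + 1) := by rw [hwx, ← pow_mul, pow_succ']
        have h5 := hpow 5
        rw [hx5, one_mul, inv_one, mul_one, show 2 ^ 5 = 3 * 10 + 1 + 1 from rfl, pow_succ, pow_succ,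
          pow_mul, hy3, one_pow, one_mul, left_eq_mul] at h5
        exact absurd h5 hy1
    rcases h15 x y (mul_inv_eq_iff_eq_mul.mp hxy) hx5 hy3 with h | h
    · rw [h, orderOf_one] at hx
      omega
    · exact hy1 h
  · exfalso
    have huniv : fixedPoints P (G ⧸ I) = Set.univ := by
      refine Set.eq_of_subset_of_ncard_le (Set.subset_univ _) ?_
      rw [Set.ncard_univ, hXcard, ← Nat.card_coe_set_eq, ← hf, hf5]
    have hyc : (y : G) ∈ I.normalCore := by
      intro g
      have h1 : ((g⁻¹ : G) : G ⧸ I) ∈ fixedPoints P (G ⧸ I) := by rw [huniv]; trivial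
      have h2 : ((y * g⁻¹ : G) : G ⧸ I) = (g⁻¹ : G) := h1 ⟨y, Subgroup.mem_zpowers y⟩
      simpa [mul_assoc] using QuotientGroup.eq.mp h2.symm
    rcases (inferInstance : I.normalCore.Normal).eq_bot_or_eq_top with h | h
    · rw [h, Subgroup.mem_bot] at hyc
      rw [← Subgroup.orderOf_coe, hyc, orderOf_one] at hy
      omega
    · have h1 : I = ⊤ := top_le_iff.mp (h ▸ I.normalCore_le)
      rw [h1, Subgroup.index_top] at hindex
      omega

end Cosets

end

section

open Matrix

variable {F : Type*} [Field F]

theorem card_specialLinearGroup_fin_two [Finite F] :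
    Nat.card (SpecialLinearGroup (Fin 2) F) = Nat.card F * (Nat.card F ^ 2 - 1) := by
  have := Fintype.ofFinite F
  have hq : 1 < Fintype.card F := Fintype.one_lt_card
  let d : GL (Fin 2) F →* Fˣ := GeneralLinearGroup.det
  have hd : Function.Surjective d := fun u => by
    refine ⟨GeneralLinearGroup.mkOfDetNeZero !![(u : F), 0; 0, 1] (by simp), ?_⟩
    ext
    simp [d, GeneralLinearGroup.mkOfDetNeZero]
  have hr : d.ker = (SpecialLinearGroup.toGL (n := Fin 2) (R := F)).range := by
    ext g
    rw [MonoidHom.mem_ker, MonoidHom.mem_range]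
    constructor
    · intro h
      exact ⟨⟨g.1, by simpa [d] using congrArg Units.val h⟩, by ext; rfl⟩
    · rintro ⟨x, rfl⟩
      ext
      exact x.2
  have h1 := d.ker.card_mul_index
  rw [Subgroup.index_ker, MonoidHom.range_eq_top.mpr hd, Subgroup.card_top, hr,
    ← Nat.card_congr (MonoidHom.ofInjective SpecialLinearGroup.toGL_injective).toEquiv,
    card_GL_field, Nat.card_units, Nat.card_eq_fintype_card (α := F)] at h1
  rw [Nat.card_eq_fintype_card (α := F)]
  generalize Fintype.card F = q at h1 hq ⊢
  have hp : ∏ i : Fin 2, (q ^ 2 - q ^ (i : ℕ)) = q * (q ^ 2 - 1) * (q - 1) := by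
    rw [Fin.prod_univ_two]
    simp only [Fin.val_zero, Fin.val_one, pow_zero, pow_one]
    rw [show q ^ 2 - q = q * (q - 1) by rw [Nat.mul_sub, mul_one, sq]]
    ring
  rw [hp] at h1
  exact Nat.eq_of_mul_eq_mul_right (by omega) h1

theorem card_center_specialLinearGroup_fin_two :
    Nat.card (Subgroup.center (SpecialLinearGroup (Fin 2) F)) =
      Nat.card (rootsOfUnity 2 F) :=
  Nat.card_congr (SpecialLinearGroup.center_equiv_rootsOfUnity' (0 : Fin 2)).toEquiv

theorem two_ne_zero_of_odd_card (h : Odd (Nat.card F)) : (2 : F) ≠ 0 := by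
  intro h2
  have := Nat.finite_of_card_ne_zero h.pos.ne'
  have := Fintype.ofFinite F
  obtain ⟨k, hk⟩ := h
  have h0 : ((Nat.card F : ℕ) : F) = 0 := by
    rw [Nat.card_eq_fintype_card]
    exact Nat.cast_card_eq_zero F
  rw [hk] at h0
  push_cast at h0
  rw [h2, zero_mul, zero_add] at h0
  exact one_ne_zero h0

theorem card_rootsOfUnity_two (h : (2 : F) ≠ 0) : Nat.card (rootsOfUnity 2 F) = 2 :=
  IsPrimitiveRoot.card_rootsOfUnity (ζ := (-1 : F)) <|
    IsPrimitiveRoot.mk_of_lt _ two_pos (by norm_num) fun l h0 h2 => by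
      obtain rfl : l = 1 := by omega
      rw [pow_one]
      intro hc
      apply h
      linear_combination -hc

theorem card_projectiveSpecialLinearGroup_fin_two [Finite F] :
    Nat.card (ProjectiveSpecialLinearGroup (Fin 2) F) * Nat.card (rootsOfUnity 2 F) =
      Nat.card F * (Nat.card F ^ 2 - 1) := by
  rw [← card_center_specialLinearGroup_fin_two, ← card_specialLinearGroup_fin_two]
  exact (Subgroup.card_eq_card_quotient_mul_card_subgroup _).symm

theorem mem_center_of_eq_smul_one {A : Matrix.SpecialLinearGroup (Fin 2) F} {r : F}
    (h : A.1 = r • 1) : A ∈ Subgroup.center (Matrix.SpecialLinearGroup (Fin 2) F) := by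
  rw [Matrix.SpecialLinearGroup.mem_center_iff]
  refine ⟨r, ?_, ?_⟩
  · have := A.2
    rw [h] at this
    simpa using this
  · rw [h, Matrix.smul_one_eq_diagonal]; rfl

section

variable {M : Matrix (Fin 2) (Fin 2) F}

theorem sq_eq_of_det_eq_one_s18 (hM : M.det = 1) : M ^ 2 = M.trace • M - 1 := by
  have h := M.aeval_self_charpoly
  rw [charpoly_fin_two, hM] at h
  simp only [map_add, map_sub, map_pow, map_mul, Polynomial.aeval_X, Polynomial.aeval_C, map_one,
    ← Algebra.smul_def] at h
  rw [← sub_eq_zero, ← h]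
  abel

theorem cube_eq_of_det_eq_one_s18 (hM : M.det = 1) :
    M ^ 3 = (M.trace ^ 2 - 1) • M - M.trace • 1 := by
  have h := sq_eq_of_det_eq_one_s18 hM
  rw [pow_succ M 2, h, sub_mul, smul_mul_assoc, ← sq, h, one_mul]
  module

theorem trace_pow_five_of_det_eq_one (hM : M.det = 1) :
    (M ^ 5).trace = M.trace ^ 5 - 5 * M.trace ^ 3 + 5 * M.trace := by
  have h := sq_eq_of_det_eq_one_s18 hM
  have h3 := cube_eq_of_det_eq_one_s18 hM
  rw [show M ^ 5 = M ^ 2 * M ^ 3 by rw [← pow_add], h, h3, sub_mul, mul_sub, smul_mul_smul_comm,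
    ← sq, h]
  simp
  ring

/-- If the cube of `M` is scalar, then `M` is scalar or has trace `±1`. -/
theorem eq_smul_one_or_trace_sq_eq_one (hM : M.det = 1) {r : F} (h : M ^ 3 = r • 1) :
    (∃ s : F, M = s • 1) ∨ M.trace ^ 2 = 1 := by
  by_cases ht : M.trace ^ 2 - 1 = 0
  · exact Or.inr (by linear_combination ht)
  · left
    rw [cube_eq_of_det_eq_one_s18 hM, sub_eq_iff_eq_add, ← add_smul] at h
    refine ⟨(M.trace ^ 2 - 1)⁻¹ * (r + M.trace), ?_⟩
    rw [mul_smul, ← h, smul_smul, inv_mul_cancel₀ ht, one_smul]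

end

theorem sq_eq_one_of_card_eleven (h : Nat.card F = 11) {t : F}
    (ht : (t ^ 5 - 5 * t ^ 3 + 5 * t) ^ 2 = 1) : t ^ 2 = 1 := by
  have := Nat.finite_of_card_ne_zero (by omega : Nat.card F ≠ 0)
  have := Fintype.ofFinite F
  rw [Nat.card_eq_fintype_card] at h
  let e := ZMod.ringEquivOfPrime F (by norm_num) h
  obtain ⟨s, rfl⟩ := e.surjective t
  have key : ∀ s : ZMod 11, (s ^ 5 - 5 * s ^ 3 + 5 * s) ^ 2 = 1 → s ^ 2 = 1 := by decide
  rw [← map_pow, key s, map_one]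
  apply e.injective
  simpa only [map_pow, map_add, map_sub, map_mul, map_ofNat, map_one] using ht

/-- `PSL(2, 11)` has no element of order `15`. -/
theorem eq_one_or_eq_one_of_commute (hF : Nat.card F = 11)
    (x y : ProjectiveSpecialLinearGroup (Fin 2) F) (hxy : Commute x y) (hx : x ^ 5 = 1)
    (hy : y ^ 3 = 1) : x = 1 ∨ y = 1 := by
  obtain ⟨A, hA⟩ := QuotientGroup.mk_surjective (x * y)
  have hz5 : (x * y) ^ 5 = y ^ 2 := by
    rw [hxy.mul_pow, hx, one_mul, show 5 = 3 + 2 from rfl, pow_add, hy, one_mul]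
  have hz3 : (x * y) ^ 3 = x ^ 3 := by rw [hxy.mul_pow, hy, mul_one]
  have hmem (k : ℕ) : (x * y) ^ k = 1 ↔ ∃ r : F, A.1 ^ k = r • 1 := by
    rw [← hA, ← QuotientGroup.mk_pow, QuotientGroup.eq_one_iff]
    constructor
    · intro h
      obtain ⟨r, -, hr⟩ := Matrix.SpecialLinearGroup.mem_center_iff.mp h
      refine ⟨r, ?_⟩
      rw [Matrix.smul_one_eq_diagonal]
      exact hr.symm
    · rintro ⟨r, hr⟩
      exact mem_center_of_eq_smul_one hr
  have hdet : (A.1 ^ 5).det = 1 := by rw [det_pow, A.2, one_pow]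
  obtain ⟨r, hr⟩ := (hmem 15).mp (by
    rw [show 15 = 5 * 3 from rfl, pow_mul, hz5, ← pow_mul, mul_comm, pow_mul, hy, one_pow])
  rcases eq_smul_one_or_trace_sq_eq_one hdet (r := r) (by rw [← pow_mul, hr]) with h | h
  · right
    have h2 := (hmem 5).mpr h
    rw [hz5] at h2
    rw [← hy, pow_succ, h2, one_mul]
  · left
    rw [trace_pow_five_of_det_eq_one A.2] at h
    have h2 := sq_eq_one_of_card_eleven hF h
    have h3 := (hmem 3).mpr ⟨-A.1.trace, by
      rw [cube_eq_of_det_eq_one_s18 A.2, h2, sub_self, zero_smul, zero_sub, neg_smul]⟩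
    rw [hz3] at h3
    calc x = (x ^ 3) ^ 2 * (x ^ 5)⁻¹ := by group
      _ = 1 := by rw [h3, hx]; simp

end

theorem stmt_18 (p n : ℕ) [Fact p.Prime] (hn : 0 < n)
    (I : Subgroup (Matrix.ProjectiveSpecialLinearGroup (Fin 2) (GaloisField p n)))
    (hproper : I ≠ ⊤)
    (hI : Nonempty (↥I ≃* ↥(alternatingGroup (Fin 5)))) :
    (∀ a b c d : Matrix.ProjectiveSpecialLinearGroup (Fin 2) (GaloisField p n) ⧸ I,
        a ≠ b → c ≠ d →
        ∃ g : Matrix.ProjectiveSpecialLinearGroup (Fin 2) (GaloisField p n),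
          g • a = c ∧ g • b = d) ↔
      (p ^ n = 9 ∨ p ^ n = 11) := by
  obtain ⟨e⟩ := hI
  have hI60 : Nat.card I = 60 := by
    rw [Nat.card_congr e.toEquiv, nat_card_alternatingGroup, Nat.card_eq_fintype_card,
      Fintype.card_fin]
    rfl
  have hA5 : IsSimpleGroup (alternatingGroup (Fin 5)) := alternatingGroup.isSimpleGroup (by simp)
  have hIs : IsSimpleGroup I := e.isSimpleGroup
  have hF : Nat.card (GaloisField p n) = p ^ n := GaloisField.card p n hn.ne'
  have hFin : Finite (GaloisField p n) := inferInstance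
  have hcard := card_projectiveSpecialLinearGroup_fin_two (F := GaloisField p n)
  rw [← I.card_mul_index, hI60, hF] at hcard
  have hodd : Odd (p ^ n) → Nat.card (rootsOfUnity 2 (GaloisField p n)) = 2 := fun ho =>
    card_rootsOfUnity_two (two_ne_zero_of_odd_card (hF ▸ ho))
  constructor
  · intro h
    have h1 := card_pred_dvd_of_doubly_transitive hproper h
    have h2 : I.index ≠ 1 := fun h => hproper (Subgroup.index_eq_one.mp h)
    have h3 := I.index_ne_zero_of_finite
    have h4 : Nat.card (rootsOfUnity 2 (GaloisField p n)) ≤ 2 := card_rootsOfUnity _ _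
    have h5 : 0 < Nat.card (rootsOfUnity 2 (GaloisField p n)) := Nat.card_pos
    rw [hI60] at h1
    generalize I.index = m at *
    generalize Nat.card (rootsOfUnity 2 (GaloisField p n)) = d at *
    generalize p ^ n = q at *
    have hm : m ≤ 61 := by
      have := Nat.le_of_dvd (by norm_num) h1
      omega
    have hm' : m ∈ ({2, 3, 4, 5, 6, 7, 11, 13, 16, 21, 31, 61} : Finset ℕ) := by
      have : ∀ m < 62, m ≠ 0 → m ≠ 1 → m - 1 ∣ 60 →
          m ∈ ({2, 3, 4, 5, 6, 7, 11, 13, 16, 21, 31, 61} : Finset ℕ) := by decide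
      exact this m (by omega) h3 h2 h1
    simp only [Finset.mem_insert, Finset.mem_singleton] at hm'
    have hq : q ≤ 19 := by
      by_contra! hq
      have h6 : 20 ^ 2 - 1 ≤ q ^ 2 - 1 := Nat.sub_le_sub_right (Nat.pow_le_pow_left hq 2) 1
      have h7 : 20 * (20 ^ 2 - 1) ≤ q * (q ^ 2 - 1) := Nat.mul_le_mul hq h6
      have h8 : 60 * m * d ≤ 60 * 61 * 2 := Nat.mul_le_mul (Nat.mul_le_mul_left _ hm) h4
      omega
    rcases Nat.even_or_odd q with he | ho
    · obtain ⟨r, rfl⟩ := he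
      have hr : r ≤ 9 := by omega
      interval_cases d <;> interval_cases r <;> omega
    · obtain rfl := hodd ho
      obtain ⟨r, rfl⟩ := ho
      have hr : r ≤ 9 := by omega
      interval_cases r <;> omega
  · intro hq
    have hsimple : IsSimpleGroup (Matrix.ProjectiveSpecialLinearGroup (Fin 2) (GaloisField p n)) :=
      Matrix.ProjectiveSpecialLinearGroup.rank_two_simple (by omega)
    refine doubly_transitive_of_stabilizer fun a b ha hb => ?_
    rcases hq with hq | hq
    · rw [hodd (by rw [hq]; decide), hq] at hcard
      exact mem_orbit_of_index_six hI60 (by omega) ha hb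
    · rw [hodd (by rw [hq]; decide), hq] at hcard
      exact mem_orbit_of_index_eleven hI60 (by omega)
        (eq_one_or_eq_one_of_commute (hF.trans hq)) ha hb
end

section
/- Let q be a prime power such that PSL(2, F_q) contains a subgroup I isomorphic to the alternating group A₅. Then there exists a nontrivial subgroup S of PSL(2, F_q) with S ∩ I = {1} and S·I = PSL(2, F_q) (i.e. a nontrivial complement to I) if and only if q = 11, q = 29 or q = 59. -/
open Matrix

section SpecialLinearTwo

variable {F : Type*} [Field F]

local notation "SL2" => Matrix.SpecialLinearGroup (Fin 2)

/-- The element of `SL(2, F)` with the given entries. -/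
def slMk (a b c d : F) (h : a * d - b * c = 1) : SL2 F :=
  ⟨!![a, b; c, d], by rw [det_fin_two_of, h]⟩

theorem slMk_eta (A : SL2 F) : ∃ a b c d h, A = slMk a b c d h :=
  ⟨A 0 0, A 0 1, A 1 0, A 1 1, by rw [← det_fin_two]; exact A.2,
    Subtype.ext (eta_fin_two A.1)⟩

theorem slMk_inj {a b c d h a' b' c' d' h'} :
    slMk (F := F) a b c d h = slMk a' b' c' d' h' ↔ a = a' ∧ b = b' ∧ c = c' ∧ d = d' := by
  constructor
  · intro e
    have e := congrArg Subtype.val e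
    exact ⟨congrFun₂ e 0 0, congrFun₂ e 0 1, congrFun₂ e 1 0, congrFun₂ e 1 1⟩
  · rintro ⟨rfl, rfl, rfl, rfl⟩; rfl

theorem slMk_mul {a b c d : F} {h} {a' b' c' d' : F} {h'} :
    slMk a b c d h * slMk a' b' c' d' h' =
      slMk (a * a' + b * c') (a * b' + b * d') (c * a' + d * c') (c * b' + d * d')
        (by linear_combination (a' * d' - b' * c') * h + h') :=
  Subtype.ext (mul_fin_two a b c d a' b' c' d')

theorem slMk_inv {a b c d : F} {h} :
    (slMk a b c d h)⁻¹ = slMk d (-b) (-c) a (by linear_combination h) := by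
  apply Subtype.ext
  rw [Matrix.SpecialLinearGroup.SL2_inv_expl]
  rfl

theorem slMk_one : (1 : SL2 F) = slMk 1 0 0 1 (by ring) :=
  Subtype.ext one_fin_two

theorem slMk_neg {a b c d : F} {h} :
    -slMk a b c d h = slMk (-a) (-b) (-c) (-d) (by linear_combination h) := by
  apply Subtype.ext
  change -!![a, b; c, d] = !![-a, -b; -c, -d]
  simp

/-- Conjugacy to a companion matrix. -/
theorem isConj_companion {a b c d : F} {h} (x y : F)
    (hxy : c * x ^ 2 + (d - a) * x * y - b * y ^ 2 = 1) :
    IsConj (slMk 0 (-1) 1 (a + d) (by ring)) (slMk a b c d h) := by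
  rw [isConj_iff]
  refine ⟨slMk x (a * x + b * y) y (c * x + d * y) (by linear_combination hxy), ?_⟩
  rw [mul_inv_eq_iff_eq_mul, slMk_mul, slMk_mul, slMk_inj]
  refine ⟨by ring, ?_, by ring, ?_⟩
  · linear_combination x * h
  · linear_combination y * h

theorem mem_center_iff_slMk {a b c d : F} {h} :
    slMk a b c d h ∈ Subgroup.center (SL2 F) ↔ a = d ∧ b = 0 ∧ c = 0 := by
  rw [Matrix.SpecialLinearGroup.mem_center_iff]
  constructor
  · rintro ⟨r, -, e⟩
    have h1 := congrFun₂ e 0 0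
    have h2 := congrFun₂ e 0 1
    have h3 := congrFun₂ e 1 0
    have h4 := congrFun₂ e 1 1
    simp [slMk] at h1 h2 h3 h4
    exact ⟨h1.symm.trans h4, h2.symm, h3.symm⟩
  · rintro ⟨rfl, rfl, rfl⟩
    refine ⟨a, by simpa [sq] using h, ?_⟩
    ext i j
    fin_cases i <;> fin_cases j <;> simp [slMk]

theorem mem_center_iff_eq_one_or_neg_one {A : SL2 F} :
    A ∈ Subgroup.center (SL2 F) ↔ A = 1 ∨ A = -1 := by
  obtain ⟨a, b, c, d, h, rfl⟩ := slMk_eta A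
  rw [mem_center_iff_slMk, slMk_one, slMk_neg, slMk_inj, slMk_inj]
  constructor
  · rintro ⟨rfl, rfl, rfl⟩
    have : (a - 1) * (a + 1) = 0 := by linear_combination h
    rcases mul_eq_zero.1 this with h | h
    · exact .inl (by simp [sub_eq_zero.1 h])
    · exact .inr (by simp [eq_neg_of_add_eq_zero_left h])
  · rintro (⟨rfl, rfl, rfl, rfl⟩ | ⟨rfl, rfl, rfl, rfl⟩) <;> simp

theorem card_center_of_two_ne_zero (h2 : (2 : F) ≠ 0) :
    Nat.card (Subgroup.center (SL2 F)) = 2 := by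
  have : (Subgroup.center (SL2 F) : Set (SL2 F)) = {1, -1} := by
    ext A; simp [mem_center_iff_eq_one_or_neg_one]
  rw [← SetLike.coe_sort_coe, this, Nat.card_coe_set_eq, Set.ncard_pair]
  rw [slMk_one, slMk_neg, Ne, slMk_inj]
  rintro ⟨e, -⟩
  exact h2 (by linear_combination e)

/-- The upper triangular matrices in `SL(2, F)` with diagonal entries in `H`. -/
def upperTri (H : Subgroup Fˣ) : Subgroup (SL2 F) where
  carrier := {A | A 1 0 = 0 ∧ ∃ u ∈ H, (u : F) = A 0 0}
  one_mem' := ⟨by simp, 1, H.one_mem, by simp⟩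
  mul_mem' := by
    rintro A B ⟨hA, u, hu, hu'⟩ ⟨hB, v, hv, hv'⟩
    refine ⟨?_, u * v, H.mul_mem hu hv, ?_⟩ <;>
    simp [mul_apply, Fin.sum_univ_two, hA, hB, hu', hv']
  inv_mem' := by
    rintro A ⟨hA, u, hu, hu'⟩
    obtain ⟨a, b, c, d, h, rfl⟩ := slMk_eta A
    rw [slMk_inv]
    simp only [slMk, of_apply, cons_val', cons_val_zero, cons_val_one, cons_val_fin_one] at hA hu'
    subst hA hu'
    refine ⟨by simp [slMk], u⁻¹, H.inv_mem hu, ?_⟩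
    simp only [slMk, of_apply, cons_val', cons_val_zero, cons_val_fin_one]
    exact Units.inv_eq_of_mul_eq_one_right (by linear_combination h)

theorem slMk_mem_upperTri {H : Subgroup Fˣ} {a b c d : F} {h} :
    slMk a b c d h ∈ upperTri H ↔ c = 0 ∧ ∃ u ∈ H, (u : F) = a := Iff.rfl

theorem card_upperTri (H : Subgroup Fˣ) : Nat.card (upperTri H) = Nat.card H * Nat.card F := by
  rw [← Nat.card_prod]
  symm
  refine Nat.card_eq_of_bijective
    (fun x : H × F => (⟨slMk (x.1 : Fˣ) x.2 0 ((x.1⁻¹ : Fˣ) : F) (by simp),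
      rfl, x.1, x.1.2, rfl⟩ : upperTri H)) ⟨?_, ?_⟩
  · rintro ⟨u, x⟩ ⟨v, y⟩ e
    have e := congrArg Subtype.val e
    rw [slMk_inj] at e
    exact Prod.ext (Subtype.ext (Units.ext e.1)) e.2.1
  · rintro ⟨A, hA⟩
    obtain ⟨a, b, c, d, h, rfl⟩ := slMk_eta A
    obtain ⟨rfl, u, hu, rfl⟩ := slMk_mem_upperTri.1 hA
    refine ⟨(⟨u, hu⟩, b), Subtype.ext ?_⟩
    change slMk (u : F) b 0 ((u⁻¹ : Fˣ) : F) (by simp) = slMk (u : F) b 0 d h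
    rw [slMk_inj]
    refine ⟨rfl, rfl, rfl, ?_⟩
    exact Units.inv_eq_of_mul_eq_one_right (by linear_combination h)

theorem card_SL2 [Finite F] :
    Nat.card (SL2 F) = Nat.card F * (Nat.card F - 1) * (Nat.card F + 1) := by
  have e1 : Nat.card {A : SL2 F // A 1 0 = 0} = (Nat.card F - 1) * Nat.card F := by
    have := card_upperTri (⊤ : Subgroup Fˣ)
    rw [Subgroup.card_top, Nat.card_units] at this
    rw [← this]
    refine Nat.card_congr (Equiv.subtypeEquivRight fun A => ?_)
    obtain ⟨a, b, c, d, h, rfl⟩ := slMk_eta A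
    rw [slMk_mem_upperTri]
    change c = 0 ↔ _
    refine ⟨fun hc => ⟨hc, ?_⟩, And.left⟩
    refine ⟨Units.mk0 a ?_, trivial, rfl⟩
    rintro rfl
    simp [hc] at h
  have e2 : Nat.card {A : SL2 F // ¬ A 1 0 = 0} = (Nat.card F - 1) * (Nat.card F * Nat.card F) := by
    rw [← Nat.card_units, ← Nat.card_prod, ← Nat.card_prod]
    symm
    refine Nat.card_eq_of_bijective (fun x : Fˣ × F × F =>
      (⟨slMk x.2.1 ((x.2.1 * x.2.2 - 1) / x.1) x.1 x.2.2 (by field_simp; ring),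
        x.1.ne_zero⟩ : {A : SL2 F // ¬ A 1 0 = 0})) ⟨?_, ?_⟩
    · rintro ⟨u, x, y⟩ ⟨v, x', y'⟩ e
      have e := congrArg Subtype.val e
      rw [slMk_inj] at e
      exact Prod.ext (Units.ext e.2.2.1) (Prod.ext e.1 e.2.2.2)
    · rintro ⟨A, hA⟩
      obtain ⟨a, b, c, d, h, rfl⟩ := slMk_eta A
      change ¬ c = 0 at hA
      refine ⟨(Units.mk0 c hA, a, d), Subtype.ext ?_⟩
      change slMk a ((a * d - 1) / c) c d (by field_simp; ring) = slMk a b c d h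
      rw [slMk_inj]
      refine ⟨rfl, ?_, rfl, rfl⟩
      rw [div_eq_iff hA]
      linear_combination h
  classical
  rw [← Nat.card_congr (Equiv.sumCompl fun A : SL2 F => A 1 0 = 0), Nat.card_sum, e1, e2]
  ring

/-- Transvections together with a matrix that is not upper triangular generate `SL(2, F)`. -/
theorem eq_top_or_le_upperTri {R : Subgroup (SL2 F)} (hR : upperTri ⊥ ≤ R) :
    R = ⊤ ∨ R ≤ upperTri ⊤ := by
  have hu (x : F) : slMk 1 x 0 1 (by ring) ∈ R := hR ⟨rfl, 1, rfl, rfl⟩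
  by_cases hle : R ≤ upperTri ⊤
  · exact .inr hle
  left
  obtain ⟨A, hA, hA'⟩ := SetLike.not_le_iff_exists.1 hle
  obtain ⟨a, b, c, d, h, rfl⟩ := slMk_eta A
  have hc : c ≠ 0 := by
    rintro rfl
    refine hA' ⟨rfl, Units.mk0 a ?_, trivial, rfl⟩
    rintro rfl
    simp at h
  have hw : slMk 0 (-1 / c) c 0 (by field_simp; ring) ∈ R := by
    convert R.mul_mem (R.mul_mem (hu (-a / c)) hA) (hu (-d / c)) using 1
    rw [slMk_mul, slMk_mul, slMk_inj]
    refine ⟨?_, ?_, ?_, ?_⟩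
    · field_simp; ring
    · field_simp; linear_combination h
    · ring
    · field_simp; ring
  have hl (y : F) : slMk 1 0 y 1 (by ring) ∈ R := by
    convert R.mul_mem (R.mul_mem hw (hu (-y / c ^ 2))) (R.inv_mem hw) using 1
    rw [slMk_inv, slMk_mul, slMk_mul, slMk_inj]
    refine ⟨?_, ?_, ?_, ?_⟩ <;> field_simp <;> ring
  have hbig {a b c d : F} {h} (hc : c ≠ 0) : slMk a b c d h ∈ R := by
    convert R.mul_mem (R.mul_mem (hu ((a - 1) / c)) (hl c)) (hu ((d - 1) / c)) using 1
    rw [slMk_mul, slMk_mul, slMk_inj]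
    refine ⟨?_, ?_, ?_, ?_⟩
    · field_simp; ring
    · field_simp; linear_combination -h
    · ring
    · field_simp; ring
  rw [eq_top_iff]
  rintro A -
  obtain ⟨a, b, c, d, h, rfl⟩ := slMk_eta A
  by_cases hc : c = 0
  · rw [← R.mul_mem_cancel_left (hl 1), slMk_mul]
    apply hbig
    rintro e
    simp [hc] at e
    simp [e, hc] at h
  · exact hbig hc

theorem mem_center_of_eq_smul_add {A B : SL2 F} {x y : F} (hB : B ∈ Subgroup.center (SL2 F))
    (hx : x ≠ 0) (e : (B : Matrix (Fin 2) (Fin 2) F) = x • (A : Matrix (Fin 2) (Fin 2) F) + y • 1) :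
    A ∈ Subgroup.center (SL2 F) := by
  obtain ⟨a, b, c, d, h, rfl⟩ := slMk_eta A
  obtain ⟨a', b', c', d', h', rfl⟩ := slMk_eta B
  rw [mem_center_iff_slMk] at hB ⊢
  obtain ⟨rfl, rfl, rfl⟩ := hB
  have h1 := congrFun₂ e 0 0
  have h2 := congrFun₂ e 0 1
  have h3 := congrFun₂ e 1 0
  have h4 := congrFun₂ e 1 1
  simp [slMk, hx] at h1 h2 h3 h4
  refine ⟨mul_left_cancel₀ hx ?_, h2, h3⟩
  linear_combination h4 - h1

theorem coe_sq_eq (A : SL2 F) : (A : Matrix (Fin 2) (Fin 2) F) ^ 2 =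
    (A 0 0 + A 1 1) • (A : Matrix (Fin 2) (Fin 2) F) - 1 := by
  obtain ⟨a, b, c, d, h, rfl⟩ := slMk_eta A
  ext i j
  fin_cases i <;> fin_cases j <;> simp [slMk, sq, mul_apply, Fin.sum_univ_two]
  · linear_combination -h
  · ring
  · ring
  · linear_combination -h

theorem coe_pow_succ_eq {A : SL2 F} {n : ℕ} {x y : F}
    (e : (A : Matrix (Fin 2) (Fin 2) F) ^ n = x • (A : Matrix (Fin 2) (Fin 2) F) + y • 1) :
    (A : Matrix (Fin 2) (Fin 2) F) ^ (n + 1) =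
      (x * (A 0 0 + A 1 1) + y) • (A : Matrix (Fin 2) (Fin 2) F) + (-x) • 1 := by
  rw [pow_succ, e, add_mul, smul_mul_assoc, ← sq, coe_sq_eq, smul_mul_assoc, one_mul]
  module

theorem trace_of_sq_mem_center {A : SL2 F} (hA : A ∉ Subgroup.center (SL2 F))
    (h : A ^ 2 ∈ Subgroup.center (SL2 F)) : A 0 0 + A 1 1 = 0 := by
  by_contra ht
  refine hA (mem_center_of_eq_smul_add h ht (y := -1) ?_)
  rw [Matrix.SpecialLinearGroup.coe_pow, coe_sq_eq]
  module

theorem trace_of_pow_three_mem_center {A : SL2 F} (hA : A ∉ Subgroup.center (SL2 F))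
    (h : A ^ 3 ∈ Subgroup.center (SL2 F)) : (A 0 0 + A 1 1) ^ 2 = 1 := by
  by_contra ht
  refine hA (mem_center_of_eq_smul_add h (sub_ne_zero.2 ht) (y := -(A 0 0 + A 1 1)) ?_)
  rw [Matrix.SpecialLinearGroup.coe_pow, coe_pow_succ_eq (x := A 0 0 + A 1 1) (y := -1)]
  · module
  · rw [coe_sq_eq]; module

theorem trace_of_pow_five_mem_center_s19 (h5 : (5 : F) = 0) {A : SL2 F}
    (hA : A ∉ Subgroup.center (SL2 F)) (h : A ^ 5 ∈ Subgroup.center (SL2 F)) :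
    (A 0 0 + A 1 1) ^ 2 = 4 := by
  set t := A 0 0 + A 1 1 with htd
  by_contra ht
  have hx : (t ^ 2 - 4) ^ 2 ≠ 0 := pow_ne_zero _ (sub_ne_zero.2 ht)
  have h2 : (A : Matrix (Fin 2) (Fin 2) F) ^ 2 =
      t • (A : Matrix (Fin 2) (Fin 2) F) + (-1 : F) • 1 := by
    rw [coe_sq_eq]; module
  have e := coe_pow_succ_eq (coe_pow_succ_eq (coe_pow_succ_eq h2))
  rw [← htd, show ((t * t + -1) * t + -t) * t + -(t * t + -1) = (t ^ 2 - 4) ^ 2 by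
    linear_combination (t ^ 2 - 3) * h5] at e
  exact hA (mem_center_of_eq_smul_add h hx ((Matrix.SpecialLinearGroup.coe_pow A 5).trans e))

/-- A binary quadratic form attached to a matrix represents one if its discriminant is nonzero. -/
theorem exists_represents_one [Finite F] (h2 : (2 : F) ≠ 0) {a b c d : F} (h : a * d - b * c = 1)
    (ht : (a + d) ^ 2 ≠ 4) : ∃ x y, c * x ^ 2 + (d - a) * x * y - b * y ^ 2 = 1 := by
  have := Fintype.ofFinite F
  by_cases hc : c = 0
  · subst hc
    have hda : d - a ≠ 0 := by
      intro hda
      apply ht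
      linear_combination (d - a) * hda + 4 * h
    exact ⟨(1 + b) / (d - a), 1, by field_simp; ring⟩
  · have hD : (a + d) ^ 2 - 4 ≠ 0 := sub_ne_zero.2 ht
    have h4 : (4 : F) ≠ 0 := by
      rw [show (4 : F) = 2 * 2 by norm_num]; exact mul_ne_zero h2 h2
    obtain ⟨x, y, hxy⟩ := FiniteField.exists_root_sum_quadratic (R := F)
      (f := Polynomial.C (4 * c ^ 2) * Polynomial.X ^ 2 + Polynomial.C 0 * Polynomial.X
        + Polynomial.C (-4 * c))
      (g := Polynomial.C (-((a + d) ^ 2 - 4)) * Polynomial.X ^ 2 + Polynomial.C 0 * Polynomial.X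
        + Polynomial.C 0)
      (Polynomial.degree_quadratic (mul_ne_zero h4 (pow_ne_zero _ hc)))
      (Polynomial.degree_quadratic (neg_ne_zero.2 hD)) (by
        refine FiniteField.odd_card_of_char_ne_two fun h => h2 ?_
        exact_mod_cast (ringChar.spec F 2).2 h.dvd)
    simp at hxy
    refine ⟨x - (d - a) / (2 * c) * y, y, ?_⟩
    field_simp
    linear_combination hxy + 4 * y ^ 2 * h

theorem exists_represents_one_of_char_two [Finite F] [CharP F 2] {a b c d : F}
    (hA : ¬ (a = d ∧ b = 0 ∧ c = 0)) (ht : a + d = 0) :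
    ∃ x y, c * x ^ 2 + (d - a) * x * y - b * y ^ 2 = 1 := by
  have hs (z : F) : ∃ x, x ^ 2 = z := by
    obtain ⟨x, hx⟩ := FiniteField.isSquare_of_char_two (ringChar.eq_iff.2 ‹_›) z
    exact ⟨x, by rw [hx, sq]⟩
  have hda : a = d := by rw [← sub_eq_zero, CharTwo.sub_eq_add, ht]
  by_cases hc : c = 0
  · have hb : b ≠ 0 := fun hb => hA ⟨hda, hb, hc⟩
    obtain ⟨y, hy⟩ := hs (-1 / b)
    exact ⟨0, y, by rw [hy]; field_simp; ring⟩
  · obtain ⟨x, hx⟩ := hs (1 / c)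
    exact ⟨x, 0, by rw [hx]; field_simp; ring⟩

local notation "PSLTwo" => Matrix.ProjectiveSpecialLinearGroup (Fin 2)

theorem exists_lift_of_orderOf_prime {r : ℕ} [hr : Fact r.Prime] {g : PSLTwo F}
    (hg : orderOf g = r) :
    ∃ A : SL2 F, (A : PSLTwo F) = g ∧ A ∉ Subgroup.center (SL2 F) ∧
      A ^ r ∈ Subgroup.center (SL2 F) := by
  obtain ⟨A, rfl⟩ := QuotientGroup.mk_surjective g
  refine ⟨A, rfl, fun h => ?_, ?_⟩
  · rw [(QuotientGroup.eq_one_iff A).2 h, orderOf_one] at hg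
    exact hr.out.one_lt.ne hg
  · rw [← QuotientGroup.eq_one_iff, QuotientGroup.mk_pow, ← hg, pow_orderOf_eq_one]

theorem isConj_coe {A B : SL2 F} (h : IsConj A B) : IsConj (A : PSLTwo F) (B : PSLTwo F) :=
  (QuotientGroup.mk' (Subgroup.center (SL2 F))).map_isConj h

theorem coe_neg_eq_coe (A : SL2 F) : ((-A : SL2 F) : PSLTwo F) = A := by
  rw [QuotientGroup.eq, mem_center_iff_eq_one_or_neg_one]
  right
  obtain ⟨a, b, c, d, h, rfl⟩ := slMk_eta A
  rw [slMk_neg, slMk_inv, slMk_mul, slMk_one, slMk_neg, slMk_inj]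
  refine ⟨?_, ?_, ?_, ?_⟩
  · linear_combination -h
  · ring
  · ring
  · linear_combination -h

theorem isConj_of_orderOf_two [Finite F] {g : PSLTwo F} (hg : orderOf g = 2) :
    IsConj ((slMk 0 (-1) 1 0 (by ring) : SL2 F) : PSLTwo F) g := by
  obtain ⟨A, rfl, hA, hA2⟩ := exists_lift_of_orderOf_prime hg
  have ht := trace_of_sq_mem_center hA hA2
  obtain ⟨a, b, c, d, h, rfl⟩ := slMk_eta A
  rw [mem_center_iff_slMk] at hA
  change a + d = 0 at ht
  have : ∃ x y, c * x ^ 2 + (d - a) * x * y - b * y ^ 2 = 1 := by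
    by_cases h2 : (2 : F) = 0
    · have := CharTwo.of_one_ne_zero_of_two_eq_zero (one_ne_zero (α := F)) h2
      exact exists_represents_one_of_char_two hA ht
    · refine exists_represents_one h2 h ?_
      rw [ht, show (4 : F) = 2 * 2 by norm_num]
      simp [h2]
  obtain ⟨x, y, hxy⟩ := this
  have := isConj_companion (h := h) x y hxy
  simp only [ht] at this
  exact isConj_coe this

theorem isConj_of_orderOf_three [Finite F] (h2 : (2 : F) ≠ 0) (h3 : (3 : F) ≠ 0) {g : PSLTwo F}
    (hg : orderOf g = 3) : IsConj ((slMk 0 (-1) 1 1 (by ring) : SL2 F) : PSLTwo F) g := by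
  obtain ⟨A, rfl, hA, hA3⟩ := exists_lift_of_orderOf_prime hg
  have ht := trace_of_pow_three_mem_center hA hA3
  obtain ⟨a, b, c, d, h, rfl⟩ := slMk_eta A
  change (a + d) ^ 2 = 1 at ht
  have key {a b c d : F} (h : a * d - b * c = 1) (ht : a + d = 1) :
      IsConj ((slMk 0 (-1) 1 1 (by ring) : SL2 F) : PSLTwo F) (slMk a b c d h : SL2 F) := by
    obtain ⟨x, y, hxy⟩ := exists_represents_one h2 h (by
      rw [ht]
      intro e
      exact h3 (by linear_combination -e))
    have := isConj_companion (h := h) x y hxy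
    simp only [ht] at this
    exact isConj_coe this
  rcases sq_eq_sq_iff_eq_or_eq_neg.1 (ht.trans (one_pow 2).symm) with ht | ht
  · exact key h ht
  · rw [← coe_neg_eq_coe (slMk a b c d h), slMk_neg]
    exact key _ (by linear_combination -ht)

theorem exists_mul_sq_eq_one_or [Finite F] (h2 : ¬ IsSquare (2 : F)) {z : F} (hz : z ≠ 0) :
    ∃ x, z * x ^ 2 = 1 ∨ 2 * z * x ^ 2 = 1 := by
  classical
  have := Fintype.ofFinite F
  have h20 : (2 : F) ≠ 0 := by rintro e; exact h2 (e ▸ IsSquare.zero)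
  by_cases hs : IsSquare z
  · obtain ⟨w, rfl⟩ := hs
    have hw : w ≠ 0 := left_ne_zero_of_mul hz
    exact ⟨w⁻¹, .inl (by field_simp)⟩
  · have : IsSquare (2 * z) := by
      rw [← quadraticChar_one_iff_isSquare (mul_ne_zero h20 hz), map_mul,
        quadraticChar_neg_one_iff_not_isSquare.2 h2, quadraticChar_neg_one_iff_not_isSquare.2 hs]
      norm_num
    obtain ⟨w, hw⟩ := this
    have hw0 : w ≠ 0 := by rintro rfl; exact mul_ne_zero h20 hz (by simpa using hw)
    exact ⟨w⁻¹, .inr (by rw [hw]; field_simp)⟩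

theorem isConj_of_trace_eq_two [Finite F] (h2 : ¬ IsSquare (2 : F)) {a b c d : F} {h}
    (hA : ¬ (a = d ∧ b = 0 ∧ c = 0)) (ht : a + d = 2) :
    IsConj ((slMk 0 (-1) 1 2 (by ring) : SL2 F) : PSLTwo F) (slMk a b c d h : SL2 F) ∨
      IsConj ((slMk 0 (-1) 1 2 (by ring) : SL2 F) : PSLTwo F)
        ((slMk a b c d h : SL2 F) ^ 2 : PSLTwo F) := by
  have key {a b c d : F} {h} (ht : a + d = 2) (x y : F)
      (hxy : c * x ^ 2 + (d - a) * x * y - b * y ^ 2 = 1) :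
      IsConj ((slMk 0 (-1) 1 2 (by ring) : SL2 F) : PSLTwo F) (slMk a b c d h : SL2 F) := by
    have := isConj_companion (h := h) x y hxy
    simp only [ht] at this
    exact isConj_coe this
  rw [← QuotientGroup.mk_pow, sq, slMk_mul]
  have ht' : a * a + b * c + (c * b + d * d) = 2 := by linear_combination (a + d + 2) * ht - 2 * h
  by_cases hc : c = 0
  · have hda : (a - 1) ^ 2 = 0 := by linear_combination a * ht - h - b * hc
    have ha : a = 1 := sub_eq_zero.1 (pow_eq_zero_iff two_ne_zero |>.1 hda)
    have hd : d = 1 := by linear_combination ht - ha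
    have hb : b ≠ 0 := fun hb => hA ⟨ha.trans hd.symm, hb, hc⟩
    obtain ⟨y, hy | hy⟩ := exists_mul_sq_eq_one_or h2 (neg_ne_zero.2 hb)
    · exact .inl (key ht 0 y (by linear_combination hy))
    · exact .inr (key ht' 0 y (by linear_combination hy - b * y ^ 2 * ht))
  · obtain ⟨x, hx | hx⟩ := exists_mul_sq_eq_one_or h2 hc
    · exact .inl (key ht x 0 (by linear_combination hx))
    · exact .inr (key ht' x 0 (by linear_combination hx + c * x ^ 2 * ht))

theorem isConj_of_orderOf_five [Finite F] (h5 : (5 : F) = 0) (h2 : ¬ IsSquare (2 : F))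
    {g : PSLTwo F} (hg : orderOf g = 5) :
    IsConj ((slMk 0 (-1) 1 2 (by ring) : SL2 F) : PSLTwo F) g ∨
      IsConj ((slMk 0 (-1) 1 2 (by ring) : SL2 F) : PSLTwo F) (g ^ 2) := by
  have := Fact.mk Nat.prime_five
  obtain ⟨A, rfl, hA, hA5⟩ := exists_lift_of_orderOf_prime hg
  have ht := trace_of_pow_five_mem_center_s19 h5 hA hA5
  obtain ⟨a, b, c, d, h, rfl⟩ := slMk_eta A
  rw [mem_center_iff_slMk] at hA
  change (a + d) ^ 2 = 4 at ht
  rcases sq_eq_sq_iff_eq_or_eq_neg.1 (ht.trans (show (4 : F) = 2 ^ 2 by norm_num)) with ht | ht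
  · exact isConj_of_trace_eq_two h2 hA ht
  · rw [← coe_neg_eq_coe (slMk a b c d h), slMk_neg]
    exact isConj_of_trace_eq_two h2 (by simpa [neg_inj] using hA) (by linear_combination -ht)

theorem eq_one_of_isComplement'_of_isConj {G : Type*} [Group G] {S I : Subgroup G}
    (h : S.IsComplement' I) {s i : G} (hs : s ∈ S) (hi : i ∈ I) (hc : IsConj s i) : s = 1 := by
  obtain ⟨c, hc⟩ := isConj_iff.1 hc
  obtain ⟨⟨x, y⟩, hxy⟩ := h.symm.surjective c
  have hxy : (x : G) * y = c := hxy
  have e : (y : G) * s * (y : G)⁻¹ = (x : G)⁻¹ * i * x := by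
    rw [← hc, ← hxy]; group
  have h1 : (y : G) * s * (y : G)⁻¹ = 1 := by
    refine Subgroup.disjoint_def.1 h.disjoint (S.mul_mem (S.mul_mem y.2 hs) (S.inv_mem y.2)) ?_
    rw [e]
    exact I.mul_mem (I.mul_mem (I.inv_mem x.2) hi) x.2
  simpa [mul_inv_eq_one] using h1

theorem exists_mem_orderOf_eq_of_dvd_card {G : Type*} [Group G] [Finite G] {H : Subgroup G} {r : ℕ}
    [Fact r.Prime] (h : r ∣ Nat.card H) : ∃ x ∈ H, orderOf x = r := by
  obtain ⟨x, hx⟩ := exists_prime_orderOf_dvd_card' r h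
  exact ⟨x, x.2, by rw [Subgroup.orderOf_coe, hx]⟩

theorem odd_card_of_isComplement' [Finite F] {S I : Subgroup (PSLTwo F)} (h : S.IsComplement' I)
    (hI : 2 ∣ Nat.card I) : ¬ 2 ∣ Nat.card S := by
  intro hS
  obtain ⟨s, hs, hs2⟩ := exists_mem_orderOf_eq_of_dvd_card hS
  obtain ⟨i, hi, hi2⟩ := exists_mem_orderOf_eq_of_dvd_card hI
  have := eq_one_of_isComplement'_of_isConj h hs hi
    ((isConj_of_orderOf_two hs2).symm.trans (isConj_of_orderOf_two hi2))
  simp [this] at hs2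

theorem not_three_dvd_card_of_isComplement' [Finite F] (h2 : (2 : F) ≠ 0) (h3 : (3 : F) ≠ 0)
    {S I : Subgroup (PSLTwo F)} (h : S.IsComplement' I) (hI : 3 ∣ Nat.card I) :
    ¬ 3 ∣ Nat.card S := by
  intro hS
  obtain ⟨s, hs, hs2⟩ := exists_mem_orderOf_eq_of_dvd_card hS
  obtain ⟨i, hi, hi2⟩ := exists_mem_orderOf_eq_of_dvd_card hI
  have := eq_one_of_isComplement'_of_isConj h hs hi
    ((isConj_of_orderOf_three h2 h3 hs2).symm.trans (isConj_of_orderOf_three h2 h3 hi2))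
  simp [this] at hs2

theorem not_five_dvd_card_of_isComplement' [Finite F] (h5 : (5 : F) = 0) (h2 : ¬ IsSquare (2 : F))
    {S I : Subgroup (PSLTwo F)} (h : S.IsComplement' I) (hI : 5 ∣ Nat.card I) :
    ¬ 5 ∣ Nat.card S := by
  intro hS
  have := Fact.mk Nat.prime_five
  obtain ⟨s, hs, hs5⟩ := exists_mem_orderOf_eq_of_dvd_card hS
  obtain ⟨i, hi, hi5⟩ := exists_mem_orderOf_eq_of_dvd_card hI
  have key {s i : PSLTwo F} (hs : s ∈ S) (hi : i ∈ I) (hs1 : s ≠ 1)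
    (h1 : IsConj ((slMk 0 (-1) 1 2 (by ring) : SL2 F) : PSLTwo F) s)
    (h2 : IsConj ((slMk 0 (-1) 1 2 (by ring) : SL2 F) : PSLTwo F) i) : False :=
    hs1 (eq_one_of_isComplement'_of_isConj h hs hi (h1.symm.trans h2))
  have hs1 : s ≠ 1 := by rintro rfl; simp at hs5
  have hs2 : s ^ 2 ≠ 1 := by
    intro e
    have := orderOf_dvd_of_pow_eq_one e
    rw [hs5] at this
    norm_num at this
  rcases isConj_of_orderOf_five h5 h2 hs5 with h1 | h1 <;>
  rcases isConj_of_orderOf_five h5 h2 hi5 with h2 | h2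
  · exact key hs hi hs1 h1 h2
  · exact key hs (I.pow_mem hi 2) hs1 h1 h2
  · exact key (S.pow_mem hs 2) hi hs2 h1 h2
  · exact key (S.pow_mem hs 2) (I.pow_mem hi 2) hs2 h1 h2

theorem card_comap_mul_card [Finite F] {S I : Subgroup (PSLTwo F)} (h : S.IsComplement' I) :
    Nat.card (S.comap (QuotientGroup.mk' (Subgroup.center (SL2 F)))) * Nat.card I =
      Nat.card F * (Nat.card F - 1) * (Nat.card F + 1) := by
  rw [← card_SL2, ← h.symm.index_eq_card,
    ← S.index_comap_of_surjective (QuotientGroup.mk'_surjective (Subgroup.center (SL2 F))),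
    Subgroup.card_mul_index]

theorem card_PSL2_mul_card_center [Finite F] :
    Nat.card (PSLTwo F) * Nat.card (Subgroup.center (SL2 F)) =
      Nat.card F * (Nat.card F - 1) * (Nat.card F + 1) := by
  rw [← card_SL2]
  exact (Subgroup.card_eq_card_quotient_mul_card_subgroup _).symm

theorem card_PSL2_mul_two [Finite F] (h2 : (2 : F) ≠ 0) :
    Nat.card (PSLTwo F) * 2 = Nat.card F * (Nat.card F - 1) * (Nat.card F + 1) := by
  rw [← card_PSL2_mul_card_center, card_center_of_two_ne_zero h2]

theorem card_PSL2_of_two_eq_zero [Finite F] (h2 : (2 : F) = 0) :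
    Nat.card (PSLTwo F) = Nat.card F * (Nat.card F - 1) * (Nat.card F + 1) := by
  have : Subgroup.center (SL2 F) = ⊥ := by
    rw [eq_bot_iff]
    intro A hA
    rw [Subgroup.mem_bot]
    rcases mem_center_iff_eq_one_or_neg_one.1 hA with h | rfl
    · exact h
    · rw [slMk_one, slMk_neg, slMk_inj]
      have : (-1 : F) = 1 := by linear_combination -h2
      simp [this]
  have hc : Nat.card (Subgroup.center (SL2 F)) = 1 := by rw [this, Subgroup.card_bot]
  rw [← card_PSL2_mul_card_center, hc, mul_one]

/-- A proper subgroup of `SL(2, F)` containing a Sylow `p`-subgroup, where `p` is the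
characteristic of `F`, has order dividing that of a Borel subgroup. -/
theorem card_dvd_of_card_dvd [Finite F] {p n : ℕ} [Fact p.Prime] (hF : Nat.card F = p ^ n)
    {R : Subgroup (SL2 F)} (hR : R ≠ ⊤) (hd : Nat.card F ∣ Nat.card R) :
    Nat.card R ∣ (Nat.card F - 1) * Nat.card F := by
  have hfac : (Nat.card (SL2 F)).factorization p = n := by
    have hp : p.Prime := Fact.out
    have hF1 : 1 < Nat.card F := Finite.one_lt_card
    have hpF : p ∣ Nat.card F := by
      rw [hF]
      refine dvd_pow_self p ?_
      rintro rfl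
      rw [hF, pow_zero] at hF1
      exact hF1.false
    have hp1 : ¬ p ∣ Nat.card F - 1 := fun h =>
      hp.one_lt.ne' (Nat.dvd_one.1 ((Nat.dvd_sub_iff_right hF1.le hpF).1 h))
    have hp2 : ¬ p ∣ Nat.card F + 1 := fun h =>
      hp.one_lt.ne' (Nat.dvd_one.1 ((Nat.dvd_add_right hpF).1 h))
    rw [card_SL2, Nat.factorization_mul (Nat.mul_pos (by omega) (by omega)).ne' (by omega),
      Nat.factorization_mul (by omega) (by omega), Finsupp.add_apply, Finsupp.add_apply,
      Nat.factorization_eq_zero_of_not_dvd hp1, Nat.factorization_eq_zero_of_not_dvd hp2, hF,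
      hp.factorization_pow, Finsupp.single_eq_same, add_zero, add_zero]
  obtain ⟨K, hK⟩ := Sylow.exists_subgroup_card_pow_prime p (hF ▸ hd)
  let P : Sylow p (SL2 F) := Sylow.ofCard (K.map R.subtype) (by
    rw [Subgroup.card_map_of_injective R.subtype_injective, hK, hfac])
  let U : Sylow p (SL2 F) := Sylow.ofCard (upperTri ⊥) (by
    rw [card_upperTri, Subgroup.card_bot, one_mul, hF, hfac])
  obtain ⟨g, hg⟩ := MulAction.exists_smul_eq (SL2 F) P U
  have hg : (K.map R.subtype).map (MulAut.conj g).toMonoidHom = upperTri ⊥ :=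
    congrArg Sylow.toSubgroup hg
  have hcard : Nat.card (R.map (MulAut.conj g).toMonoidHom) = Nat.card R :=
    Subgroup.card_map_of_injective (MulAut.conj g).injective
  have hle : upperTri ⊥ ≤ R.map (MulAut.conj g).toMonoidHom := by
    rw [← hg]
    exact Subgroup.map_mono (Subgroup.map_subtype_le K)
  rcases eq_top_or_le_upperTri hle with h | h
  · refine absurd ?_ hR
    apply Subgroup.eq_top_of_card_eq
    rw [← hcard, h, Subgroup.card_top]
  · rw [← hcard, ← Nat.card_units, ← Subgroup.card_top (G := Fˣ), ← card_upperTri]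
    exact Subgroup.card_dvd_of_le h

/-- The case of a characteristic prime to the order of the complemented subgroup. -/
theorem succ_card_dvd_of_isComplement' [Finite F] {p n : ℕ} [Fact p.Prime]
    (hF : Nat.card F = p ^ n) {S I : Subgroup (PSLTwo F)} (h : S.IsComplement' I)
    (hI : Nat.card I ≠ 1) (hp : (Nat.card I).Coprime p) : Nat.card F + 1 ∣ Nat.card I := by
  have hc := card_comap_mul_card h
  have hF1 : 1 < Nat.card F := Finite.one_lt_card
  have hcop : (Nat.card F).Coprime (Nat.card I) := by
    rw [hF]
    exact (hp.pow_right n).symm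
  have hd : Nat.card F ∣ Nat.card (S.comap (QuotientGroup.mk' (Subgroup.center (SL2 F)))) :=
    hcop.dvd_of_dvd_mul_right (hc ▸ ⟨_, mul_assoc _ _ _⟩)
  have hR : S.comap (QuotientGroup.mk' (Subgroup.center (SL2 F))) ≠ ⊤ := by
    intro e
    rw [e, Subgroup.card_top, card_SL2] at hc
    have hpos : 0 < Nat.card F * (Nat.card F - 1) * (Nat.card F + 1) :=
      Nat.mul_pos (Nat.mul_pos (by omega) (by omega)) (by omega)
    exact hI (Nat.eq_of_mul_eq_mul_left hpos (by rw [hc, mul_one]))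
  obtain ⟨k, hk⟩ := card_dvd_of_card_dvd hF hR hd
  refine ⟨k, Nat.eq_of_mul_eq_mul_left Nat.card_pos (hc.trans ?_)⟩
  linear_combination (Nat.card F + 1) * hk

theorem exists_isComplement'_of_coprime [Finite F] (h2 : (2 : F) ≠ 0) {I : Subgroup (PSLTwo F)}
    {m : ℕ} (hm : m ∣ Nat.card F - 1) (hodd : (m * Nat.card F).Coprime 2)
    (hmI : (m * Nat.card F).Coprime (Nat.card I))
    (hc : m * Nat.card I * 2 = (Nat.card F - 1) * (Nat.card F + 1)) :
    ∃ S : Subgroup (PSLTwo F), Nat.card S = m * Nat.card F ∧ S.IsComplement' I := by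
  set T : Subgroup (SL2 F) := upperTri (powMonoidHom m : Fˣ →* Fˣ).ker
  have hT : Nat.card T = m * Nat.card F := by
    rw [card_upperTri, IsCyclic.card_powMonoidHom_ker, Nat.card_units, Nat.gcd_eq_right hm]
  have hinj : Function.Injective ((QuotientGroup.mk' (Subgroup.center (SL2 F))).comp T.subtype) := by
    rw [← MonoidHom.ker_eq_bot_iff, ← MonoidHom.comap_ker, QuotientGroup.ker_mk',
      ← Subgroup.subgroupOf, Subgroup.subgroupOf_eq_bot, disjoint_comm]
    apply Subgroup.disjoint_of_coprime_natCard
    rwa [hT, card_center_of_two_ne_zero h2]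
  have hS : Nat.card ((QuotientGroup.mk' (Subgroup.center (SL2 F))).comp T.subtype).range =
      m * Nat.card F := by
    rw [← hT]
    exact Nat.card_congr (MonoidHom.ofInjective hinj).symm.toEquiv
  refine ⟨_, hS, Subgroup.isComplement'_of_coprime ?_ (by rwa [hS])⟩
  have := card_PSL2_mul_two h2
  apply Nat.eq_of_mul_eq_mul_right two_pos
  rw [hS, this]
  linear_combination Nat.card F * hc

end SpecialLinearTwo

theorem mod_eight_of_odd {q s : ℕ} (hq : q % 2 = 1) (hs : ¬ 2 ∣ s)
    (h : s * 60 * 2 = q * (q - 1) * (q + 1)) : q % 8 = 3 ∨ q % 8 = 5 := by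
  obtain ⟨k, rfl⟩ : ∃ k, q = k + 1 := ⟨q - 1, by omega⟩
  have h1 : s * 60 * 2 % 16 = 8 := by omega
  rw [h, Nat.add_sub_cancel, Nat.mul_mod, Nat.mul_mod (k + 1), Nat.add_mod k, Nat.add_mod (k + 1),
    Nat.add_mod k] at h1
  have hk : k % 16 < 16 := Nat.mod_lt _ (by norm_num)
  have hk8 : k % 8 = k % 16 % 8 := by omega
  have hk2 : k % 2 = k % 16 % 2 := by omega
  generalize k % 16 = r at *
  interval_cases r <;> simp_all <;> omega

theorem three_pow_mod_forty (n : ℕ) :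
    3 ^ n % 40 = 1 ∨ 3 ^ n % 40 = 3 ∨ 3 ^ n % 40 = 9 ∨ 3 ^ n % 40 = 27 := by
  induction n with
  | zero => simp
  | succ k ih =>
    rw [pow_succ]
    omega

theorem natCast_eq_zero_iff_galoisField (p n : ℕ) [Fact p.Prime] (r : ℕ) :
    (r : GaloisField p n) = 0 ↔ p ∣ r := CharP.cast_eq_zero_iff _ p r

theorem stmt_19 (p n : ℕ) [Fact p.Prime] (hn : 0 < n)
    (I : Subgroup (Matrix.ProjectiveSpecialLinearGroup (Fin 2) (GaloisField p n)))
    (hI : Nonempty (↥I ≃* ↥(alternatingGroup (Fin 5)))) :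
    (∃ S : Subgroup (Matrix.ProjectiveSpecialLinearGroup (Fin 2) (GaloisField p n)),
        S ≠ ⊥ ∧ S.IsComplement' I) ↔
      (p ^ n = 11 ∨ p ^ n = 29 ∨ p ^ n = 59) := by
  have hp : p.Prime := Fact.out
  have hF : Nat.card (GaloisField p n) = p ^ n := GaloisField.card p n hn.ne'
  have hpq : p ∣ p ^ n := dvd_pow_self p hn.ne'
  have hI60 : Nat.card I = 60 := by
    obtain ⟨e⟩ := hI
    rw [Nat.card_congr e.toEquiv, nat_card_alternatingGroup, Nat.card_eq_fintype_card,
      Fintype.card_fin]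
    rfl
  have hchar (r : ℕ) (hr : r.Prime) : (r : GaloisField p n) = 0 ↔ p = r := by
    rw [natCast_eq_zero_iff_galoisField, Nat.prime_dvd_prime_iff_eq hp hr]
  have h2 := hchar 2 Nat.prime_two
  have h3 := hchar 3 Nat.prime_three
  have h5 := hchar 5 Nat.prime_five
  push_cast at h2 h3 h5
  constructor
  · rintro ⟨S, hS, hSI⟩
    have hodd : ¬ 2 ∣ Nat.card S := odd_card_of_isComplement' hSI (by rw [hI60]; norm_num)
    have hS1 : Nat.card S ≠ 1 := fun h => hS (Subgroup.card_eq_one.1 h)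
    have hcard := hSI.card_mul_card
    rw [hI60] at hcard
    by_cases hp2 : p = 2
    · exfalso
      subst hp2
      rw [card_PSL2_of_two_eq_zero (h2.2 rfl), hF] at hcard
      have hn3 : n < 3 := by
        by_contra! h
        obtain ⟨k, rfl⟩ := Nat.exists_eq_add_of_le h
        have : 2 ^ (3 + k) = 8 * 2 ^ k := by rw [pow_add]; norm_num
        rw [this, mul_assoc, mul_assoc] at hcard
        omega
      interval_cases n <;> omega
    have hq2 : p ^ n % 2 = 1 := Nat.odd_iff.1 ((hp.odd_of_ne_two hp2).pow)
    have hcard2 := card_PSL2_mul_two (mt h2.1 hp2)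
    rw [← hcard, hF] at hcard2
    have hq8 := mod_eight_of_odd hq2 hodd hcard2
    by_cases hp3 : p = 3
    · exfalso
      subst hp3
      have hmod : 3 ^ n % 40 = 1 ∨ 3 ^ n % 40 = 3 ∨ 3 ^ n % 40 = 9 ∨ 3 ^ n % 40 = 27 := three_pow_mod_forty n
      have h40 : 3 ^ n % 5 = 3 ∨ 3 ^ n % 5 = 2 := by omega
      have hq1 : (3 ^ n - 1) % 5 = 3 ^ n % 5 - 1 := by omega
      have h0 : 3 ^ n * (3 ^ n - 1) * (3 ^ n + 1) % 5 = 0 := by omega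
      rw [Nat.mul_mod, Nat.mul_mod (3 ^ n), Nat.add_mod, hq1] at h0
      rcases h40 with h | h <;> rw [h] at h0 <;> norm_num at h0
    by_cases hp5 : p = 5
    · exfalso
      subst hp5
      have hsq : ¬ IsSquare (2 : GaloisField 5 n) := by
        have := Fintype.ofFinite (GaloisField 5 n)
        rw [FiniteField.isSquare_two_iff, ← Nat.card_eq_fintype_card, hF]
        omega
      have hS5 := not_five_dvd_card_of_isComplement' (h5.2 rfl) hsq hSI (by rw [hI60]; norm_num)
      have hn2 : n < 2 := by
        by_contra! h
        obtain ⟨k, rfl⟩ := Nat.exists_eq_add_of_le h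
        have : 5 ^ (2 + k) = 25 * 5 ^ k := by rw [pow_add]; norm_num
        have : 25 ∣ Nat.card S * 60 * 2 := by
          rw [hcard2, this]
          exact (((Dvd.intro _ rfl).mul_right _).mul_right _)
        omega
      interval_cases n
      omega
    have hcop : Nat.Coprime 60 p := by
      rw [Nat.coprime_comm, hp.coprime_iff_not_dvd, show 60 = 2 * 2 * 3 * 5 by norm_num,
        hp.dvd_mul, hp.dvd_mul, hp.dvd_mul, Nat.prime_dvd_prime_iff_eq hp Nat.prime_two,
        Nat.prime_dvd_prime_iff_eq hp Nat.prime_three, Nat.prime_dvd_prime_iff_eq hp Nat.prime_five]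
      tauto
    have hdvd := succ_card_dvd_of_isComplement' hF hSI (by rw [hI60]; norm_num) (by rwa [hI60])
    rw [hF, hI60] at hdvd
    have h19 : p ^ n ≠ 19 := by
      intro h
      refine not_three_dvd_card_of_isComplement' (mt h2.1 hp2) (mt h3.1 hp3) hSI
        (by rw [hI60]; norm_num) ?_
      rw [h] at hcard2
      omega
    have hqcop : Nat.Coprime 60 (p ^ n) := hcop.pow_right n
    generalize p ^ n = q at hqcop hdvd h19 hq8
    have hle : q + 1 ≤ 60 := Nat.le_of_dvd (by norm_num) hdvd
    have hle : q ≤ 59 := by omega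
    clear * - hqcop hdvd h19 hq8 hle
    interval_cases q <;> first | omega | exact absurd hqcop (by decide)
  · intro hq
    have hp2 : (2 : GaloisField p n) ≠ 0 := by
      rw [Ne, h2]
      rintro rfl
      omega
    have key (m : ℕ) (hm : m ∣ p ^ n - 1) (hodd : (m * p ^ n).Coprime 2)
        (hmI : (m * p ^ n).Coprime 60) (hc : m * 60 * 2 = (p ^ n - 1) * (p ^ n + 1)) :
        ∃ S : Subgroup (Matrix.ProjectiveSpecialLinearGroup (Fin 2) (GaloisField p n)),
          S ≠ ⊥ ∧ S.IsComplement' I := by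
      rw [← hF] at hm hodd hmI hc
      rw [← hI60] at hmI hc
      obtain ⟨S, hS, hSI⟩ := exists_isComplement'_of_coprime hp2 hm hodd hmI hc
      refine ⟨S, ?_, hSI⟩
      rintro rfl
      rw [Subgroup.card_bot, hF] at hS
      exact hp.one_lt.ne' (Nat.dvd_one.1 (hpq.trans (Dvd.intro_left m hS.symm)))
    rcases hq with hq | hq | hq <;> rw [hq] at key
    · exact key 1 (by norm_num) (by norm_num) (by norm_num) (by norm_num)
    · exact key 7 (by norm_num) (by norm_num) (by norm_num) (by norm_num)
    · exact key 29 (by norm_num) (by norm_num) (by norm_num) (by norm_num)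
end
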